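/- Main upper bound (Theorem 2, in dyadically decomposed form). There exists a constant C > 0, depending only on n, s, γ, C_Φ and c_b, such that the following holds. For every kernel b satisfying the standing kernel assumptions, every measurable g : ℝⁿ → ℝ satisfying Assumption U with constant C_g > 0, and all Schwartz functions f, h : ℝⁿ → ℝ: for every k ∈ ℤ the function (v, v_*, σ) ↦ B(v-v_*,σ)·1_{(2^{-k-1}, 2^{-k}]}(|v'-v|)·g(v_*)·f(v)·(h(v')-h(v)) is absolutely integrable on ℝⁿ × ℝⁿ × S^{n-1}, and, denoting its integral by T_k(f,h), one has Σ_{k∈ℤ} |T_k(f,h)| ≤ C · C_g · |f|_{N^{s,γ}} · |h|_{N^{s,γ}}. (The sum Σ_k T_k(f,h) is the weak form ⟨Q(g,f), h⟩ of the Boltzmann collision operator.) -/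

import Mathlib

open MeasureTheory Real Set Metric
open scoped ENNReal RealInnerProductSpace

noncomputable section

/-- `ℝⁿ` with the Euclidean structure. -/
abbrev V (n : ℕ) := EuclideanSpace ℝ (Fin n)

/-- the Japanese bracket `⟨v⟩ = √(1+|v|²)`. -/
def jap {n : ℕ} (v : V n) : ℝ := Real.sqrt (1 + ‖v‖ ^ 2)

/-- the post-collisional velocity `v' = (v+v_*)/2 + (|v-v_*|/2)σ`. -/
def vprime {n : ℕ} (v vs σ : V n) : V n :=
  (2:ℝ)⁻¹ • (v + vs) + (‖v - vs‖ / 2) • σ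

/-- the anisotropic metric `d(v,v') = √(|v-v'|² + ¼(|v|²-|v'|²)²)` on the lifted paraboloid. -/
def anisoDist {n : ℕ} (v v' : V n) : ℝ :=
  Real.sqrt (‖v - v'‖ ^ 2 + 4⁻¹ * (‖v‖ ^ 2 - ‖v'‖ ^ 2) ^ 2)

/-- The standing assumptions on the angular kernel `b`: measurability, nonnegativity,
vanishing for deviation angles `θ ∈ (π/2, π]`, and the two-sided power bound
`c_b θ^{-(1+2s)} ≤ sin^{n-2}θ · b(cos θ) ≤ c_b⁻¹ θ^{-(1+2s)}` on `(0, π/2]`. -/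
def KernelAssumptions (n : ℕ) (s cb : ℝ) (b : ℝ → ℝ) : Prop :=
  Measurable b ∧ (∀ t : ℝ, 0 ≤ b t) ∧
  (∀ θ : ℝ, θ ∈ Set.Ioc (π / 2) π → b (Real.cos θ) = 0) ∧
  (∀ θ : ℝ, θ ∈ Set.Ioc 0 (π / 2) →
    cb * θ ^ (-(1 + 2 * s)) ≤ Real.sin θ ^ ((n : ℝ) - 2) * b (Real.cos θ) ∧
    Real.sin θ ^ ((n : ℝ) - 2) * b (Real.cos θ) ≤ cb⁻¹ * θ ^ (-(1 + 2 * s)))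

/-- The Boltzmann collision kernel `B(v-v_*,σ) = C_Φ |v-v_*|^γ b(⟨(v-v_*)/|v-v_*|, σ⟩)`. -/
def Bker {n : ℕ} (CΦ γ : ℝ) (b : ℝ → ℝ) (v vs σ : V n) : ℝ :=
  CΦ * ‖v - vs‖ ^ γ * b ⟪‖v - vs‖⁻¹ • (v - vs), σ⟫

/-- the surface measure on the unit sphere `S^{n-1}`. -/
def sphMeas (n : ℕ) : Measure (Metric.sphere (0 : V n) 1) :=
  (volume : Measure (V n)).toSphere

/-- the weighted squared `L²` norm `|f|²_{L²_ℓ}`, as a value in `[0,∞]`. -/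
def L2e {n : ℕ} (ℓ : ℝ) (f : V n → ℝ) : ℝ≥0∞ :=
  ∫⁻ v : V n, ENNReal.ofReal (jap v ^ ℓ * f v ^ 2)

/-- Assumption U: with `i = 1` for `s ∈ (0,1/2)` and `i = 2` for `s ∈ [1/2,1)`,
`∫ |v-v_*|^a ⟨v_*⟩^i |g(v_*)| dv_* ≤ C_g ⟨v⟩^a` for all `v` and all `a ∈ [γ, γ+2s]`. -/
def AssumptionU {n : ℕ} (s γ Cg : ℝ) (g : V n → ℝ) : Prop :=
  ∀ v : V n, ∀ a ∈ Set.Icc γ (γ + 2 * s),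
    (∫⁻ vs : V n, ENNReal.ofReal
        (‖v - vs‖ ^ a * jap vs ^ (if s < 2⁻¹ then (1:ℝ) else 2) * |g vs|)) ≤
      ENNReal.ofReal (Cg * jap v ^ a)

/-- the anisotropic seminorm `|f|²_{Ṅ^{s,γ}}`, as a value in `[0,∞]`. -/
def NdotSq {n : ℕ} (s γ : ℝ) (f : V n → ℝ) : ℝ≥0∞ :=
  ∫⁻ v : V n, ∫⁻ v' : V n, (if anisoDist v v' ≤ 1 then
    ENNReal.ofReal ((jap v * jap v') ^ ((γ + 2 * s + 1) / 2) * (f v' - f v) ^ 2 *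
      anisoDist v v' ^ (-((n : ℝ) + 2 * s))) else 0)

/-- the product measure on `ℝⁿ × ℝⁿ × S^{n-1}`. -/
def collMeas (n : ℕ) : Measure (V n × V n × Metric.sphere (0 : V n) 1) :=
  (volume : Measure (V n)).prod ((volume : Measure (V n)).prod (sphMeas n))

/-- the integrand of the dyadic piece `T_k(f,h)` of the weak form `⟨Q(g,f),h⟩`. -/
def Tker {n : ℕ} (CΦ γ : ℝ) (b : ℝ → ℝ) (g f h : V n → ℝ) (k : ℤ)
    (p : V n × V n × Metric.sphere (0 : V n) 1) : ℝ :=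
  Bker CΦ γ b p.1 p.2.1 p.2.2 *
    Set.indicator (Set.Ioc ((2:ℝ) ^ (-k - 1)) ((2:ℝ) ^ (-k))) (fun _ => (1:ℝ))
      ‖vprime p.1 p.2.1 p.2.2 - p.1‖ *
    g p.2.1 * f p.1 * (h (vprime p.1 p.2.1 p.2.2) - h p.1)

instance sph_fin (n : ℕ) : IsFiniteMeasure (sphMeas n) := by
  unfold sphMeas; infer_instance

lemma polar_lintegral {n : ℕ} (hn : 1 ≤ n) (F : V n → ℝ≥0∞) (hF : Measurable F) :
    ∫⁻ x, F x = ∫⁻ ω, ∫⁻ r in Ioi (0:ℝ), ENNReal.ofReal (r ^ (n-1)) * F (r • (ω : V n)) ∂volume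
      ∂(sphMeas n) := by
  have : Nonempty (Fin n) := ⟨⟨0, hn⟩⟩
  have hfr : Module.finrank ℝ (V n) = n := by simp
  have h1 : ∫⁻ x, F x = ∫⁻ x : ({(0)}ᶜ : Set (V n)), F x.1 ∂((volume : Measure (V n)).comap (↑)) := by
    rw [lintegral_subtype_comap (measurableSet_singleton _).compl F,
        restrict_compl_singleton]
  have h2 := (volume : Measure (V n)).measurePreserving_homeomorphUnitSphereProd.lintegral_comp_emb
        (Homeomorph.measurableEmbedding _) (fun p => F (p.2.1 • p.1.1))
  have h3 : ∀ x : ({(0)}ᶜ : Set (V n)), ((homeomorphUnitSphereProd (V n)) x).2.1 • ((homeomorphUnitSphereProd (V n)) x).1.1 = x.1 := by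
    intro x
    have : ‖(x:V n)‖ ≠ 0 := norm_ne_zero_iff.2 (fun h => x.2 h)
    simp [homeomorphUnitSphereProd, smul_smul, this]
  simp only [h3] at h2
  rw [h1, h2, lintegral_prod _ (by fun_prop)]
  unfold sphMeas
  refine lintegral_congr fun ω => ?_
  rw [Measure.volumeIoiPow, lintegral_withDensity_eq_lintegral_mul _ (by fun_prop) (by fun_prop), hfr]
  have := lintegral_subtype_comap (μ := volume) (measurableSet_Ioi (a := (0:ℝ))) (fun r : ℝ => ENNReal.ofReal (r ^ (n-1)) * F (r • (ω : V n)))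
  rw [← this]
  rfl

lemma det_rankone {n : ℕ} (φ : V n →L[ℝ] ℝ) (e : V n) :
    (ContinuousLinearMap.id ℝ (V n) + φ.smulRight e).det = 1 + φ e := by
  have := LinearMap.transvection.det (R := ℝ) (V := V n) (φ : V n →ₗ[ℝ] ℝ) e
  rw [ContinuousLinearMap.det, ← ContinuousLinearMap.coe_coe φ, ← this]
  congr 1

lemma lint_pow (n : ℕ) (hn : 1 ≤ n) (a : ℝ) (ha : 0 ≤ a) :
    ∫⁻ r in Ioo (0:ℝ) a, ENNReal.ofReal (r ^ (n-1)) = ENNReal.ofReal (a ^ n / n) := by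
  rw [Measure.restrict_congr_set Ioo_ae_eq_Ioc,
    ← ofReal_integral_eq_lintegral_ofReal (intervalIntegral.intervalIntegrable_pow _).1, ← intervalIntegral.integral_of_le ha]
  · simp only [integral_pow]
    congr 1
    rw [Nat.sub_add_cancel hn, zero_pow (by omega), Nat.cast_sub hn]
    simp
  · filter_upwards [ae_restrict_mem measurableSet_Ioc] with y hy
    exact pow_nonneg hy.1.le _

lemma lint_pow_ind (n : ℕ) (hn : 1 ≤ n) (a : ℝ) (ha : 0 ≤ a) (c : ℝ≥0∞) :
    ∫⁻ r in Ioi (0:ℝ), ENNReal.ofReal (r ^ (n-1)) * (if r < a then c else 0) = ENNReal.ofReal (a ^ n / n) * c := by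
  rw [← lint_pow n hn a ha, ← lintegral_mul_const _ (by fun_prop), ← Ioi_inter_Iio, inter_comm,
    ← Measure.restrict_restrict measurableSet_Iio, ← lintegral_indicator measurableSet_Iio]
  refine lintegral_congr fun r => ?_
  by_cases h : r < a <;> simp [h, indicator]

def Gmap {n : ℕ} (e : V n) (w : V n) : V n := w - (‖w‖ ^ 2 / (2 * ⟪e, w⟫)) • e

lemma Gmap_norm {n : ℕ} (e : V n) (he : ‖e‖ = 1) (w : V n) (hw : 0 < ⟪e, w⟫) :
    ‖Gmap e w‖ = ‖w‖ ^ 2 / (2 * ⟪e, w⟫) := by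
  have h0 : 0 ≤ ‖w‖ ^ 2 / (2 * ⟪e, w⟫) := by positivity
  rw [← sq_eq_sq₀ (norm_nonneg _) h0, Gmap, norm_sub_sq_real, inner_smul_right, real_inner_comm e w, norm_smul, he]
  rw [Real.norm_of_nonneg h0]
  field_simp
  ring

lemma Gmap_inj {n : ℕ} (e : V n) (he : ‖e‖ = 1) : InjOn (Gmap e) {w | 0 < ⟪e, w⟫} := by
  intro w hw w' hw' h
  have h1 := Gmap_norm e he w hw
  have h2 := Gmap_norm e he w' hw'
  have h3 := h
  rw [h] at h1
  rw [Gmap, Gmap, ← h1, ← h2] at h3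
  simpa using h3

lemma Gmap_image {n : ℕ} (e : V n) (he : ‖e‖ = 1) :
    Gmap e '' {w | 0 < ⟪e, w⟫} = {y | 0 < ⟪e, y⟫ + ‖y‖} := by
  ext y
  constructor
  · rintro ⟨w, hw, rfl⟩
    have := Gmap_norm e he w hw
    simp only [mem_ofPred_eq] at hw ⊢
    rw [this]
    simp only [Gmap, inner_sub_right, inner_smul_right, real_inner_self_eq_norm_sq, he]
    linarith
  · intro hy
    simp only [mem_ofPred_eq] at hy
    have h1 : ⟪e, y + ‖y‖ • e⟫ = ⟪e, y⟫ + ‖y‖ := by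
      simp [inner_add_right, inner_smul_right, real_inner_self_eq_norm_sq, he]
    refine ⟨y + ‖y‖ • e, by simpa [h1] using hy, ?_⟩
    rw [Gmap, h1, norm_add_sq_real, inner_smul_right, real_inner_comm, norm_smul, he]
    simp only [norm_norm]
    have : (‖y‖ ^ 2 + 2 * (‖y‖ * ⟪e, y⟫) + (‖y‖ * 1) ^ 2) / (2 * (⟪e, y⟫ + ‖y‖)) = ‖y‖ := by
      field_simp
      ring
    rw [this]; simp

lemma ray_null {n : ℕ} (hn : 2 ≤ n) (e : V n) (he : ‖e‖ = 1) :
    volume ({y : V n | 0 < ⟪e, y⟫ + ‖y‖}ᶜ) = 0 := by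
  have hs : ({y : V n | 0 < ⟪e, y⟫ + ‖y‖}ᶜ) ⊆ (Submodule.span ℝ {e} : Submodule ℝ (V n)) := by
    intro y hy
    simp only [mem_compl_iff, mem_ofPred_eq, not_lt] at hy
    rw [SetLike.mem_coe, Submodule.mem_span_singleton]
    refine ⟨-‖y‖, ?_⟩
    have : ‖y + ‖y‖ • e‖ ^ 2 ≤ 0 := by
      rw [norm_add_sq_real, inner_smul_right, real_inner_comm, norm_smul, he]
      simp only [norm_norm]
      nlinarith [norm_nonneg y]
    have h2 : y + ‖y‖ • e = 0 := by
      rw [← norm_eq_zero]; nlinarith [norm_nonneg (y + ‖y‖ • e)]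
    rw [neg_smul]; exact (eq_neg_of_add_eq_zero_left h2).symm
  refine measure_mono_null hs (Measure.addHaar_submodule _ _ ?_)
  intro htop
  have h1 := finrank_span_le_card (R := ℝ) ({e} : Set (V n))
  rw [htop] at h1
  simp at h1
  omega

lemma Gmap_deriv {n : ℕ} (e : V n) (w : V n) (hw : 0 < ⟪e, w⟫) :
    HasFDerivAt (Gmap e) (ContinuousLinearMap.id ℝ (V n) +
      (-((2 * ⟪e, w⟫)⁻¹ • ((2:ℝ) • innerSL ℝ w) - (‖w‖^2 / (2 * ⟪e,w⟫)^2) • ((2:ℝ) • innerSL ℝ e))).smulRight e) w := by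
  have h1 : HasFDerivAt (fun w : V n => ‖w‖ ^ 2) ((2:ℝ) • innerSL ℝ w) w := by
    have := (hasStrictFDerivAt_norm_sq w).hasFDerivAt
    refine this.congr_fderiv ?_
    ext x; simp
  have h2 : HasFDerivAt (fun w : V n => 2 * ⟪e, w⟫) ((2:ℝ) • innerSL ℝ e) w := by
    simpa using ((innerSL ℝ e).hasFDerivAt (x := w)).const_mul 2
  have h3 := h1.mul ((hasDerivAt_inv (x := 2 * ⟪e, w⟫) (by positivity)).comp_hasFDerivAt w h2)
  have h4 := (hasFDerivAt_id w).sub (h3.smul_const e)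
  refine h4.congr_fderiv ?_
  ext x
  simp
  ring

lemma Gmap_det {n : ℕ} (e : V n) (he : ‖e‖ = 1) (w : V n) (hw : 0 < ⟪e, w⟫) :
    (ContinuousLinearMap.id ℝ (V n) +
      (-((2 * ⟪e, w⟫)⁻¹ • ((2:ℝ) • innerSL ℝ w) - (‖w‖^2 / (2 * ⟪e,w⟫)^2) • ((2:ℝ) • innerSL ℝ e))).smulRight e).det
      = ‖w‖ ^ 2 / (2 * ⟪e, w⟫ ^ 2) := by
  rw [det_rankone]
  simp [he]
  rw [real_inner_comm e w]
  field_simp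
  ring

lemma sigma_omega {n : ℕ} (hn : 2 ≤ n) (e : V n) (he : ‖e‖ = 1) (Ψ : V n → ℝ≥0∞) (hΨ : Measurable Ψ) :
    ∫⁻ σ, Ψ σ ∂(sphMeas n) = ∫⁻ ω, (if 0 < ⟪e, (ω : V n)⟫ then
      ENNReal.ofReal (2 ^ (n-1) * ⟪e, (ω : V n)⟫ ^ (n-2)) * Ψ ((2 * ⟪e, (ω : V n)⟫) • (ω : V n) - e) else 0) ∂(sphMeas n) := by
  have hn1 : 1 ≤ n := by omega
  let F : V n → ℝ≥0∞ := fun y => if ‖y‖ < 1 then Ψ (‖y‖⁻¹ • y) else 0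
  have hF : Measurable F := Measurable.ite (measurableSet_lt (by fun_prop) (by fun_prop)) (by fun_prop) (by fun_prop)
  have hms : MeasurableSet {w : V n | 0 < ⟪e, w⟫} := measurableSet_lt (by fun_prop) (by fun_prop)
  have h1 : ∫⁻ y, F y = ENNReal.ofReal (1 / n) * ∫⁻ σ, Ψ σ ∂(sphMeas n) := by
    rw [polar_lintegral hn1 F hF, ← lintegral_const_mul _ (by fun_prop)]
    refine lintegral_congr fun ω => ?_
    have hω : ‖(ω : V n)‖ = 1 := by simp
    have := lint_pow_ind n hn1 1 zero_le_one (Ψ ω)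
    rw [one_pow] at this
    rw [← this]
    refine setLIntegral_congr_fun measurableSet_Ioi fun r hr => ?_
    have hr' : (0:ℝ) < r := hr
    simp only [F, norm_smul, hω, Real.norm_of_nonneg hr'.le, mul_one, smul_smul, inv_mul_cancel₀ hr'.ne', one_smul]
  have h2 : ∫⁻ y, F y = ∫⁻ w in {w : V n | 0 < ⟪e, w⟫}, ENNReal.ofReal (‖w‖ ^ 2 / (2 * ⟪e, w⟫ ^ 2)) * F (Gmap e w) := by
    have h := lintegral_image_eq_lintegral_abs_det_fderiv_mul volume hms
      (fun w hw => (Gmap_deriv e w hw).hasFDerivWithinAt) (Gmap_inj e he) F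
    rw [Gmap_image e he, setLIntegral_congr (t := univ), setLIntegral_univ] at h
    · rw [h]
      refine setLIntegral_congr_fun hms fun w hw => ?_
      have hw' : 0 < ⟪e, w⟫ := hw
      simp only []
      rw [Gmap_det e he w hw, abs_of_nonneg (by positivity)]
    · rw [ae_eq_univ]; exact ray_null hn e he
  have h3 : ∫⁻ y, F y = ENNReal.ofReal (1 / n) * ∫⁻ ω, (if 0 < ⟪e, (ω : V n)⟫ then
      ENNReal.ofReal (2 ^ (n-1) * ⟪e, (ω : V n)⟫ ^ (n-2)) * Ψ ((2 * ⟪e, (ω : V n)⟫) • (ω : V n) - e) else 0) ∂(sphMeas n) := by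
    have hG : Measurable (Gmap e) := by unfold Gmap; fun_prop
    rw [h2, ← lintegral_indicator hms, polar_lintegral hn1 _ (Measurable.indicator (by fun_prop) hms)]
    rw [← lintegral_const_mul]
    swap
    · exact Measurable.ite (measurableSet_lt (by fun_prop) (by fun_prop)) (by fun_prop) (by fun_prop)
    refine lintegral_congr fun ω => ?_
    have hω : ‖(ω : V n)‖ = 1 := by simp
    by_cases hc : 0 < ⟪e, (ω : V n)⟫
    · set c := ⟪e, (ω : V n)⟫ with hcdef
      rw [if_pos hc]
      have := lint_pow_ind n hn1 (2 * c) (by positivity) (ENNReal.ofReal (1 / (2 * c^2)) * Ψ ((2 * c) • (ω : V n) - e))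
      have e1 : ENNReal.ofReal (1 / n) * (ENNReal.ofReal (2 ^ (n-1) * c ^ (n-2)) * Ψ ((2 * c) • (ω : V n) - e))
         = ENNReal.ofReal ((2 * c)^n / n) * (ENNReal.ofReal (1 / (2 * c^2)) * Ψ ((2 * c) • (ω : V n) - e)) := by
        rw [← mul_assoc, ← mul_assoc, ← ENNReal.ofReal_mul (by positivity), ← ENNReal.ofReal_mul (by positivity)]
        congr 2
        obtain ⟨m, rfl⟩ : ∃ m, n = m + 2 := ⟨n - 2, by omega⟩
        have : m + 2 - 1 = m + 1 := by omega
        rw [this]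
        simp only [Nat.add_sub_cancel]
        field_simp
        ring
      rw [e1, ← this]
      refine setLIntegral_congr_fun measurableSet_Ioi fun r hr => ?_
      have hr' : (0:ℝ) < r := hr
      have hin : ⟪e, r • (ω : V n)⟫ = r * c := by rw [inner_smul_right]
      have hmem : r • (ω : V n) ∈ {w : V n | 0 < ⟪e, w⟫} := by
        simp only [mem_ofPred_eq, hin]; positivity
      rw [indicator_of_mem hmem]
      congr 1
      have hnG := Gmap_norm e he (r • (ω : V n)) (by rw [hin]; positivity)
      have hnw : ‖r • (ω : V n)‖ = r := by rw [norm_smul, hω, Real.norm_of_nonneg hr'.le, mul_one]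
      rw [hin, hnw] at hnG
      have hnG' : ‖Gmap e (r • (ω : V n))‖ = r / (2 * c) := by rw [hnG]; field_simp
      simp only [F]
      rw [hin, hnG', hnw]
      have hdiv : (r / (2 * c) < 1) ↔ r < 2 * c := by rw [div_lt_one (by positivity)]
      simp only [hdiv]
      by_cases hlt : r < 2 * c
      · simp only [hlt, if_true]
        congr 2
        · field_simp
        · rw [Gmap, hnw, hin, smul_sub, smul_smul, smul_smul]
          congr 2
          · field_simp
          · rw [show (r / (2*c))⁻¹ * (r^2/(2 * (r * c))) = 1 by field_simp, one_smul]
      · simp [hlt]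
    · rw [if_neg hc, mul_zero, lintegral_eq_zero_iff']
      · filter_upwards [ae_restrict_mem measurableSet_Ioi] with r hr
        have hr' : (0:ℝ) < r := hr
        rw [indicator_of_notMem]
        · simp
        · simp only [mem_ofPred_eq, inner_smul_right, not_lt]
          exact mul_nonpos_of_nonneg_of_nonpos hr'.le (not_lt.1 hc)
      · refine Measurable.aemeasurable (Measurable.mul (by fun_prop) ?_)
        exact (Measurable.indicator (by fun_prop) hms).comp (by fun_prop)
  rw [h1] at h3
  have hn0 : (0:ℝ) < 1 / n := by have : (0:ℝ) < n := by exact_mod_cast hn1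
                                 positivity
  exact (ENNReal.mul_right_inj (ENNReal.ofReal_pos.2 hn0).ne' ENNReal.ofReal_ne_top).1 h3

lemma scale_Ioi (n : ℕ) (hn : 1 ≤ n) (c : ℝ) (hc : 0 < c) (φ : ℝ → ℝ≥0∞) :
    ∫⁻ r in Ioi (0:ℝ), ENNReal.ofReal (r ^ (n-1)) * φ r =
    ∫⁻ r in Ioi (0:ℝ), ENNReal.ofReal (r ^ (n-1)) * (ENNReal.ofReal ((c ^ n)⁻¹) * φ (r / c)) := by
  have himg : (fun r : ℝ => r / c) '' Ioi 0 = Ioi 0 := by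
    ext x
    constructor
    · rintro ⟨y, hy, rfl⟩
      exact div_pos hy hc
    · intro hx
      exact ⟨x * c, mul_pos hx hc, by field_simp⟩
  have := lintegral_image_eq_lintegral_abs_deriv_mul (f := fun r : ℝ => r / c) (f' := fun _ => 1 / c) (s := Ioi 0) measurableSet_Ioi
    (fun x _ => ((hasDerivAt_id x).div_const c).hasDerivWithinAt)
    (fun x _ y _ h => by simpa [div_left_inj' hc.ne'] using h) (fun r => ENNReal.ofReal (r ^ (n-1)) * φ r)
  rw [himg] at this
  rw [this]
  refine setLIntegral_congr_fun measurableSet_Ioi fun r hr => ?_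
  have hr' : (0:ℝ) < r := hr
  rw [← mul_assoc, ← mul_assoc, ← ENNReal.ofReal_mul (by positivity), ← ENNReal.ofReal_mul (by positivity)]
  congr 2
  rw [abs_of_nonneg (by positivity)]
  obtain ⟨m, rfl⟩ : ∃ m, n = m + 1 := ⟨n - 1, by omega⟩
  simp only [Nat.add_sub_cancel]
  rw [div_pow]
  field_simp
  ring

lemma swap_lintegral {n : ℕ} (hn : 1 ≤ n) (G : V n → V n → ℝ≥0∞) (hG : Measurable (Function.uncurry G)) :
    ∫⁻ z, ∫⁻ ω, (if 0 < ⟪z, (ω : V n)⟫ then G z (⟪z, (ω : V n)⟫ • (ω : V n)) else 0) ∂(sphMeas n)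
    = ∫⁻ z, ∫⁻ ω, (if 0 < ⟪z, (ω : V n)⟫ then
        ENNReal.ofReal (((⟪z, (ω : V n)⟫ / ‖z‖) ^ n)⁻¹) *
          G ((‖z‖ / (⟪z, (ω : V n)⟫ / ‖z‖)) • (ω : V n)) z else 0) ∂(sphMeas n) := by
  have hG2 : ∀ {α : Type} [MeasurableSpace α] (f g : α → V n), Measurable f → Measurable g →
      Measurable (fun x => G (f x) (g x)) := fun f g hf hg => hG.comp (hf.prodMk hg)
  let X : sphere (0 : V n) 1 → sphere (0 : V n) 1 → ℝ≥0∞ := fun η ω =>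
    if 0 < ⟪(η : V n), (ω : V n)⟫ then ∫⁻ r in Ioi (0:ℝ), ENNReal.ofReal (r ^ (n-1)) *
      (G (r • (η : V n)) ((r * ⟪(η : V n), (ω : V n)⟫) • (ω : V n))) else 0
  have hX : Measurable (Function.uncurry X) := by
    refine Measurable.ite (measurableSet_lt (by fun_prop) (by fun_prop)) ?_ measurable_const
    refine Measurable.lintegral_prod_right' (f := fun (q : (sphere (0 : V n) 1 × sphere (0 : V n) 1) × ℝ) => ENNReal.ofReal (q.2 ^ (n-1)) *
      (G (q.2 • (q.1.1 : V n)) ((q.2 * ⟪(q.1.1 : V n), (q.1.2 : V n)⟫) • (q.1.2 : V n)))) ?_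
    refine Measurable.mul (by fun_prop) (hG2 _ _ (by fun_prop) (by fun_prop))
  have h1 : ∫⁻ z, ∫⁻ ω, (if 0 < ⟪z, (ω : V n)⟫ then G z (⟪z, (ω : V n)⟫ • (ω : V n)) else 0) ∂(sphMeas n)
      = ∫⁻ η, ∫⁻ ω, X η ω ∂(sphMeas n) ∂(sphMeas n) := by
    rw [polar_lintegral hn]
    · refine lintegral_congr fun η => ?_
      have : ∀ r : ℝ, ENNReal.ofReal (r ^ (n-1)) * ∫⁻ ω, (if 0 < ⟪r • (η : V n), (ω : V n)⟫ then G (r • (η : V n)) (⟪r • (η : V n), (ω : V n)⟫ • (ω : V n)) else 0) ∂(sphMeas n)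
        = ∫⁻ ω, ENNReal.ofReal (r ^ (n-1)) * (if 0 < ⟪r • (η : V n), (ω : V n)⟫ then G (r • (η : V n)) (⟪r • (η : V n), (ω : V n)⟫ • (ω : V n)) else 0) ∂(sphMeas n) := by
        intro r
        rw [lintegral_const_mul]
        exact Measurable.ite (measurableSet_lt (by fun_prop) (by fun_prop)) (hG2 _ _ (by fun_prop) (by fun_prop)) measurable_const
      simp only [this]
      rw [lintegral_lintegral_swap]
      · refine lintegral_congr fun ω => ?_
        by_cases hc : 0 < ⟪(η : V n), (ω : V n)⟫
        · simp only [X, if_pos hc]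
          refine setLIntegral_congr_fun measurableSet_Ioi fun r hr => ?_
          have hr' : (0:ℝ) < r := hr
          have : 0 < r * ⟪(η : V n), (ω : V n)⟫ := by positivity
          simp only [real_inner_smul_left, if_pos this]
        · simp only [X, if_neg hc]
          rw [setLIntegral_congr_fun (g := fun _ => 0) measurableSet_Ioi, lintegral_zero]
          intro r hr
          have hr' : (0:ℝ) < r := hr
          have : ¬ 0 < r * ⟪(η : V n), (ω : V n)⟫ := by
            rw [mul_pos_iff_of_pos_left hr']; exact hc
          simp only [real_inner_smul_left, if_neg this, mul_zero]
      · refine Measurable.aemeasurable (Measurable.mul (by fun_prop) ?_)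
        exact Measurable.ite (measurableSet_lt (by fun_prop) (by fun_prop)) (hG2 _ _ (by fun_prop) (by fun_prop)) measurable_const
    · refine Measurable.lintegral_prod_right' (f := fun (q : V n × sphere (0 : V n) 1) => if 0 < ⟪q.1, (q.2 : V n)⟫ then G q.1 (⟪q.1, (q.2 : V n)⟫ • (q.2 : V n)) else 0) ?_
      exact Measurable.ite (measurableSet_lt (by fun_prop) (by fun_prop)) (hG2 _ _ (by fun_prop) (by fun_prop)) measurable_const
  have h2 : ∫⁻ z, ∫⁻ ω, (if 0 < ⟪z, (ω : V n)⟫ then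
        ENNReal.ofReal (((⟪z, (ω : V n)⟫ / ‖z‖) ^ n)⁻¹) *
          G ((‖z‖ / (⟪z, (ω : V n)⟫ / ‖z‖)) • (ω : V n)) z else 0) ∂(sphMeas n)
      = ∫⁻ η, ∫⁻ ω, X ω η ∂(sphMeas n) ∂(sphMeas n) := by
    rw [polar_lintegral hn]
    · refine lintegral_congr fun η => ?_
      have hη : ‖(η : V n)‖ = 1 := by simp
      have : ∀ r : ℝ, ENNReal.ofReal (r ^ (n-1)) * ∫⁻ ω, (if 0 < ⟪r • (η : V n), (ω : V n)⟫ then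
        ENNReal.ofReal (((⟪r • (η : V n), (ω : V n)⟫ / ‖r • (η : V n)‖) ^ n)⁻¹) *
          G ((‖r • (η : V n)‖ / (⟪r • (η : V n), (ω : V n)⟫ / ‖r • (η : V n)‖)) • (ω : V n)) (r • (η : V n)) else 0) ∂(sphMeas n)
        = ∫⁻ ω, ENNReal.ofReal (r ^ (n-1)) * (if 0 < ⟪r • (η : V n), (ω : V n)⟫ then
        ENNReal.ofReal (((⟪r • (η : V n), (ω : V n)⟫ / ‖r • (η : V n)‖) ^ n)⁻¹) *
          G ((‖r • (η : V n)‖ / (⟪r • (η : V n), (ω : V n)⟫ / ‖r • (η : V n)‖)) • (ω : V n)) (r • (η : V n)) else 0) ∂(sphMeas n) := by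
        intro r
        rw [lintegral_const_mul]
        exact Measurable.ite (measurableSet_lt (by fun_prop) (by fun_prop)) (Measurable.mul (by fun_prop) (hG2 _ _ (by fun_prop) (by fun_prop))) measurable_const
      simp only [this]
      rw [lintegral_lintegral_swap]
      · refine lintegral_congr fun ω => ?_
        by_cases hc : 0 < ⟪(η : V n), (ω : V n)⟫
        · have hc' : 0 < ⟪(ω : V n), (η : V n)⟫ := by rwa [real_inner_comm]
          simp only [X, if_pos hc']
          conv_rhs => rw [scale_Ioi n hn _ hc']
          refine setLIntegral_congr_fun measurableSet_Ioi fun r hr => ?_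
          have hr' : (0:ℝ) < r := hr
          have : 0 < r * ⟪(η : V n), (ω : V n)⟫ := by positivity
          simp only [real_inner_smul_left, if_pos this, norm_smul, hη, Real.norm_of_nonneg hr'.le, mul_one]
          rw [mul_div_cancel_left₀ _ hr'.ne', real_inner_comm (ω : V n) (η : V n), div_mul_cancel₀ _ hc'.ne']
        · have hc' : ¬ 0 < ⟪(ω : V n), (η : V n)⟫ := by rwa [real_inner_comm]
          simp only [X, if_neg hc']
          rw [setLIntegral_congr_fun (g := fun _ => 0) measurableSet_Ioi, lintegral_zero]
          intro r hr
          have hr' : (0:ℝ) < r := hr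
          have : ¬ 0 < r * ⟪(η : V n), (ω : V n)⟫ := by
            rw [mul_pos_iff_of_pos_left hr']; exact hc
          simp only [real_inner_smul_left, if_neg this, mul_zero]
      · refine Measurable.aemeasurable (Measurable.mul (by fun_prop) ?_)
        exact Measurable.ite (measurableSet_lt (by fun_prop) (by fun_prop)) (Measurable.mul (by fun_prop) (hG2 _ _ (by fun_prop) (by fun_prop))) measurable_const
    · refine Measurable.lintegral_prod_right' (f := fun (q : V n × sphere (0 : V n) 1) => if 0 < ⟪q.1, (q.2 : V n)⟫ then
        ENNReal.ofReal (((⟪q.1, (q.2 : V n)⟫ / ‖q.1‖) ^ n)⁻¹) *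
          G ((‖q.1‖ / (⟪q.1, (q.2 : V n)⟫ / ‖q.1‖)) • (q.2 : V n)) q.1 else 0) ?_
      exact Measurable.ite (measurableSet_lt (by fun_prop) (by fun_prop)) (Measurable.mul (by fun_prop) (hG2 _ _ (by fun_prop) (by fun_prop))) measurable_const
  rw [h1, h2, lintegral_lintegral_swap hX.aemeasurable]

lemma split_mp (m : ℕ) : MeasurePreserving
    (fun y : V (m+1) => ((y 0, WithLp.toLp 2 (fun j : Fin m => y j.succ)) : ℝ × V m)) := by
  have h1 := PiLp.volume_preserving_ofLp (Fin (m+1))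
  have h2 := volume_preserving_piFinSuccAbove (fun _ : Fin (m+1) => ℝ) 0
  have h3 := (MeasurePreserving.id (volume : Measure ℝ)).prod (PiLp.volume_preserving_toLp (Fin m))
  exact h3.comp (h2.comp h1)

lemma split_norm (m : ℕ) (y : V (m+1)) :
    ‖y‖ = √((y 0)^2 + ‖(WithLp.toLp 2 (fun j : Fin m => y j.succ) : V m)‖ ^ 2) := by
  rw [EuclideanSpace.norm_eq, EuclideanSpace.norm_eq, Real.sq_sqrt (by positivity), Fin.sum_univ_succ]
  simp

lemma angular_aux {m : ℕ} (hm : 1 ≤ m) (φ : ℝ → ℝ≥0∞) (hφ : Measurable φ) (a : ℝ) (ha : 0 < a) (ha1 : a < 1) :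
    ∫⁻ u : V m, φ (a / √(a^2 + ‖u‖^2)) ≤
      sphMeas m univ * ∫⁻ t in Ioi (0:ℝ), ENNReal.ofReal (t ^ (m-1)) * φ (1 / √(1 + t^2)) := by
  rw [polar_lintegral hm _ (by fun_prop)]
  calc _ = ∫⁻ ω, (∫⁻ t in Ioi (0:ℝ), ENNReal.ofReal (t ^ (m-1)) * (ENNReal.ofReal (a^m) * φ (1 / √(1 + t^2)))) ∂(sphMeas m) := by
        refine lintegral_congr fun ω => ?_
        have hω : ‖(ω : V m)‖ = 1 := by simp
        have := scale_Ioi m hm (1 / a) (by positivity) (fun r => φ (a / √(a^2 + ‖r • (ω : V m)‖^2)))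
        rw [this]
        refine setLIntegral_congr_fun measurableSet_Ioi fun t ht => ?_
        have ht' : (0:ℝ) < t := ht
        simp only [norm_smul, hω, mul_one]
        congr 3
        · simp
        · rw [Real.norm_of_nonneg (by positivity)]
          have : a ^ 2 + (t / (1 / a))^2 = a^2 * (1 + t^2) := by field_simp
          rw [this, Real.sqrt_mul (by positivity), Real.sqrt_sq ha.le]
          field_simp
    _ ≤ ∫⁻ ω, (∫⁻ t in Ioi (0:ℝ), ENNReal.ofReal (t ^ (m-1)) * φ (1 / √(1 + t^2))) ∂(sphMeas m) := by
        gcongr with ω t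
        have : ENNReal.ofReal (a ^ m) ≤ 1 := by
          rw [ENNReal.ofReal_le_one]; exact pow_le_one₀ ha.le ha1.le
        calc _ ≤ 1 * φ (1 / √(1 + t^2)) := by gcongr
          _ = _ := one_mul _
    _ = _ := by rw [lintegral_const, mul_comm]

lemma angular {n : ℕ} (hn : 2 ≤ n) : ∃ C : ℝ≥0∞, C ≠ ⊤ ∧ ∀ e : V n, ‖e‖ = 1 → ∀ φ : ℝ → ℝ≥0∞, Measurable φ →
    ∫⁻ ω, (if 0 < ⟪e, (ω : V n)⟫ then φ ⟪e, (ω : V n)⟫ else 0) ∂(sphMeas n) ≤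
      C * ∫⁻ t in Ioi (0:ℝ), ENNReal.ofReal (t ^ (n-2)) * φ (1 / √(1 + t^2)) := by
  obtain ⟨m, rfl⟩ : ∃ m, n = m + 1 := ⟨n - 1, by omega⟩
  have hm : 1 ≤ m := by omega
  refine ⟨ENNReal.ofReal (m+1) * sphMeas m univ, ENNReal.mul_ne_top ENNReal.ofReal_ne_top (measure_ne_top _ _), ?_⟩
  intro e he φ hφ
  set I := ∫⁻ t in Ioi (0:ℝ), ENNReal.ofReal (t ^ (m+1-2)) * φ (1 / √(1 + t^2)) with hI
  obtain ⟨bas, hbas⟩ := Orthonormal.exists_orthonormalBasis_extension_of_card_eq (𝕜 := ℝ) (E := V (m+1)) (ι := Fin (m+1))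
    (by simp) (v := fun _ => e) (s := {0}) (by
      constructor
      · intro i; simpa using he
      · intro i j hij; exact absurd (Subsingleton.elim i j) hij)
  have hb0 : bas 0 = e := hbas 0 (by simp)
  let F : V (m+1) → ℝ≥0∞ := fun x => if ‖x‖ < 1 then (if 0 < ⟪e, x⟫ then φ (⟪e, x⟫ / ‖x‖) else 0) else 0
  have hF : Measurable F := Measurable.ite (measurableSet_lt (by fun_prop) (by fun_prop))
    (Measurable.ite (measurableSet_lt (by fun_prop) (by fun_prop)) (by fun_prop) (by fun_prop)) (by fun_prop)
  have h1 : ∫⁻ y, F y = ENNReal.ofReal (1 / (m+1 : ℕ)) * ∫⁻ ω, (if 0 < ⟪e, (ω : V (m+1))⟫ then φ ⟪e, (ω : V (m+1))⟫ else 0) ∂(sphMeas (m+1)) := by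
    rw [polar_lintegral (by omega) F hF, ← lintegral_const_mul]
    swap
    · exact Measurable.ite (measurableSet_lt (by fun_prop) (by fun_prop)) (by fun_prop) (by fun_prop)
    refine lintegral_congr fun ω => ?_
    have hω : ‖(ω : V (m+1))‖ = 1 := by simp
    have := lint_pow_ind (m+1) (by omega) 1 zero_le_one (if 0 < ⟪e, (ω : V (m+1))⟫ then φ ⟪e, (ω : V (m+1))⟫ else 0)
    rw [one_pow] at this
    rw [← this]
    refine setLIntegral_congr_fun measurableSet_Ioi fun r hr => ?_
    have hr' : (0:ℝ) < r := hr
    simp only [F, norm_smul, hω, Real.norm_of_nonneg hr'.le, mul_one, inner_smul_right, mul_pos_iff_of_pos_left hr']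
    rw [mul_div_cancel_left₀ _ hr'.ne']
  let K : ℝ × V m → ℝ≥0∞ := fun p => if 0 < p.1 ∧ p.1 < 1 then φ (p.1 / √(p.1^2 + ‖p.2‖^2)) else 0
  have hK : Measurable K := Measurable.ite (measurableSet_Ioo.preimage measurable_fst)
    (by fun_prop) (by fun_prop)
  have h2 : ∫⁻ y, F y ≤ ∫⁻ p, K p := by
    rw [← bas.measurePreserving_repr_symm.lintegral_comp hF, ← (split_mp m).lintegral_comp hK]
    refine lintegral_mono fun y => ?_
    have hin : ⟪e, bas.repr.symm y⟫ = y 0 := by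
      rw [← hb0, ← bas.repr_apply_apply]; simp
    simp only [F, K, LinearIsometryEquiv.norm_map, hin, ← split_norm]
    by_cases hy : ‖y‖ < 1
    · have : y 0 < 1 := lt_of_le_of_lt (le_trans (le_abs_self _) (by simpa using PiLp.norm_apply_le y 0)) hy
      simp [hy, this]
    · simp [hy]
  have h3 : ∫⁻ p, K p ≤ sphMeas m univ * I := by
    rw [Measure.volume_eq_prod, lintegral_prod _ hK.aemeasurable]
    calc _ ≤ ∫⁻ a in Ioo (0:ℝ) 1, sphMeas m univ * I := by
          rw [← lintegral_indicator measurableSet_Ioo]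
          refine lintegral_mono fun a => ?_
          by_cases ha : a ∈ Ioo (0:ℝ) 1
          · rw [indicator_of_mem ha]
            simp only [K, ha.1, ha.2, and_self, if_true]
            have := angular_aux hm φ hφ a ha.1 ha.2
            simpa [hI] using this
          · rw [indicator_of_notMem ha]
            have : ¬ (0 < a ∧ a < 1) := ha
            simp [K, this]
      _ = _ := by simp
  have h4 := h1 ▸ h2.trans h3
  have h5 : ENNReal.ofReal (m+1) * ENNReal.ofReal (1 / (m+1:ℕ)) = 1 := by
    rw [← ENNReal.ofReal_mul (by positivity)]
    push_cast
    rw [mul_one_div_cancel (by positivity)]; simp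
  calc _ = ENNReal.ofReal (m+1) * (ENNReal.ofReal (1 / (m+1 : ℕ)) * ∫⁻ ω, (if 0 < ⟪e, (ω : V (m+1))⟫ then φ ⟪e, (ω : V (m+1))⟫ else 0) ∂(sphMeas (m+1))) := by
        rw [← mul_assoc, h5, one_mul]
    _ ≤ ENNReal.ofReal (m+1) * (sphMeas m univ * I) := by gcongr
    _ = _ := by rw [mul_assoc]

/-- angular factor in the `ω` variables -/
def aK (n : ℕ) (b : ℝ → ℝ) (c : ℝ) : ℝ :=
  if 0 < c then 2 ^ (n - 1) * c ^ (n - 2) * b (2 * c ^ 2 - 1) else 0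

/-- dyadic indicator -/
def dy (k : ℤ) (r : ℝ) : ℝ :=
  Set.indicator (Set.Ioc ((2:ℝ) ^ (-k - 1)) ((2:ℝ) ^ (-k))) (fun _ => (1:ℝ)) r

/-- kernel in `ω` variables -/
def BB (n : ℕ) (CΦ γ : ℝ) (b : ℝ → ℝ) (k : ℤ) (ρ c : ℝ) : ℝ :=
  CΦ * ρ ^ γ * aK n b c * dy k (ρ * √(1 - c ^ 2))

/-- swapped kernel -/
def BS (n : ℕ) (CΦ γ : ℝ) (b : ℝ → ℝ) (k : ℤ) (ρ c : ℝ) : ℝ :=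
  CΦ * ρ ^ γ * aK n b c * c ^ (-((n : ℝ) + γ)) * dy k (ρ * √((c ^ 2)⁻¹ - 1))

theorem measurable_aK {n : ℕ} {b : ℝ → ℝ} (hb : Measurable b) : Measurable (aK n b) :=
  Measurable.ite (measurableSet_lt (by fun_prop) (by fun_prop)) (by fun_prop) (by fun_prop)

theorem measurable_dy (k : ℤ) : Measurable (dy k) :=
  measurable_const.indicator measurableSet_Ioc

theorem dy_nonneg (k : ℤ) (r : ℝ) : 0 ≤ dy k r := indicator_nonneg (fun _ _ => zero_le_one) r

theorem dy_le_one (k : ℤ) (r : ℝ) : dy k r ≤ 1 := by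
  unfold dy; exact indicator_le_self' (fun _ _ => zero_le_one) r

theorem dy_eq (k : ℤ) (r : ℝ) : dy k r = (if r ≤ (2:ℝ)^(-k) then 1 else 0) - (if r ≤ (2:ℝ)^(-(k+1)) then 1 else 0) := by
  have h1 : (2:ℝ)^(-k-1) = (2:ℝ)^(-(k+1)) := by congr 1; ring
  have h2 : (2:ℝ)^(-(k+1)) ≤ (2:ℝ)^(-k) := zpow_le_zpow_right₀ (by norm_num) (by omega)
  unfold dy
  rw [indicator_apply, h1]
  simp only [mem_Ioc]
  split_ifs <;> first | (norm_num; done) | (exfalso; grind)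

theorem dy_ne {k : ℤ} {r : ℝ} (h : dy k r ≠ 0) : (2:ℝ)^(-k)/2 < r ∧ r ≤ (2:ℝ)^(-k) := by
  have := mem_of_indicator_ne_zero h
  rw [zpow_sub₀ (by norm_num), zpow_one] at this
  exact this

theorem aK_nonneg {n : ℕ} {b : ℝ → ℝ} (hb : ∀ t, 0 ≤ b t) (c : ℝ) : 0 ≤ aK n b c := by
  unfold aK; split_ifs with h
  · have := hb (2 * c ^ 2 - 1); positivity
  · exact le_rfl

theorem aK_zero {n : ℕ} {s cb : ℝ} {b : ℝ → ℝ} (hb : KernelAssumptions n s cb b) {c : ℝ} (_hc1 : c ≤ 1)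
    (h : aK n b c ≠ 0) : 0 < c ∧ 1/2 ≤ c^2 := by
  unfold aK at h
  split_ifs at h with h0
  · refine ⟨h0, ?_⟩
    by_contra hlt
    push Not at hlt
    apply h
    have : b (2*c^2-1) = 0 := by
      have h3 := hb.2.2.1 (arccos (2*c^2-1)) ⟨?_, arccos_le_pi _⟩
      · rwa [cos_arccos (by nlinarith) (by nlinarith)] at h3
      · have := arccos_le_pi_div_two (x := 2*c^2-1)
        by_contra hh; push Not at hh
        have := this.1 hh; linarith
    rw [this]; ring
  · exact absurd rfl h

theorem aK_bound {n : ℕ} (hn : 2 ≤ n) {s cb : ℝ} (hs : 0 < s) {b : ℝ → ℝ} (hb : KernelAssumptions n s cb b) {t : ℝ} (ht : 0 < t) (ht1 : t ≤ 1) :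
    t^(n-2) * aK n b (1/√(1+t^2)) ≤ 2^(n-1) * cb⁻¹ * t^(-(1+2*s)) := by
  have hq : 0 < √(1+t^2) := by positivity
  have hsq : √(1+t^2)^2 = 1+t^2 := sq_sqrt (by positivity)
  have hq1 : 1 ≤ √(1+t^2) := by rw [one_le_sqrt]; nlinarith
  have hc0 : 0 < 1/√(1+t^2) := by positivity
  have hc1 : 1/√(1+t^2) ≤ 1 := by rw [div_le_one hq]; exact hq1
  set θ := 2 * arctan t with hθ
  have hcos : cos θ = 2*(1/√(1+t^2))^2 - 1 := by rw [hθ, cos_two_mul, cos_arctan]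
  have hsin : sin θ = 2*t/(1+t^2) := by
    rw [hθ, sin_two_mul, sin_arctan, cos_arctan]; field_simp; rw [hsq]
  have hθ0 : 0 < θ := by have := arctan_pos.2 ht; positivity
  have hθ1 : θ ≤ π/2 := by
    have : arctan t ≤ arctan 1 := arctan_mono ht1
    rw [arctan_one] at this; linarith
  have hst : t ≤ sin θ := by rw [hsin, le_div_iff₀ (by positivity)]; nlinarith
  have hs0 : 0 ≤ sin θ := ht.le.trans hst
  have hθt : t ≤ θ := hst.trans (sin_le hθ0.le)
  have hb2 := (hb.2.2.2 θ ⟨hθ0, hθ1⟩).2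
  have hb0 := hb.2.1 (cos θ)
  have hcb : 0 ≤ cb⁻¹ := by
    by_contra hneg
    push Not at hneg
    have h1 : cb⁻¹ * θ ^ (-(1 + 2 * s)) < 0 := mul_neg_of_neg_of_pos hneg (rpow_pos_of_pos hθ0 _)
    have h2 : 0 ≤ sin θ ^ ((n:ℝ)-2) * b (cos θ) := mul_nonneg (rpow_nonneg (ht.le.trans hst) _) hb0
    linarith
  have e : ((n:ℝ) - 2) = ((n-2 : ℕ) : ℝ) := by push_cast [Nat.cast_sub hn]; ring
  rw [e, rpow_natCast] at hb2
  unfold aK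
  rw [if_pos hc0, ← hcos]
  calc t^(n-2) * (2^(n-1) * (1/√(1+t^2))^(n-2) * b (cos θ))
      ≤ (sin θ)^(n-2) * (2^(n-1) * 1 * b (cos θ)) := by
        gcongr
        exact pow_le_one₀ hc0.le hc1
    _ = 2^(n-1) * ((sin θ)^(n-2) * b (cos θ)) := by ring
    _ ≤ 2^(n-1) * (cb⁻¹ * θ ^ (-(1 + 2 * s))) := by gcongr
    _ ≤ 2^(n-1) * (cb⁻¹ * t ^ (-(1 + 2 * s))) := by
        gcongr 2^(n-1) * (cb⁻¹ * ?_)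
        exact rpow_le_rpow_of_nonpos ht hθt (by linarith)
    _ = _ := by ring

theorem aK_bound_zero {n : ℕ} {s cb : ℝ} {b : ℝ → ℝ} (hb : KernelAssumptions n s cb b) {t : ℝ} (ht1 : 1 < t) :
    aK n b (1/√(1+t^2)) = 0 := by
  by_contra h
  have hq : 0 < √(1+t^2) := by positivity
  have hsq : √(1+t^2)^2 = 1+t^2 := sq_sqrt (by positivity)
  have hc1 : 1/√(1+t^2) ≤ 1 := by rw [div_le_one hq, one_le_sqrt]; nlinarith
  have := (aK_zero hb hc1 h).2
  rw [div_pow, hsq, one_pow, div_le_div_iff₀ (by norm_num) (by positivity)] at this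
  nlinarith

theorem geo_small {p : ℝ} (hp : 0 < p) : ∃ C : ℝ, 0 < C ∧ ∀ A : ℝ, 0 < A →
    ∑' k : ℤ, (if (2:ℝ)^(-k) ≤ A then ENNReal.ofReal (((2:ℝ)^(-k))^p) else 0) ≤ ENNReal.ofReal (C * A^p) := by
  have hq0 : (0:ℝ) < (2:ℝ)^(-p) := by positivity
  have hq1 : (2:ℝ)^(-p) < 1 := rpow_lt_one_of_one_lt_of_neg (by norm_num) (by linarith)
  refine ⟨(1-(2:ℝ)^(-p))⁻¹, by rw [inv_pos]; linarith, fun A hA => ?_⟩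
  obtain ⟨m, hm⟩ := exists_mem_Ico_zpow hA (one_lt_two)
  have hinj : Function.Injective (fun j : ℕ => -m + (j:ℤ)) := fun i j h => by simpa using h
  rw [← hinj.tsum_eq]
  · calc _ ≤ ∑' j : ℕ, ENNReal.ofReal (A^p) * (ENNReal.ofReal ((2:ℝ)^(-p)))^j := by
          refine ENNReal.tsum_le_tsum fun j => ?_
          rw [← ENNReal.ofReal_pow hq0.le, ← ENNReal.ofReal_mul (by positivity)]
          split_ifs
          · refine ENNReal.ofReal_le_ofReal ?_
            have : (2:ℝ)^(-(-m+(j:ℤ))) = 2^m * ((2:ℝ)^j)⁻¹ := by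
              rw [neg_add, neg_neg, zpow_add₀ (by norm_num), zpow_neg, zpow_natCast]
            rw [this, mul_rpow (by positivity) (by positivity)]
            have e2 : (((2:ℝ)^j)⁻¹)^p = ((2:ℝ)^(-p))^j := by
              rw [← rpow_natCast, ← rpow_natCast, ← rpow_neg (by norm_num), ← rpow_mul (by norm_num), ← rpow_mul (by norm_num)]; congr 1; ring
            rw [e2]
            gcongr
            exact hm.1
          · exact zero_le
      _ = ENNReal.ofReal (A^p) * (1 - ENNReal.ofReal ((2:ℝ)^(-p)))⁻¹ := by
          rw [ENNReal.tsum_mul_left, ENNReal.tsum_geometric]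
      _ ≤ _ := by
          rw [← ENNReal.ofReal_one, ← ENNReal.ofReal_sub _ hq0.le, ← ENNReal.ofReal_inv_of_pos (by linarith), ← ENNReal.ofReal_mul (by positivity), mul_comm]
  · intro k hk
    simp only [Function.mem_support, ne_eq, ite_eq_right_iff, not_forall] at hk
    obtain ⟨hk, -⟩ := hk
    have : (2:ℝ)^(-k) < 2^(m+1) := hk.trans_lt hm.2
    rw [zpow_lt_zpow_iff_right₀ (by norm_num)] at this
    exact ⟨(k+m).toNat, by simp; omega⟩

theorem geo_large {p : ℝ} (hp : 0 < p) : ∃ C : ℝ, 0 < C ∧ ∀ A : ℝ, 0 < A →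
    ∑' k : ℤ, (if A ≤ (2:ℝ)^(-k) then ENNReal.ofReal (((2:ℝ)^(-k))^(-p)) else 0) ≤ ENNReal.ofReal (C * A^(-p)) := by
  obtain ⟨C, hC, h⟩ := geo_small hp
  refine ⟨C, hC, fun A hA => ?_⟩
  have := h A⁻¹ (by positivity)
  rw [← (Equiv.neg ℤ).tsum_eq]
  rw [inv_rpow hA.le, ← rpow_neg hA.le] at this
  refine le_trans (ENNReal.tsum_le_tsum fun k => ?_) this
  have e : ((2:ℝ)^k)^(-p) = ((2:ℝ)^(-k))^p := by
    rw [zpow_neg, inv_rpow (by positivity), rpow_neg (by positivity)]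
  have e2 : A ≤ (2:ℝ)^k ↔ (2:ℝ)^(-k) ≤ A⁻¹ := by
    rw [zpow_neg, inv_le_inv₀ (by positivity) hA]
  simp only [Equiv.neg_apply, neg_neg]
  rw [e]; simp only [e2]; exact le_rfl

theorem lint_rpow_Ioi {a q : ℝ} (ha : 0 < a) (hq : q < -1) :
    ∫⁻ t in Ioi a, ENNReal.ofReal (t^q) = ENNReal.ofReal (-a^(q+1)/(q+1)) := by
  rw [← integral_Ioi_rpow_of_lt hq ha, ofReal_integral_eq_lintegral_ofReal (integrableOn_Ioi_rpow_of_lt hq ha)]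
  refine (ae_restrict_iff' measurableSet_Ioi).2 (Filter.Eventually.of_forall fun t ht => ?_)
  exact rpow_nonneg (ha.le.trans (le_of_lt ht)) _

theorem lint_rpow_Ioc {q : ℝ} (hq : -1 < q) :
    ∫⁻ t in Ioc (0:ℝ) 1, ENNReal.ofReal (t^q) = ENNReal.ofReal (1/(q+1)) := by
  have h := integral_rpow (a := 0) (b := 1) (Or.inl hq)
  rw [intervalIntegral.integral_of_le zero_le_one, one_rpow, zero_rpow (by linarith), sub_zero] at h
  have hi := (intervalIntegral.intervalIntegrable_rpow' (a := 0) (b := 1) hq)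
  rw [intervalIntegrable_iff_integrableOn_Ioc_of_le zero_le_one] at hi
  rw [← h, ofReal_integral_eq_lintegral_ofReal hi]
  refine (ae_restrict_iff' measurableSet_Ioc).2 (Filter.Eventually.of_forall fun t ht => ?_)
  exact rpow_nonneg ht.1.le _

theorem ang_bound {n : ℕ} (hn : 2 ≤ n) : ∃ C : ℝ, 0 < C ∧ ∀ s cb : ℝ, 0 < s → 0 < cb → ∀ b : ℝ → ℝ, KernelAssumptions n s cb b →
    ∀ e : V n, ‖e‖ = 1 → ∀ Λ : ℝ → ℝ≥0∞, Measurable Λ →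
    ∫⁻ ω, ENNReal.ofReal (aK n b ⟪e, (ω : V n)⟫) * Λ ⟪e, (ω : V n)⟫ ∂(sphMeas n) ≤
      ENNReal.ofReal (C * cb⁻¹) * ∫⁻ t in Ioc (0:ℝ) 1, ENNReal.ofReal (t^(-(1+2*s))) * Λ (1/√(1+t^2)) := by
  obtain ⟨C, hC, h⟩ := angular hn
  refine ⟨2^(n-1) * (C.toReal + 1), by positivity, ?_⟩
  intro s cb hs hcb b hb e he Λ hΛ
  have hma := measurable_aK (n := n) hb.1
  have h1 := h e he (fun c => ENNReal.ofReal (aK n b c) * Λ c) (by fun_prop)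
  have e1 : ∫⁻ ω, ENNReal.ofReal (aK n b ⟪e, (ω : V n)⟫) * Λ ⟪e, (ω : V n)⟫ ∂(sphMeas n) =
      ∫⁻ ω, (if 0 < ⟪e, (ω : V n)⟫ then ENNReal.ofReal (aK n b ⟪e, (ω : V n)⟫) * Λ ⟪e, (ω : V n)⟫ else 0) ∂(sphMeas n) := by
    refine lintegral_congr fun ω => ?_
    split_ifs with h0
    · rfl
    · simp [aK, h0]
  rw [e1]
  refine h1.trans ?_
  have h2 : ∫⁻ t in Ioi (0:ℝ), ENNReal.ofReal (t^(n-2)) * (ENNReal.ofReal (aK n b (1/√(1+t^2))) * Λ (1/√(1+t^2)))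
      ≤ ENNReal.ofReal (2^(n-1) * cb⁻¹) * ∫⁻ t in Ioc (0:ℝ) 1, ENNReal.ofReal (t^(-(1+2*s))) * Λ (1/√(1+t^2)) := by
    rw [← lintegral_const_mul _ (by fun_prop), ← lintegral_indicator measurableSet_Ioi, ← lintegral_indicator measurableSet_Ioc]
    refine lintegral_mono fun t => ?_
    by_cases ht : t ∈ Ioi (0:ℝ)
    · rw [indicator_of_mem ht]
      by_cases ht1 : t ≤ 1
      · rw [indicator_of_mem (show t ∈ Ioc (0:ℝ) 1 from ⟨ht, ht1⟩), ← mul_assoc, ← mul_assoc]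
        have ht0 : (0:ℝ) < t := ht
        rw [← ENNReal.ofReal_mul (by positivity), ← ENNReal.ofReal_mul (by positivity)]
        have := aK_nonneg (n := n) hb.2.1 (1/√(1+t^2))
        gcongr ENNReal.ofReal ?_ * _
        exact aK_bound hn hs hb ht ht1
      · rw [aK_bound_zero hb (not_le.1 ht1)]; simp
    · rw [indicator_of_notMem ht]; exact zero_le
  calc _ ≤ C * (ENNReal.ofReal (2^(n-1) * cb⁻¹) * ∫⁻ t in Ioc (0:ℝ) 1, ENNReal.ofReal (t^(-(1+2*s))) * Λ (1/√(1+t^2))) := by gcongr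
    _ ≤ _ := by
      rw [← mul_assoc]
      gcongr
      calc C * ENNReal.ofReal (2^(n-1) * cb⁻¹) ≤ ENNReal.ofReal (C.toReal + 1) * ENNReal.ofReal (2^(n-1) * cb⁻¹) := by
            gcongr
            calc C = ENNReal.ofReal C.toReal := (ENNReal.ofReal_toReal hC).symm
              _ ≤ _ := ENNReal.ofReal_le_ofReal (by linarith)
        _ = _ := by
          rw [← ENNReal.ofReal_mul (by positivity)]; congr 1; ring

theorem cpow_t {t : ℝ} (m : ℝ) : (1/√(1+t^2))^(-m) = (1+t^2)^(m/2) := by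
  have h : (0:ℝ) < 1+t^2 := by positivity
  rw [one_div, inv_rpow (by positivity), sqrt_eq_rpow, ← rpow_mul h.le, ← rpow_neg h.le]
  congr 1; ring

theorem sharp_t {t : ℝ} (ht : 0 < t) : √(((1/√(1+t^2))^2)⁻¹ - 1) = t := by
  have h : (0:ℝ) < 1+t^2 := by positivity
  rw [div_pow, sq_sqrt h.le, one_pow, one_div, inv_inv, add_sub_cancel_left, sqrt_sq ht.le]

theorem flat_t {t : ℝ} (ht : 0 < t) : √(1 - (1/√(1+t^2))^2) = t/√(1+t^2) := by
  have h : (0:ℝ) < 1+t^2 := by positivity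
  rw [div_pow, sq_sqrt h.le]
  have : 1 - 1^2/(1+t^2) = t^2/(1+t^2) := by field_simp; ring
  rw [this, sqrt_div (by positivity), sqrt_sq ht.le]

theorem one_add_rpow {u q : ℝ} (hu : 0 ≤ u) (hu1 : u ≤ 1) (hq : 0 < q) : (1+u)^q - 1 ≤ q * exp q * u := by
  have h1 : (1+u)^q ≤ exp (q*u) := by
    rw [rpow_def_of_pos (by linarith)]
    apply exp_le_exp.2
    have := log_le_sub_one_of_pos (show 0 < 1+u by linarith)
    nlinarith
  have h2 := add_one_le_exp (-(q*u))
  have h3 : exp (q*u) * exp (-(q*u)) = 1 := by rw [← exp_add]; simp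
  have h4 : exp (q*u) ≤ exp q := exp_le_exp.2 (by nlinarith)
  have h5 := exp_pos (q*u)
  have h6 : 0 ≤ q*u := by positivity
  nlinarith

theorem K12 {n : ℕ} (hn : 2 ≤ n) {s γ CΦ cb : ℝ} (hs : s ∈ Ioo (0:ℝ) 1) (hγ : -(n:ℝ) < γ) (hCΦ : 0 < CΦ) (hcb : 0 < cb) :
    ∃ C : ℝ, 0 < C ∧ ∀ b : ℝ → ℝ, KernelAssumptions n s cb b → ∀ e : V n, ‖e‖ = 1 → ∀ ρ : ℝ, 0 < ρ → ∀ k : ℤ,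
     (∫⁻ ω, ENNReal.ofReal (BB n CΦ γ b k ρ ⟪e, (ω : V n)⟫) ∂(sphMeas n) ≤ ENNReal.ofReal (C * (ρ^(γ+2*s) * ((2:ℝ)^(-k))^(-(2*s))))) ∧
     (∫⁻ ω, ENNReal.ofReal (BS n CΦ γ b k ρ ⟪e, (ω : V n)⟫) ∂(sphMeas n) ≤ ENNReal.ofReal (C * (ρ^(γ+2*s) * ((2:ℝ)^(-k))^(-(2*s))))) := by
  obtain ⟨C, hC, h⟩ := ang_bound hn
  have hs0 := hs.1
  set M : ℝ := 2^(((n:ℝ)+γ)/2) with hM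
  have hM1 : 1 ≤ M := one_le_rpow (by norm_num) (by linarith)
  refine ⟨C * cb⁻¹ * (CΦ * M * 2^(2*s)/(2*s)), by positivity, ?_⟩
  intro b hb e he ρ hρ k
  set x : ℝ := (2:ℝ)^(-k) with hx
  have hx0 : 0 < x := by positivity
  have key : ∀ Λ : ℝ → ℝ, Measurable Λ → (∀ t, 0 < t → t ≤ 1 → Λ (1/√(1+t^2)) ≤ if x/(2*ρ) < t then CΦ*ρ^γ*M else 0) →
      ∫⁻ ω, ENNReal.ofReal (aK n b ⟪e, (ω : V n)⟫) * ENNReal.ofReal (Λ ⟪e, (ω : V n)⟫) ∂(sphMeas n) ≤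
       ENNReal.ofReal (C * cb⁻¹ * (CΦ * M * 2^(2*s)/(2*s)) * (ρ^(γ+2*s) * x^(-(2*s)))) := by
    intro Λ hΛ hb2
    refine (h s cb hs.1 hcb b hb e he (fun c => ENNReal.ofReal (Λ c)) (by fun_prop)).trans ?_
    rw [mul_assoc (C*cb⁻¹), ENNReal.ofReal_mul (p := C*cb⁻¹) (by positivity)]
    gcongr
    calc _ ≤ ∫⁻ t in Ioi (x/(2*ρ)), ENNReal.ofReal (CΦ*ρ^γ*M) * ENNReal.ofReal (t^(-(1+2*s))) := by
          rw [← lintegral_indicator measurableSet_Ioi, ← lintegral_indicator measurableSet_Ioc]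
          refine lintegral_mono fun t => ?_
          by_cases ht : t ∈ Ioc (0:ℝ) 1
          · rw [indicator_of_mem ht]
            have := hb2 t ht.1 ht.2
            by_cases ht2 : t ∈ Ioi (x/(2*ρ))
            · rw [indicator_of_mem ht2, mul_comm]
              rw [if_pos (mem_Ioi.1 ht2)] at this
              gcongr
            · rw [if_neg (fun hh => ht2 (mem_Ioi.2 hh))] at this
              rw [ENNReal.ofReal_of_nonpos this, mul_zero]; exact zero_le
          · rw [indicator_of_notMem ht]; exact zero_le
      _ = _ := by
        rw [lintegral_const_mul _ (by fun_prop), lint_rpow_Ioi (by positivity) (by linarith), ← ENNReal.ofReal_mul (by positivity)]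
        congr 1
        have : (x/(2*ρ))^(-(1+2*s)+1) = x^(-(2*s)) * (2^(2*s) * ρ^(2*s)) := by
          rw [show -(1+2*s)+1 = -(2*s) by ring, div_rpow hx0.le (by positivity), rpow_neg (x := 2*ρ) (by positivity), mul_rpow (by norm_num) hρ.le]; field_simp
        rw [this, rpow_add hρ, show -(1+2*s)+1 = -(2*s) by ring]
        field_simp
  have hda := measurable_dy k
  constructor
  · have := key (fun c => CΦ * ρ^γ * dy k (ρ * √(1-c^2))) (by fun_prop) ?_
    · convert this using 4 with ω
      rw [← ENNReal.ofReal_mul (aK_nonneg hb.2.1 _)]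
      unfold BB; congr 1; ring
    · intro t ht ht1
      beta_reduce
      rw [flat_t ht]
      have hq1 : 1 ≤ √(1+t^2) := by rw [one_le_sqrt]; nlinarith
      have hle : t/√(1+t^2) ≤ t := div_le_self ht.le hq1
      by_cases hd : dy k (ρ * (t/√(1+t^2))) = 0
      · rw [hd, mul_zero]; split_ifs <;> positivity
      · have h3 := (dy_ne hd).1
        rw [if_pos]
        · have := dy_le_one k (ρ * (t/√(1+t^2)))
          have h0 := dy_nonneg k (ρ * (t/√(1+t^2)))
          gcongr
          linarith
        · rw [div_lt_iff₀ (by positivity)]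
          have : ρ * (t/√(1+t^2)) ≤ ρ * t := by gcongr
          simp only [hx]; linarith
  · have := key (fun c => CΦ * ρ^γ * c ^ (-((n : ℝ) + γ)) * dy k (ρ * √((c ^ 2)⁻¹ - 1))) (by fun_prop) ?_
    · convert this using 4 with ω
      rw [← ENNReal.ofReal_mul (aK_nonneg hb.2.1 _)]
      unfold BS; congr 1; ring
    · intro t ht ht1
      beta_reduce
      rw [sharp_t ht, cpow_t]
      by_cases hd : dy k (ρ * t) = 0
      · rw [hd, mul_zero]; split_ifs <;> positivity
      · have h3 := (dy_ne hd).1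
        rw [if_pos]
        · have := dy_le_one k (ρ * t)
          have h0 := dy_nonneg k (ρ * t)
          have h4 : (1+t^2)^(((n:ℝ)+γ)/2) ≤ M := by
            rw [hM]; apply rpow_le_rpow (by positivity) (by nlinarith) (by linarith)
          calc _ ≤ CΦ * ρ^γ * M * 1 := by gcongr
            _ = _ := by ring
        · rw [div_lt_iff₀ (by positivity)]
          simp only [hx]; linarith

theorem dy_diff {k : ℤ} {r r' : ℝ} (h : r' ≤ r) : |dy k r - dy k r'| ≤
    (if r' ≤ (2:ℝ)^(-k) ∧ (2:ℝ)^(-k) < r then 1 else 0) + (if r' ≤ (2:ℝ)^(-(k+1)) ∧ (2:ℝ)^(-(k+1)) < r then 1 else 0) := by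
  rw [dy_eq, dy_eq]
  have h2 : (2:ℝ)^(-(k+1)) ≤ (2:ℝ)^(-k) := zpow_le_zpow_right₀ (by norm_num) (by omega)
  split_ifs <;> first | (norm_num; done) | (exfalso; grind)

theorem dy_tsum (r : ℝ) : ∑' k : ℤ, ENNReal.ofReal (dy k r) ≤ 1 := by
  by_cases hr : 0 < r
  · obtain ⟨m, hm⟩ := exists_mem_Ioc_zpow hr one_lt_two
    rw [tsum_eq_single (-(m+1))]
    · exact ENNReal.ofReal_le_one.2 (dy_le_one _ _)
    · intro k hk
      by_contra h
      have h1 : dy k r ≠ 0 := fun h0 => h (by rw [h0]; simp)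
      have h2 := mem_of_indicator_ne_zero h1
      have h3 := (zpow_lt_zpow_iff_right₀ (one_lt_two (α := ℝ))).1 (h2.1.trans_le hm.2)
      have h4 := (zpow_lt_zpow_iff_right₀ (one_lt_two (α := ℝ))).1 (hm.1.trans_le h2.2)
      omega
  · have : ∀ k : ℤ, dy k r = 0 := by
      intro k
      by_contra h
      have h2 := (dy_ne h).1
      have : (0:ℝ) < 2^(-k) := by positivity
      linarith
    simp [this]

theorem W_int {s : ℝ} (hs : s ∈ Ioo (0:ℝ) 1) {ρ : ℝ} (hρ : 0 < ρ) (k : ℤ) :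
    ∫⁻ t in Ioc (0:ℝ) 1, ENNReal.ofReal (t^(-(1+2*s))) *
      ENNReal.ofReal (if ρ * (t/√(1+t^2)) ≤ (2:ℝ)^(-k) ∧ (2:ℝ)^(-k) < ρ * t then 1 else 0)
    ≤ ENNReal.ofReal (ρ^(-(2-2*s))) * (if (2:ℝ)^(-k) ≤ ρ then ENNReal.ofReal (((2:ℝ)^(-k))^(2-2*s)) else 0) := by
  set x : ℝ := (2:ℝ)^(-k) with hx
  have hx0 : 0 < x := by positivity
  obtain ⟨hs0, hs1⟩ := hs
  by_cases hxr : x ≤ ρ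
  · rw [if_pos hxr]
    set τ := x/ρ with hτ
    have hτ0 : 0 < τ := by positivity
    calc _ ≤ ∫⁻ t in Ioc τ (τ+τ^3), ENNReal.ofReal (τ^(-(1+2*s))) := by
          rw [← lintegral_indicator measurableSet_Ioc, ← lintegral_indicator measurableSet_Ioc]
          refine lintegral_mono fun t => ?_
          by_cases ht : t ∈ Ioc (0:ℝ) 1
          · rw [indicator_of_mem ht]
            split_ifs with hc
            · have hq : 0 < √(1+t^2) := by positivity
              have hsq : √(1+t^2)^2 = 1+t^2 := sq_sqrt (by positivity)
              have h1 : τ < t := by rw [hτ, div_lt_iff₀ hρ]; linarith [hc.2]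
              have h2 : t ≤ τ * √(1+t^2) := by
                have := hc.1
                rw [← mul_div_assoc, div_le_iff₀ hq] at this
                rw [hτ, div_mul_eq_mul_div, le_div_iff₀ hρ]; linarith
              have h3 : t^2 ≤ τ^2 * (1+t^2) := by
                rw [← hsq, ← mul_pow]; exact pow_le_pow_left₀ ht.1.le h2 2
              have ht2 : t^2 ≤ 1 := by nlinarith [ht.1, ht.2]
              have h4 : t^2 ≤ 2*τ^2 := by nlinarith [sq_nonneg τ]
              have h5 : √(1+t^2) ≤ 1 + τ^2 := by
                rw [sqrt_le_left (by positivity)]; nlinarith [sq_nonneg (τ^2)]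
              have h6 : t ≤ τ + τ^3 := by
                have := mul_le_mul_of_nonneg_left h5 hτ0.le
                linarith [this, show τ*(1+τ^2) = τ+τ^3 by ring]
              rw [indicator_of_mem (show t ∈ Ioc τ (τ+τ^3) from ⟨h1, h6⟩)]
              simp only [ENNReal.ofReal_one, mul_one]
              exact ENNReal.ofReal_le_ofReal (rpow_le_rpow_of_nonpos hτ0 h1.le (by linarith))
            · simp
          · rw [indicator_of_notMem ht]; exact zero_le
      _ = _ := by
        rw [setLIntegral_const, Real.volume_Ioc, ← ENNReal.ofReal_mul (by positivity), ← ENNReal.ofReal_mul (by positivity)]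
        congr 1
        rw [add_sub_cancel_left, ← rpow_natCast τ 3, ← rpow_add hτ0]
        rw [show -(1+2*s) + ((3:ℕ):ℝ) = 2-2*s by push_cast; ring, hτ, div_rpow hx0.le hρ.le, rpow_neg hρ.le]
        field_simp
  · have : ∀ t ∈ Ioc (0:ℝ) 1, ENNReal.ofReal (t^(-(1+2*s))) *
      ENNReal.ofReal (if ρ * (t/√(1+t^2)) ≤ x ∧ x < ρ * t then 1 else 0) = 0 := by
      intro t ht
      rw [if_neg]
      · simp
      · rintro ⟨-, h2⟩
        have : ρ * t ≤ ρ := by nlinarith [ht.2]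
        linarith
    rw [setLIntegral_congr_fun measurableSet_Ioc this]; simp

theorem K3 {n : ℕ} (hn : 2 ≤ n) {s γ CΦ cb : ℝ} (hs : s ∈ Ioo (0:ℝ) 1) (hγ : -(n:ℝ) < γ) (hCΦ : 0 < CΦ) (hcb : 0 < cb) :
    ∃ C : ℝ, 0 < C ∧ ∀ b : ℝ → ℝ, KernelAssumptions n s cb b → ∀ e : V n, ‖e‖ = 1 → ∀ ρ : ℝ, 0 < ρ →
     ∑' k : ℤ, ∫⁻ ω, ENNReal.ofReal |BS n CΦ γ b k ρ ⟪e, (ω : V n)⟫ - BB n CΦ γ b k ρ ⟪e, (ω : V n)⟫| ∂(sphMeas n)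
       ≤ ENNReal.ofReal (C * ρ^γ) := by
  obtain ⟨C, hC, h⟩ := ang_bound hn
  obtain ⟨hs0, hs1⟩ := hs
  obtain ⟨D, hD, hgeo⟩ := geo_small (p := 2-2*s) (by linarith)
  set q : ℝ := ((n:ℝ)+γ)/2 with hq
  have hq0 : 0 < q := by rw [hq]; linarith
  set M : ℝ := q * exp q with hM
  have hM0 : 0 < M := by positivity
  refine ⟨C * cb⁻¹ * (CΦ * (M * (1/(2-2*s)) + D + D)), ?_, ?_⟩
  · have : 0 < 2-2*s := by linarith
    positivity
  intro b hb e he ρ hρ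
  have h22 : 0 < 2-2*s := by linarith
  let w : ℤ → ℝ → ℝ := fun k t => if ρ * (t/√(1+t^2)) ≤ (2:ℝ)^(-k) ∧ (2:ℝ)^(-k) < ρ * t then 1 else 0
  have hw0 : ∀ k t, 0 ≤ w k t := fun k t => by simp only [w]; split_ifs <;> norm_num
  have hwm : ∀ k, Measurable (w k) := fun k =>
    Measurable.ite (by measurability) (by fun_prop) (by fun_prop)
  let W : ℤ → ℝ≥0∞ := fun k => ENNReal.ofReal (ρ^(-(2-2*s))) * (if (2:ℝ)^(-k) ≤ ρ then ENNReal.ofReal (((2:ℝ)^(-k))^(2-2*s)) else 0)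
  have hWs : ∑' k, W k ≤ ENNReal.ofReal D := by
    simp only [W]
    rw [ENNReal.tsum_mul_left]
    calc _ ≤ ENNReal.ofReal (ρ^(-(2-2*s))) * ENNReal.ofReal (D * ρ^(2-2*s)) := by gcongr; exact hgeo ρ hρ
      _ = _ := by
        rw [← ENNReal.ofReal_mul (by positivity)]; congr 1
        rw [rpow_neg hρ.le]; field_simp
  have hda : ∀ k, Measurable (dy k) := measurable_dy
  have hma := measurable_aK (n := n) hb.1
  have step : ∀ k : ℤ, ∫⁻ ω, ENNReal.ofReal |BS n CΦ γ b k ρ ⟪e, (ω : V n)⟫ - BB n CΦ γ b k ρ ⟪e, (ω : V n)⟫| ∂(sphMeas n)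
      ≤ ENNReal.ofReal (C * cb⁻¹) * (ENNReal.ofReal (CΦ * ρ^γ) *
        (ENNReal.ofReal M * (∫⁻ t in Ioc (0:ℝ) 1, ENNReal.ofReal (t^(1-2*s)) * ENNReal.ofReal (dy k (ρ*t))) + W k + W (k+1))) := by
    intro k
    have h1 := h s cb hs0 hcb b hb e he
      (fun c => ENNReal.ofReal (CΦ * ρ^γ * |c ^ (-((n : ℝ) + γ)) * dy k (ρ * √((c ^ 2)⁻¹ - 1)) - dy k (ρ * √(1-c^2))|)) (by fun_prop)
    have e1 : ∀ c, ENNReal.ofReal |BS n CΦ γ b k ρ c - BB n CΦ γ b k ρ c| = ENNReal.ofReal (aK n b c) *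
       ENNReal.ofReal (CΦ * ρ^γ * |c ^ (-((n : ℝ) + γ)) * dy k (ρ * √((c ^ 2)⁻¹ - 1)) - dy k (ρ * √(1-c^2))|) := by
      intro c
      have ha := aK_nonneg (n := n) hb.2.1 c
      rw [← ENNReal.ofReal_mul ha]
      congr 1
      unfold BS BB
      rw [← abs_of_nonneg (show 0 ≤ CΦ * ρ^γ by positivity), ← mul_assoc]
      nth_rewrite 3 [← abs_of_nonneg ha]
      rw [← abs_mul, ← abs_mul, abs_of_nonneg (show 0 ≤ CΦ * ρ^γ by positivity)]
      congr 1; ring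
    simp only [e1]
    refine h1.trans ?_
    gcongr
    calc _ ≤ ∫⁻ t in Ioc (0:ℝ) 1, ENNReal.ofReal (CΦ * ρ^γ) * (ENNReal.ofReal M * (ENNReal.ofReal (t^(1-2*s)) * ENNReal.ofReal (dy k (ρ*t)))
            + ENNReal.ofReal (t^(-(1+2*s))) * ENNReal.ofReal (w k t) + ENNReal.ofReal (t^(-(1+2*s))) * ENNReal.ofReal (w (k+1) t)) := by
          refine setLIntegral_mono' measurableSet_Ioc fun t ht => ?_
          obtain ⟨ht0, ht1⟩ := ht
          rw [sharp_t ht0, flat_t ht0, cpow_t]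
          have d0 := dy_nonneg k (ρ*t)
          have w0 := hw0 k t
          have w1 := hw0 (k+1) t
          rw [← ENNReal.ofReal_mul (by positivity), ← ENNReal.ofReal_mul (by positivity), ← ENNReal.ofReal_mul (by positivity),
            ← ENNReal.ofReal_mul (by positivity), ← ENNReal.ofReal_mul (by positivity), ← ENNReal.ofReal_add (by positivity) (by positivity), ← ENNReal.ofReal_add (by positivity) (by positivity),
            ← ENNReal.ofReal_mul (by positivity)]
          refine ENNReal.ofReal_le_ofReal ?_
          have e2 : t^(1-2*s) = t^(-(1+2*s)) * t^2 := by
            rw [← rpow_natCast, ← rpow_add ht0]; congr 1; push_cast; ring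
          have hq1 : 1 ≤ √(1+t^2) := by rw [one_le_sqrt]; nlinarith
          have hle : ρ * (t/√(1+t^2)) ≤ ρ * t := by gcongr; exact div_le_self ht0.le hq1
          have h2 := dy_diff (k := k) hle
          have h3 := one_add_rpow (u := t^2) (q := q) (by positivity) (by nlinarith) hq0
          have h4 : |(1+t^2)^q * dy k (ρ*t) - dy k (ρ * (t/√(1+t^2)))| ≤ M * t^2 * dy k (ρ*t) + (w k t + w (k+1) t) := by
            have h5 : (1+t^2)^q * dy k (ρ*t) - dy k (ρ * (t/√(1+t^2))) = ((1+t^2)^q-1) * dy k (ρ*t) + (dy k (ρ*t) - dy k (ρ * (t/√(1+t^2)))) := by ring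
            rw [h5]
            refine (abs_add_le _ _).trans (add_le_add ?_ h2)
            have : 0 ≤ (1+t^2)^q - 1 := by
              have := one_le_rpow (x := 1+t^2) (z := q) (by nlinarith) hq0.le; linarith
            rw [abs_of_nonneg (by positivity)]
            gcongr
          rw [e2]
          have ht3 : 0 < t^(-(1+2*s)) := by positivity
          calc _ ≤ t^(-(1+2*s)) * (CΦ * ρ^γ * (M * t^2 * dy k (ρ*t) + (w k t + w (k+1) t))) := by gcongr
            _ = _ := by ring
      _ = ENNReal.ofReal (CΦ * ρ^γ) * (ENNReal.ofReal M * (∫⁻ t in Ioc (0:ℝ) 1, ENNReal.ofReal (t^(1-2*s)) * ENNReal.ofReal (dy k (ρ*t)))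
           + (∫⁻ t in Ioc (0:ℝ) 1, ENNReal.ofReal (t^(-(1+2*s))) * ENNReal.ofReal (w k t)) + (∫⁻ t in Ioc (0:ℝ) 1, ENNReal.ofReal (t^(-(1+2*s))) * ENNReal.ofReal (w (k+1) t))) := by
          have := hwm k
          have := hwm (k+1)
          rw [lintegral_const_mul _ (by fun_prop), lintegral_add_left (by fun_prop), lintegral_add_left (by fun_prop), lintegral_const_mul _ (by fun_prop)]
      _ ≤ _ := by
          gcongr
          · exact W_int ⟨hs0, hs1⟩ hρ k
          · exact W_int ⟨hs0, hs1⟩ hρ (k+1)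
  calc _ ≤ ∑' k : ℤ, _ := ENNReal.tsum_le_tsum step
    _ = ENNReal.ofReal (C * cb⁻¹) * (ENNReal.ofReal (CΦ * ρ^γ) *
        (ENNReal.ofReal M * (∫⁻ t in Ioc (0:ℝ) 1, ENNReal.ofReal (t^(1-2*s)) * ∑' k, ENNReal.ofReal (dy k (ρ*t))) + ∑' k, W k + ∑' k, W k)) := by
      rw [ENNReal.tsum_mul_left, ENNReal.tsum_mul_left, ENNReal.tsum_add, ENNReal.tsum_add, ENNReal.tsum_mul_left]
      congr 3
      · congr 2
        rw [← lintegral_tsum (fun k => by have := hda k; fun_prop)]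
        simp only [ENNReal.tsum_mul_left]
      · exact (Equiv.addRight (1:ℤ)).tsum_eq W
    _ ≤ ENNReal.ofReal (C * cb⁻¹) * (ENNReal.ofReal (CΦ * ρ^γ) *
        (ENNReal.ofReal M * ENNReal.ofReal (1/(2-2*s)) + ENNReal.ofReal D + ENNReal.ofReal D)) := by
      gcongr
      calc _ ≤ ∫⁻ t in Ioc (0:ℝ) 1, ENNReal.ofReal (t^(1-2*s)) := by
            refine lintegral_mono fun t => ?_
            calc _ ≤ ENNReal.ofReal (t^(1-2*s)) * 1 := by gcongr; exact dy_tsum _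
              _ = _ := mul_one _
        _ = _ := by rw [lint_rpow_Ioc (by linarith)]; congr 2; ring
    _ = _ := by
      rw [← ENNReal.ofReal_mul (by positivity), ← ENNReal.ofReal_add (by positivity) (by positivity), ← ENNReal.ofReal_add (by positivity) (by positivity), ← ENNReal.ofReal_mul (by positivity), ← ENNReal.ofReal_mul (by positivity)]
      congr 1; ring

theorem aniso_nonneg {n : ℕ} (v w : V n) : 0 ≤ anisoDist v w := sqrt_nonneg _

theorem aniso_comm {n : ℕ} (v w : V n) : anisoDist v w = anisoDist w v := by
  unfold anisoDist; rw [norm_sub_rev]; congr 1; ring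

theorem aniso_sq {n : ℕ} (v w : V n) : anisoDist v w ^ 2 = ‖v - w‖ ^ 2 + 4⁻¹ * (‖v‖ ^ 2 - ‖w‖ ^ 2) ^ 2 :=
  sq_sqrt (by positivity)

theorem aniso_self {n : ℕ} (v : V n) : anisoDist v v = 0 := by simp [anisoDist]

theorem norm_le_aniso {n : ℕ} (v w : V n) : ‖v - w‖ ≤ anisoDist v w :=
  le_sqrt_of_sq_le (by nlinarith [sq_nonneg (‖v‖ ^ 2 - ‖w‖ ^ 2)])

theorem aniso_eq_dist {n : ℕ} (v w : V n) : anisoDist v w =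
    dist (WithLp.toLp 2 (v, ‖v‖^2/2)) (WithLp.toLp 2 (w, ‖w‖^2/2)) := by
  rw [WithLp.prod_dist_eq_of_L2]
  unfold anisoDist
  change _ = √(dist v w ^ 2 + dist (‖v‖^2/2) (‖w‖^2/2) ^ 2)
  simp only [dist_eq_norm, Real.norm_eq_abs, sq_abs]
  congr 1; ring

theorem aniso_tri {n : ℕ} (u v w : V n) : anisoDist u w ≤ anisoDist u v + anisoDist v w := by
  simp only [aniso_eq_dist]; exact dist_triangle _ _ _

theorem aniso_pos {n : ℕ} {v w : V n} (h : v ≠ w) : 0 < anisoDist v w :=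
  lt_of_lt_of_le (norm_pos_iff.2 (sub_ne_zero.2 h)) (norm_le_aniso v w)

theorem aniso_cont {n : ℕ} : Continuous (fun p : V n × V n => anisoDist p.1 p.2) := by
  unfold anisoDist; fun_prop

theorem jap_pos {n : ℕ} (v : V n) : 0 < jap v := by unfold jap; positivity

theorem jap_sq {n : ℕ} (v : V n) : jap v ^ 2 = 1 + ‖v‖^2 := sq_sqrt (by positivity)

theorem one_le_jap {n : ℕ} (v : V n) : 1 ≤ jap v := by
  unfold jap; rw [one_le_sqrt]; nlinarith [sq_nonneg ‖v‖]

theorem jap_cont {n : ℕ} : Continuous (jap (n := n)) := by unfold jap; fun_prop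

theorem jap_le_of_aniso {n : ℕ} {v w : V n} (h : anisoDist v w ≤ 1) : jap w ≤ 2 * jap v := by
  have h1 : ‖w‖ ≤ ‖v‖ + 1 := by
    have h2 := norm_le_aniso v w
    have h3 : ‖w‖ ≤ ‖v‖ + ‖v - w‖ := by
      have := norm_sub_le v (v - w); simpa using this
    linarith
  refine le_of_sq_le_sq ?_ (by have := jap_pos v; positivity)
  rw [mul_pow, jap_sq, jap_sq]
  nlinarith [norm_nonneg v, norm_nonneg w, sq_nonneg (‖v‖-1)]
where
  le_of_sq_le_sq {a b : ℝ} (h : a^2 ≤ b^2) (hb : 0 ≤ b) : a ≤ b := by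
    exact abs_le_of_sq_le_sq' h hb |>.2

/-- linear map turning the anisotropic ball into a ball -/
def Mv {n : ℕ} (v : V n) : V n →L[ℝ] V n :=
  ContinuousLinearMap.id ℝ (V n) + ((1 / (1 + jap v)) • innerSL ℝ v).smulRight v

theorem Mv_norm {n : ℕ} (v y : V n) : ‖Mv v y‖^2 = ‖y‖^2 + ⟪v, y⟫^2 := by
  have : Mv v y = y + (1/(1+jap v) * ⟪v, y⟫) • v := by
    simp [Mv]
  rw [this, norm_add_sq_real, norm_smul, inner_smul_right, mul_pow, Real.norm_eq_abs, sq_abs, real_inner_comm v y]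
  have h1 := jap_sq v
  have h2 := jap_pos v
  have : ‖v‖^2 = jap v^2 - 1 := by linarith
  rw [this]
  field_simp
  ring

theorem Mv_det {n : ℕ} (v : V n) : (Mv v).det = jap v := by
  unfold Mv
  rw [det_rankone]
  have h1 := jap_sq v
  have h2 := jap_pos v
  have h3 : ‖v‖^2 = jap v^2 - 1 := by linarith
  simp only [smul_apply, innerSL_apply_apply, real_inner_self_eq_norm_sq, smul_eq_mul, h3]
  field_simp
  ring

theorem vol_ell {n : ℕ} (v : V n) {a : ℝ} (ha : 0 ≤ a) :
    volume {y : V n | ‖y‖^2 + ⟪v,y⟫^2 ≤ a^2} = ENNReal.ofReal (a^n / jap v) * volume (ball (0 : V n) 1) := by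
  have e : {y : V n | ‖y‖^2 + ⟪v,y⟫^2 ≤ a^2} = Mv v ⁻¹' closedBall 0 a := by
    ext y
    rw [mem_preimage, mem_closedBall_zero_iff, mem_ofPred_eq, ← Mv_norm, sq_le_sq₀ (norm_nonneg _) ha]
  have hd : LinearMap.det (Mv v : V n →ₗ[ℝ] V n) = jap v := Mv_det v
  have hj := jap_pos v
  rw [e, Measure.addHaar_preimage_continuousLinearMap _ (by rw [hd]; exact hj.ne'), hd, Measure.addHaar_closedBall _ _ ha,
    ← mul_assoc, ← ENNReal.ofReal_mul (by positivity), abs_of_pos (by positivity)]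
  congr 2
  simp
  field_simp

theorem aniso_add_sq {n : ℕ} (v y : V n) : anisoDist v (v + y) ^ 2 = ‖y‖^2 + (⟪v,y⟫ + ‖y‖^2/2)^2 := by
  rw [aniso_sq, norm_add_sq_real]
  simp
  ring

theorem vol_shift {n : ℕ} (v : V n) (r : ℝ) : volume {w : V n | anisoDist v w ≤ r} = volume {y : V n | anisoDist v (v+y) ≤ r} := by
  have := measure_preimage_add (volume : Measure (V n)) v {w : V n | anisoDist v w ≤ r}
  rw [← this]; rfl

theorem vol_bounds (n : ℕ) : ∃ c C : ℝ, 0 < c ∧ 0 < C ∧ ∀ (v : V n) (r : ℝ), 0 < r → r ≤ 1 →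
    ENNReal.ofReal (c * (r^n / jap v)) ≤ volume {w : V n | anisoDist v w ≤ r} ∧
    volume {w : V n | anisoDist v w ≤ r} ≤ ENNReal.ofReal (C * (r^n / jap v)) := by
  set β := (volume (ball (0 : V n) 1)).toReal with hβ
  have hfin : volume (ball (0 : V n) 1) ≠ ⊤ := measure_ball_lt_top.ne
  have hb : volume (ball (0 : V n) 1) = ENNReal.ofReal β := (ENNReal.ofReal_toReal hfin).symm
  have hb0 : 0 < β := ENNReal.toReal_pos (measure_ball_pos _ _ one_pos).ne' hfin
  refine ⟨β * (1/2)^n, β * 3^n, by positivity, by positivity, fun v r hr hr1 => ?_⟩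
  have hj := jap_pos v
  rw [vol_shift]
  constructor
  · have : ENNReal.ofReal (β * (1/2)^n * (r^n / jap v)) = volume {y : V n | ‖y‖^2 + ⟪v,y⟫^2 ≤ (r/2)^2} := by
      rw [vol_ell v (by positivity), hb, ← ENNReal.ofReal_mul (by positivity)]
      congr 1
      rw [div_pow, div_pow, one_pow]; field_simp
    rw [this]
    refine measure_mono fun y hy => ?_
    rw [mem_ofPred_eq] at hy ⊢
    refine (abs_le_of_sq_le_sq' ?_ hr.le).2
    rw [aniso_add_sq]
    set p := ⟪v,y⟫
    set q := ‖y‖^2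
    have hq : 0 ≤ q := by positivity
    have hp : p ≤ r/2 := (abs_le_of_sq_le_sq' (by nlinarith) (by positivity)).2
    have hq1 : q ≤ (r/2)^2 := by nlinarith [sq_nonneg p]
    nlinarith [mul_le_mul hp hq1 hq (by positivity), mul_le_mul hq1 hq1 hq (by positivity), mul_pos hr hr, mul_nonneg hr.le (sub_nonneg.2 hr1), mul_nonneg (mul_nonneg hr.le (sub_nonneg.2 hr1)) hr.le, mul_nonneg (mul_nonneg (mul_nonneg hr.le (sub_nonneg.2 hr1)) hr.le) hr.le]
  · have : ENNReal.ofReal (β * 3^n * (r^n / jap v)) = volume {y : V n | ‖y‖^2 + ⟪v,y⟫^2 ≤ (3*r)^2} := by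
      rw [vol_ell v (by positivity), hb, ← ENNReal.ofReal_mul (by positivity)]
      congr 1
      rw [mul_pow]; ring
    rw [this]
    refine measure_mono fun y hy => ?_
    rw [mem_ofPred_eq] at hy ⊢
    have h1 : anisoDist v (v+y)^2 ≤ r^2 := pow_le_pow_left₀ (aniso_nonneg _ _) hy 2
    rw [aniso_add_sq] at h1
    set p := ⟪v,y⟫
    set q := ‖y‖^2
    have hq : 0 ≤ q := by positivity
    have hq1 : q ≤ r^2 := by nlinarith [sq_nonneg (p+q/2)]
    have h2 : |p + q/2| ≤ r := abs_le_of_sq_le_sq (by nlinarith) hr.le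
    rw [abs_le] at h2
    have hq2 : q ≤ r := by nlinarith
    have h3 : p^2 ≤ (2*r)^2 := sq_le_sq' (by linarith) (by linarith)
    nlinarith

/-- anisotropic ball -/
def Bd {n : ℕ} (v : V n) (r : ℝ) : Set (V n) := {w | anisoDist v w ≤ r}

theorem aniso_cont_right {n : ℕ} (v : V n) : Continuous (anisoDist v) := by
  have : Continuous (fun w => anisoDist v w) := by unfold anisoDist; fun_prop
  exact this

theorem Bd_meas {n : ℕ} (v : V n) (r : ℝ) : MeasurableSet (Bd v r) :=
  (isClosed_le (aniso_cont_right v) continuous_const).measurableSet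

theorem Bd_fin {n : ℕ} (v : V n) (r : ℝ) : volume (Bd v r) < ⊤ := by
  refine lt_of_le_of_lt (measure_mono (t := closedBall v r) fun w hw => ?_) measure_closedBall_lt_top
  rw [mem_closedBall, dist_comm, dist_eq_norm]
  exact (norm_le_aniso v w).trans hw

theorem int_supp {n : ℕ} {u : V n → ℝ} (hu : Measurable u) {v : V n} {r K : ℝ} (h1 : ∀ w ∈ Bd v r, |u w| ≤ K)
    (h2 : ∀ w ∉ Bd v r, u w = 0) : Integrable u := by
  refine Integrable.mono' (g := (Bd v r).indicator fun _ => K) ?_ hu.aestronglyMeasurable ?_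
  · exact (integrable_indicator_iff (Bd_meas v r)).2 (integrableOn_const (Bd_fin v r).ne)
  · refine Filter.Eventually.of_forall fun w => ?_
    by_cases hw : w ∈ Bd v r
    · rw [indicator_of_mem hw]; exact h1 w hw
    · rw [indicator_of_notMem hw, h2 w hw]; simp

/-- tent function -/
def phi {n : ℕ} (R : ℝ) (x w : V n) : ℝ := max (1 - anisoDist x w / R) 0

/-- mass of the tent function -/
def NN {n : ℕ} (R : ℝ) (x : V n) : ℝ := ∫ w, phi R x w

/-- average of `f` -/
def FF {n : ℕ} (R : ℝ) (f : V n → ℝ) (x : V n) : ℝ := (NN R x)⁻¹ * ∫ w, phi R x w * f w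

/-- local oscillation of `f` -/
def QQ {n : ℕ} (R : ℝ) (f : V n → ℝ) (v : V n) : ℝ := jap v / R ^ n * ∫ w in Bd v (2*R), (f w - f v)^2

theorem phi_cont {n : ℕ} (R : ℝ) : Continuous (fun p : V n × V n => phi R p.1 p.2) := by
  unfold phi; have := aniso_cont (n := n); fun_prop

theorem phi_cont_right {n : ℕ} (R : ℝ) (x : V n) : Continuous (phi R x) := by
  have h := aniso_cont_right x
  have : Continuous (fun w => phi R x w) := by unfold phi; fun_prop
  exact this

theorem phi_nonneg {n : ℕ} (R : ℝ) (x w : V n) : 0 ≤ phi R x w := le_max_right _ _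

theorem phi_le_one {n : ℕ} {R : ℝ} (hR : 0 < R) (x w : V n) : phi R x w ≤ 1 :=
  max_le (by have := div_nonneg (aniso_nonneg x w) hR.le; linarith) zero_le_one

theorem phi_zero {n : ℕ} {R : ℝ} (hR : 0 < R) {x w : V n} (h : w ∉ Bd x R) : phi R x w = 0 := by
  refine max_eq_right ?_
  have : R < anisoDist x w := not_le.1 h
  have := (one_lt_div hR).2 this
  linarith

theorem phi_int {n : ℕ} {R : ℝ} (hR : 0 < R) (x : V n) {u : V n → ℝ} (hu : Measurable u) {K : ℝ} (hK : ∀ w, |u w| ≤ K) :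
    Integrable (fun w => phi R x w * u w) := by
  have := (phi_cont_right R x).measurable
  refine int_supp (v := x) (r := R) (K := K) (by fun_prop) (fun w _ => ?_) (fun w hw => by rw [phi_zero hR hw, zero_mul])
  rw [abs_mul, abs_of_nonneg (phi_nonneg _ _ _)]
  have := phi_le_one hR x w
  nlinarith [abs_nonneg (u w), hK w]

theorem phi_int1 {n : ℕ} {R : ℝ} (hR : 0 < R) (x : V n) : Integrable (phi R x) := by
  have := phi_int hR x (u := fun _ => 1) measurable_const (K := 1) (by simp)
  simpa using this

theorem vol_bounds' (n : ℕ) : ∃ c C : ℝ, 0 < c ∧ 0 < C ∧ ∀ (v : V n) (r : ℝ), 0 < r → r ≤ 1 →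
    c * (r^n / jap v) ≤ volume.real (Bd v r) ∧ volume.real (Bd v r) ≤ C * (r^n / jap v) := by
  obtain ⟨c, C, hc, hC, h⟩ := vol_bounds n
  refine ⟨c, C, hc, hC, fun v r hr hr1 => ?_⟩
  obtain ⟨h1, h2⟩ := h v r hr hr1
  have hj := jap_pos v
  have hfin := (Bd_fin v r).ne
  exact ⟨(ENNReal.ofReal_le_iff_le_toReal hfin).1 h1, ENNReal.toReal_le_of_le_ofReal (by positivity) h2⟩

theorem NN_lower (n : ℕ) : ∃ c : ℝ, 0 < c ∧ ∀ (x : V n) (R : ℝ), 0 < R → R ≤ 1 → c * (R^n / jap x) ≤ NN R x := by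
  obtain ⟨c, C, hc, hC, h⟩ := vol_bounds' n
  refine ⟨c / 2^n / 2, by positivity, fun x R hR hR1 => ?_⟩
  have h1 := (h x (R/2) (by positivity) (by linarith)).1
  have hj := jap_pos x
  calc c / 2^n / 2 * (R^n / jap x) = (1/2) * (c * ((R/2)^n / jap x)) := by rw [div_pow]; field_simp
    _ ≤ (1/2) * volume.real (Bd x (R/2)) := by gcongr
    _ = ∫ w in Bd x (R/2), (1/2 : ℝ) := by rw [setIntegral_const]; simp; ring
    _ ≤ ∫ w in Bd x (R/2), phi R x w := by
        refine setIntegral_mono_on (integrableOn_const (Bd_fin x _).ne) (phi_int1 hR x).integrableOn (Bd_meas _ _) fun w hw => ?_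
        refine le_max_of_le_left ?_
        have : anisoDist x w / R ≤ 1/2 := by
          rw [div_le_iff₀ hR]; have : anisoDist x w ≤ R/2 := hw; linarith
        linarith
    _ ≤ NN R x := setIntegral_le_integral (phi_int1 hR x) (Filter.Eventually.of_forall fun w => phi_nonneg _ _ _)

theorem sq_int_le {α : Type*} [MeasurableSpace α] {μ : Measure α} {p u : α → ℝ} (hp : ∀ w, 0 ≤ p w) (h0 : Integrable p μ)
    (h1 : Integrable (fun w => p w * u w) μ) (h2 : Integrable (fun w => p w * u w ^ 2) μ) (hP : 0 < ∫ w, p w ∂μ) :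
    (∫ w, p w * u w ∂μ)^2 ≤ (∫ w, p w ∂μ) * ∫ w, p w * u w ^ 2 ∂μ := by
  set P := ∫ w, p w ∂μ
  set I := ∫ w, p w * u w ∂μ
  set J := ∫ w, p w * u w ^ 2 ∂μ
  have h : 0 ≤ ∫ w, (p w * u w ^ 2 - (2*(I/P)) * (p w * u w) + (I/P)^2 * p w) ∂μ := by
    refine integral_nonneg fun w => ?_
    have : p w * u w ^ 2 - (2*(I/P)) * (p w * u w) + (I/P)^2 * p w = p w * (u w - I/P)^2 := by ring
    change 0 ≤ p w * u w ^ 2 - (2*(I/P)) * (p w * u w) + (I/P)^2 * p w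
    rw [this]; exact mul_nonneg (hp w) (sq_nonneg _)
  rw [integral_add (f := fun w => p w * u w ^ 2 - (2*(I/P)) * (p w * u w)) (h2.sub (h1.const_mul _)) (h0.const_mul _), integral_sub h2 (h1.const_mul _), integral_const_mul, integral_const_mul] at h
  have e : J - 2*(I/P)*I + (I/P)^2 * P = J - I^2/P := by field_simp; ring
  have h' : 0 ≤ J - I^2/P := by rw [← e]; exact h
  have : I^2/P ≤ J := by linarith
  rw [div_le_iff₀ hP] at this
  linarith

theorem Bd_int {n : ℕ} (v : V n) (r : ℝ) {u : V n → ℝ} (hu : Measurable u) {K : ℝ} (hK : ∀ w, |u w| ≤ K) :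
    IntegrableOn u (Bd v r) := by
  refine Integrable.mono' (integrableOn_const (C := K) (Bd_fin v r).ne) hu.aestronglyMeasurable
    (Filter.Eventually.of_forall fun w => hK w)

theorem QQ_nonneg {n : ℕ} {R : ℝ} (hR : 0 < R) (f : V n → ℝ) (v : V n) : 0 ≤ QQ R f v := by
  have := jap_pos v
  exact mul_nonneg (by positivity) (integral_nonneg fun w => sq_nonneg _)

theorem avg1 (n : ℕ) : ∃ C : ℝ, 0 < C ∧ ∀ (f : V n → ℝ) (Mf : ℝ), Measurable f → (∀ w, |f w| ≤ Mf) →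
    ∀ (R : ℝ), 0 < R → R ≤ 1/2 → ∀ v x : V n, anisoDist v x ≤ R → (FF R f x - f v)^2 ≤ C * QQ R f v := by
  obtain ⟨c, hc, hN⟩ := NN_lower n
  refine ⟨2/c, by positivity, fun f Mf hf hM R hR hR1 v x hx => ?_⟩
  have hjx := jap_pos x
  have hjv := jap_pos v
  have hN1 := hN x R hR (by linarith)
  have hN0 : 0 < NN R x := lt_of_lt_of_le (by positivity) hN1
  have hj2 := jap_le_of_aniso (show anisoDist v x ≤ 1 by linarith)
  have b1 : ∀ w, |f w - f v| ≤ Mf + Mf := fun w => (abs_sub _ _).trans (add_le_add (hM w) (hM v))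
  have b2 : ∀ w, |(f w - f v)^2| ≤ (Mf+Mf)^2 := fun w => by
    rw [abs_pow]; exact pow_le_pow_left₀ (abs_nonneg _) (b1 w) 2
  have e1 : FF R f x - f v = (NN R x)⁻¹ * ∫ w, phi R x w * (f w - f v) := by
    have : ∫ w, phi R x w * (f w - f v) = (∫ w, phi R x w * f w) - f v * NN R x := by
      rw [NN, ← integral_const_mul, ← integral_sub (phi_int hR x hf hM) ((phi_int1 hR x).const_mul _)]
      congr 1; ext w; ring
    rw [this, FF]; field_simp
  have h2 := sq_int_le (μ := (volume : Measure (V n))) (p := phi R x) (u := fun w => f w - f v) (phi_nonneg R x) (phi_int1 hR x)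
    (phi_int hR x (by fun_prop) b1) (phi_int hR x (by fun_prop) b2) hN0
  have h3 : ∫ w, phi R x w * (f w - f v)^2 ≤ ∫ w in Bd v (2*R), (f w - f v)^2 := by
    rw [← integral_indicator (Bd_meas _ _)]
    refine integral_mono (phi_int hR x (by fun_prop) b2) ((integrable_indicator_iff (Bd_meas _ _)).2 (Bd_int v _ (by fun_prop) b2)) fun w => ?_
    beta_reduce
    by_cases hw : w ∈ Bd v (2*R)
    · rw [indicator_of_mem hw]
      have := phi_le_one hR x w
      nlinarith [sq_nonneg (f w - f v)]
    · rw [indicator_of_notMem hw, phi_zero hR, zero_mul]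
      intro hw2
      apply hw
      have h4 := aniso_tri v x w
      have h5 : anisoDist x w ≤ R := hw2
      change anisoDist v w ≤ 2*R
      linarith
  set S := ∫ w in Bd v (2*R), (f w - f v)^2 with hS
  have hS0 : 0 ≤ S := integral_nonneg fun w => sq_nonneg _
  rw [e1, mul_pow]
  calc (NN R x)⁻¹^2 * (∫ w, phi R x w * (f w - f v))^2 ≤ (NN R x)⁻¹^2 * (NN R x * S) := by
        gcongr
        exact h2.trans (mul_le_mul_of_nonneg_left h3 hN0.le)
    _ = S / NN R x := by field_simp
    _ ≤ S / (c * (R^n / (2*jap v))) := by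
        gcongr
        refine le_trans ?_ hN1
        gcongr
    _ = 2/c * QQ R f v := by rw [QQ, ← hS]; field_simp

theorem avg2 (n : ℕ) : ∃ C : ℝ, 0 < C ∧ ∀ (f : V n → ℝ) (Mf : ℝ), Measurable f → (∀ w, |f w| ≤ Mf) →
    ∀ (R : ℝ), 0 < R → R ≤ 1/2 → ∀ v x y : V n, anisoDist v x ≤ R → anisoDist v y ≤ R →
      (FF R f x - FF R f y)^2 ≤ C * (anisoDist x y / R)^2 * QQ R f v := by
  obtain ⟨c, hc, hN⟩ := NN_lower n
  obtain ⟨_, D, _, hD, hV⟩ := vol_bounds' n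
  obtain ⟨A, hA, hA1⟩ := avg1 n
  refine ⟨(c⁻¹ * 2)^2 * (D * 2^n) * (2 + 2 * (D * 2^n) * A), by positivity, fun f Mf hf hM R hR hR1 v x y hx hy => ?_⟩
  have hjx := jap_pos x
  have hjv := jap_pos v
  have hN1 := hN x R hR (by linarith)
  have hN0 : 0 < NN R x := lt_of_lt_of_le (by positivity) hN1
  have hNy : 0 < NN R y := lt_of_lt_of_le (by have := jap_pos y; positivity) (hN y R hR (by linarith))
  have hj2 := jap_le_of_aniso (show anisoDist v x ≤ 1 by linarith)
  set m := FF R f y with hm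
  set B := Bd v (2*R) with hB
  have bm : ∀ w, |f w - m| ≤ Mf + |m| := fun w => (abs_sub _ _).trans (add_le_add (hM w) le_rfl)
  have bm2 : ∀ w, |(f w - m)^2| ≤ (Mf + |m|)^2 := fun w => by
    rw [abs_pow]; exact pow_le_pow_left₀ (abs_nonneg _) (bm w) 2
  have b1 : ∀ w, |f w - f v| ≤ Mf + Mf := fun w => (abs_sub _ _).trans (add_le_add (hM w) (hM v))
  have b2 : ∀ w, |(f w - f v)^2| ≤ (Mf+Mf)^2 := fun w => by
    rw [abs_pow]; exact pow_le_pow_left₀ (abs_nonneg _) (b1 w) 2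
  have key : ∀ z : V n, 0 < NN R z → ∫ w, phi R z w * (f w - m) = NN R z * (FF R f z - m) := by
    intro z hz
    have : ∫ w, phi R z w * (f w - m) = (∫ w, phi R z w * f w) - m * NN R z := by
      rw [NN, ← integral_const_mul, ← integral_sub (phi_int hR z hf hM) ((phi_int1 hR z).const_mul _)]
      congr 1; ext w; ring
    rw [this, FF]; field_simp
  have e1 : NN R x * (FF R f x - m) = ∫ w, (phi R x w - phi R y w) * (f w - m) := by
    have h1 := key x hN0
    have h2 := key y hNy
    rw [hm, sub_self, mul_zero, ← hm] at h2
    rw [← h1, ← sub_zero (∫ w, phi R x w * (f w - m)), ← h2, ← integral_sub (phi_int hR x (by fun_prop) bm) (phi_int hR y (by fun_prop) bm)]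
    congr 1; ext w; ring
  set δ := anisoDist x y / R with hδ
  have hδ0 : 0 ≤ δ := div_nonneg (aniso_nonneg _ _) hR.le
  have hdiff : ∀ w, |phi R x w - phi R y w| ≤ δ := by
    intro w
    refine (abs_max_sub_max_le_abs _ _ _).trans ?_
    rw [show 1 - anisoDist x w / R - (1 - anisoDist y w / R) = (anisoDist y w - anisoDist x w)/R by ring, abs_div, abs_of_pos hR, hδ]
    gcongr
    rw [abs_le]
    have h1 := aniso_tri x y w
    have h2 := aniso_tri y x w
    rw [aniso_comm y x] at h2
    constructor <;> linarith
  have hzero : ∀ z : V n, anisoDist v z ≤ R → ∀ w ∉ B, phi R z w = 0 := by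
    intro z hz w hw
    refine phi_zero hR fun hw2 => hw ?_
    have h4 := aniso_tri v z w
    have h5 : anisoDist z w ≤ R := hw2
    change anisoDist v w ≤ 2*R
    linarith
  have hI : |NN R x * (FF R f x - m)| ≤ δ * ∫ w in B, |f w - m| := by
    rw [e1, ← integral_indicator (Bd_meas _ _), ← integral_const_mul]
    refine (abs_integral_le_integral_abs).trans (integral_mono_of_nonneg (Filter.Eventually.of_forall fun w => abs_nonneg _) ?_ (Filter.Eventually.of_forall fun w => ?_))
    · refine Integrable.const_mul ((integrable_indicator_iff (Bd_meas _ _)).2 (Bd_int v _ (by fun_prop) (K := Mf + |m|) fun w => ?_)) _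
      rw [abs_abs]; exact bm w
    · beta_reduce
      by_cases hw : w ∈ B
      · rw [indicator_of_mem hw, abs_mul]
        gcongr; exact hdiff w
      · rw [indicator_of_notMem hw, hzero x hx w hw, hzero y hy w hw]; simp
  have hvol : volume.real B ≤ D * 2^n * (R^n / jap v) := by
    have := (hV v (2*R) (by positivity) (by linarith)).2
    rw [mul_pow] at this
    calc _ ≤ _ := this
      _ = _ := by ring
  have hvol0 : 0 < volume.real B := by
    have := (hV v (2*R) (by positivity) (by linarith)).1
    exact lt_of_lt_of_le (by positivity) this
  have hCS : (∫ w in B, |f w - m|)^2 ≤ volume.real B * ∫ w in B, (f w - m)^2 := by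
    have := sq_int_le (μ := volume.restrict B) (p := fun _ => 1) (u := fun w => |f w - m|) (fun _ => zero_le_one)
      (integrableOn_const (Bd_fin v _).ne)
      (by simp only [one_mul]; exact Bd_int v _ (by fun_prop) (K := Mf + |m|) fun w => by rw [abs_abs]; exact bm w)
      (by simp only [one_mul, sq_abs]; exact Bd_int v _ (by fun_prop) bm2)
      (by simpa using hvol0)
    simpa using this
  set S := ∫ w in B, (f w - f v)^2 with hS
  have hS0 : 0 ≤ S := integral_nonneg fun w => sq_nonneg _
  have hQ : QQ R f v = jap v / R^n * S := rfl
  have hA2 := hA1 f Mf hf hM R hR hR1 v y hy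
  rw [← hm] at hA2
  have hS2 : ∫ w in B, (f w - m)^2 ≤ 2 * S + 2 * volume.real B * (m - f v)^2 := by
    calc _ ≤ ∫ w in B, (2 * (f w - f v)^2 + 2 * (m - f v)^2) := by
          refine integral_mono (Bd_int v _ (by fun_prop) bm2) (((Bd_int v _ (by fun_prop) b2).const_mul 2).add (integrableOn_const (Bd_fin v _).ne)) fun w => ?_
          beta_reduce
          nlinarith [sq_nonneg (f w - f v + (m - f v))]
      _ = _ := by
        rw [integral_add ((Bd_int v _ (by fun_prop) b2).const_mul 2) (integrableOn_const (Bd_fin v _).ne), integral_const_mul]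
        simp; ring
  set T := ∫ w in B, (f w - m)^2
  have hT : volume.real B * T ≤ (D * 2^n * (R^n / jap v))^2 * ((2 / (D*2^n) + 2 * A) * QQ R f v) := by
    have hSQ : S = QQ R f v * (R^n / jap v) := by rw [hQ]; field_simp
    have hQ0 := QQ_nonneg hR f v
    calc volume.real B * T ≤ volume.real B * (2*S + 2*volume.real B * (A * QQ R f v)) := by gcongr; exact hS2.trans (by gcongr)
      _ ≤ (D * 2^n * (R^n / jap v)) * (2*S + 2*(D * 2^n * (R^n / jap v)) * (A * QQ R f v)) := by gcongr
      _ = _ := by rw [hSQ]; field_simp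
  have h1 : (NN R x * (FF R f x - m))^2 ≤ δ^2 * ((D * 2^n * (R^n / jap v))^2 * ((2 / (D*2^n) + 2 * A) * QQ R f v)) := by
    rw [← sq_abs]
    calc _ ≤ (δ * ∫ w in B, |f w - m|)^2 := pow_le_pow_left₀ (abs_nonneg _) hI 2
      _ = δ^2 * (∫ w in B, |f w - m|)^2 := by ring
      _ ≤ _ := by gcongr; exact hCS.trans hT
  have hN2 : c * (R^n / (2 * jap v)) ≤ NN R x := le_trans (by gcongr) hN1
  have h2 : (c * (R^n / (2 * jap v)))^2 * (FF R f x - m)^2 ≤ (NN R x * (FF R f x - m))^2 := by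
    rw [mul_pow (NN R x)]
    exact mul_le_mul_of_nonneg_right (pow_le_pow_left₀ (by positivity) hN2 2) (sq_nonneg _)
  have h3 := h2.trans h1
  have h4 : (FF R f x - m)^2 ≤ (δ^2 * ((D * 2^n * (R^n / jap v))^2 * ((2 / (D*2^n) + 2 * A) * QQ R f v))) / (c * (R^n / (2 * jap v)))^2 := by
    rw [le_div_iff₀ (by positivity)]; linarith
  refine h4.trans (le_of_eq ?_)
  field_simp

theorem FF_bound {n : ℕ} {f : V n → ℝ} {Mf : ℝ} (hf : Measurable f) (hM : ∀ w, |f w| ≤ Mf) {R : ℝ} (hR : 0 < R)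
    (hR1 : R ≤ 1) (x : V n) : |FF R f x| ≤ Mf := by
  obtain ⟨c, hc, hN⟩ := NN_lower n
  have hN0 : 0 < NN R x := lt_of_lt_of_le (by have := jap_pos x; positivity) (hN x R hR hR1)
  unfold FF
  rw [abs_mul, abs_of_pos (inv_pos.2 hN0), inv_mul_le_iff₀ hN0]
  calc |∫ w, phi R x w * f w| ≤ ∫ w, |phi R x w * f w| := abs_integral_le_integral_abs
    _ ≤ ∫ w, phi R x w * Mf := by
      refine integral_mono (phi_int hR x hf hM).abs ((phi_int1 hR x).mul_const _) fun w => ?_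
      beta_reduce
      rw [abs_mul, abs_of_nonneg (phi_nonneg _ _ _)]
      exact mul_le_mul_of_nonneg_left (hM w) (phi_nonneg _ _ _)
    _ = NN R x * Mf := by rw [integral_mul_const]; rfl

theorem FF_meas {n : ℕ} {f : V n → ℝ} (hf : Measurable f) (R : ℝ) : Measurable (FF R f) := by
  have hp := (phi_cont (n := n) R).measurable
  have h1 : Measurable (fun x : V n => ∫ w, phi R x w) :=
    (StronglyMeasurable.integral_prod_right (f := fun x w => phi R x w) hp.stronglyMeasurable).measurable
  have h2 : Measurable (fun x : V n => ∫ w, phi R x w * f w) := by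
    refine (StronglyMeasurable.integral_prod_right (f := fun x w => phi R x w * f w) ?_).measurable
    exact (hp.mul (hf.comp measurable_snd)).stronglyMeasurable
  exact h1.inv.mul h2

/-- the anisotropic difference quotient -/
def DD {n : ℕ} (s : ℝ) (f : V n → ℝ) (v : V n) : ℝ≥0∞ :=
  ∫⁻ w : V n, (if anisoDist v w ≤ 1 then
    ENNReal.ofReal ((f w - f v) ^ 2 * anisoDist v w ^ (-((n : ℝ) + 2 * s))) else 0)

theorem QQ_eq {n : ℕ} {f : V n → ℝ} {Mf : ℝ} (hf : Measurable f) (hM : ∀ w, |f w| ≤ Mf) {R : ℝ} (hR : 0 < R) (v : V n) :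
    ENNReal.ofReal (QQ R f v) = ENNReal.ofReal (jap v / R^n) *
      ∫⁻ w, (if anisoDist v w ≤ 2*R then ENNReal.ofReal ((f w - f v)^2) else 0) := by
  have hj := jap_pos v
  have b1 : ∀ w, |f w - f v| ≤ Mf + Mf := fun w => (abs_sub _ _).trans (add_le_add (hM w) (hM v))
  have b2 : ∀ w, |(f w - f v)^2| ≤ (Mf+Mf)^2 := fun w => by
    rw [abs_pow]; exact pow_le_pow_left₀ (abs_nonneg _) (b1 w) 2
  rw [QQ, ENNReal.ofReal_mul (by positivity), ofReal_integral_eq_lintegral_ofReal (Bd_int v _ (by fun_prop) b2)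
    (Filter.Eventually.of_forall fun w => sq_nonneg _), ← lintegral_indicator (Bd_meas _ _)]
  congr 1

theorem aniso_meas {n : ℕ} : Measurable (fun p : V n × V n => anisoDist p.1 p.2) := aniso_cont.measurable

theorem QQ_meas {n : ℕ} {f : V n → ℝ} {Mf : ℝ} (hf : Measurable f) (hM : ∀ w, |f w| ≤ Mf) {R : ℝ} (hR : 0 < R) :
    Measurable (fun v => ENNReal.ofReal (QQ R f v)) := by
  simp only [QQ_eq hf hM hR]
  have hj := (jap_cont (n := n)).measurable
  refine Measurable.mul (by fun_prop) ?_
  refine Measurable.lintegral_prod_right (f := fun p w : V n => (if anisoDist p w ≤ 2*R then ENNReal.ofReal ((f w - f p)^2) else 0)) ?_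
  exact Measurable.ite (measurableSet_le aniso_meas (by fun_prop)) (by fun_prop) (by fun_prop)

theorem QQ_sum (n : ℕ) {s : ℝ} (hs : s ∈ Ioo (0:ℝ) 1) : ∃ C : ℝ, 0 < C ∧ ∀ (f : V n → ℝ) (Mf : ℝ), Measurable f → (∀ w, |f w| ≤ Mf) →
    ∀ (J : ℝ), 1 ≤ J → ∀ v : V n,
    ∑' k : ℤ, (if 2*(2:ℝ)^(-k)*J ≤ 1/2 then ENNReal.ofReal (((2:ℝ)^(-k))^(-(2*s))) * ENNReal.ofReal (QQ (2*(2:ℝ)^(-k)*J) f v) else 0)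
      ≤ ENNReal.ofReal (C * J^(2*s)) * (ENNReal.ofReal (jap v) * DD s f v) := by
  obtain ⟨hs0, hs1⟩ := hs
  obtain ⟨C, hC, h⟩ := geo_large (p := (n:ℝ) + 2*s) (by positivity)
  refine ⟨C * (2^(n:ℝ))⁻¹ * 4^((n:ℝ) + 2*s), by positivity, fun f Mf hf hM J hJ v => ?_⟩
  have hJ0 : 0 < J := by linarith
  have hj := jap_pos v
  have hjm := (jap_cont (n := n)).measurable
  have ham : Measurable (anisoDist v) := (aniso_cont_right v).measurable
  calc _ ≤ ∑' k : ℤ, ENNReal.ofReal (jap v) * ∫⁻ w, ENNReal.ofReal ((2*J)^(-(n:ℝ))) *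
        (if anisoDist v w ≤ 1 then (if anisoDist v w/(4*J) ≤ (2:ℝ)^(-k) then ENNReal.ofReal (((2:ℝ)^(-k))^(-((n:ℝ)+2*s))) else 0) * ENNReal.ofReal ((f w - f v)^2) else 0) := by
        refine ENNReal.tsum_le_tsum fun k => ?_
        split_ifs with hk
        · set x : ℝ := (2:ℝ)^(-k) with hx
          have hx0 : 0 < x := by positivity
          rw [QQ_eq hf hM (by positivity), ← mul_assoc, ← ENNReal.ofReal_mul (by positivity)]
          have e : x^(-(2*s)) * (jap v / (2*x*J)^n) = jap v * ((2*J)^(-(n:ℝ)) * x^(-((n:ℝ)+2*s))) := by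
            rw [neg_add, rpow_add hx0, rpow_neg (x := 2*J) (by positivity), rpow_neg hx0.le (n:ℝ), rpow_natCast, rpow_natCast, show 2*x*J = (2*J)*x by ring, mul_pow]
            field_simp
          rw [e, ENNReal.ofReal_mul hj.le, mul_assoc]
          gcongr
          rw [← lintegral_const_mul _ (Measurable.ite (measurableSet_le ham (by fun_prop)) (by fun_prop) (by fun_prop))]
          refine lintegral_mono fun w => ?_
          by_cases hw : anisoDist v w ≤ 2*(2*x*J)
          · have hw1 : anisoDist v w ≤ 1 := by linarith
            have hw2 : anisoDist v w/(4*J) ≤ x := by rw [div_le_iff₀ (by positivity)]; linarith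
            simp only [hw, hw1, hw2, if_true]
            rw [ENNReal.ofReal_mul (by positivity), mul_assoc]
          · simp only [hw, if_false, mul_zero]; exact zero_le
        · exact zero_le
    _ = ENNReal.ofReal (jap v) * ∫⁻ w, ENNReal.ofReal ((2*J)^(-(n:ℝ))) *
        (if anisoDist v w ≤ 1 then (∑' k : ℤ, if anisoDist v w/(4*J) ≤ (2:ℝ)^(-k) then ENNReal.ofReal (((2:ℝ)^(-k))^(-((n:ℝ)+2*s))) else 0) * ENNReal.ofReal ((f w - f v)^2) else 0) := by
        rw [ENNReal.tsum_mul_left]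
        congr 1
        rw [← lintegral_tsum]
        · refine lintegral_congr fun w => ?_
          rw [ENNReal.tsum_mul_left]
          congr 1
          split_ifs
          · rw [ENNReal.tsum_mul_right]
          · simp
        · intro k
          refine Measurable.aemeasurable (Measurable.const_mul ?_ _)
          refine Measurable.ite (measurableSet_le ham (by fun_prop)) (Measurable.mul (Measurable.ite (measurableSet_le (by fun_prop) (by fun_prop)) (by fun_prop) (by fun_prop)) (by fun_prop)) (by fun_prop)
    _ ≤ ENNReal.ofReal (jap v) * ∫⁻ w, ENNReal.ofReal (C * (2^(n:ℝ))⁻¹ * 4^((n:ℝ) + 2*s) * J^(2*s)) * (if anisoDist v w ≤ 1 then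
    ENNReal.ofReal ((f w - f v) ^ 2 * anisoDist v w ^ (-((n : ℝ) + 2 * s))) else 0) := by
        refine mul_le_mul_right (lintegral_mono fun w => ?_) _
        split_ifs with hw
        · by_cases hvw : v = w
          · subst hvw; simp
          have hd := aniso_pos hvw
          have := h (anisoDist v w/(4*J)) (by positivity)
          calc _ ≤ ENNReal.ofReal ((2*J)^(-(n:ℝ))) * (ENNReal.ofReal (C * (anisoDist v w/(4*J))^(-((n:ℝ)+2*s))) * ENNReal.ofReal ((f w - f v)^2)) := by gcongr
            _ = _ := by
              rw [← ENNReal.ofReal_mul (by positivity), ← ENNReal.ofReal_mul (by positivity), ← ENNReal.ofReal_mul (by positivity)]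
              congr 1
              rw [div_rpow hd.le (by positivity), rpow_neg (x := 4*J) (by positivity), rpow_neg (x := 2*J) (by positivity), mul_rpow (by norm_num) hJ0.le, mul_rpow (by norm_num) hJ0.le, rpow_add hJ0]
              field_simp
        · simp
    _ = _ := by
      rw [lintegral_const_mul _ (Measurable.ite (measurableSet_le ham (by fun_prop)) (by fun_prop) (by fun_prop))]
      rw [DD]; ring

/-- cosine of the half angle -/
def cc {n : ℕ} (z ω : V n) : ℝ := ⟪z, ω⟫ / ‖z‖

/-- the point `v'` in `ω` variables -/
def vp {n : ℕ} (vs v ω : V n) : V n := vs + ⟪v - vs, ω⟫ • ω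

/-- the point `v^♯` -/
def vsh {n : ℕ} (vs v ω : V n) : V n := vs + (‖v - vs‖ / cc (v - vs) ω) • ω

theorem cc_le_one {n : ℕ} (z : V n) {ω : V n} (hω : ‖ω‖ = 1) : cc z ω ≤ 1 := by
  unfold cc
  by_cases hz : ‖z‖ = 0
  · rw [hz]; simp
  · have : 0 < ‖z‖ := lt_of_le_of_ne (norm_nonneg _) (Ne.symm hz)
    rw [div_le_one this]
    have := real_inner_le_norm z ω
    rwa [hω, mul_one] at this

section geom
variable {n : ℕ} {vs v ω : V n}

theorem inner_cc (hz : 0 < ‖v - vs‖) : ⟪v - vs, ω⟫ = ‖v - vs‖ * cc (v-vs) ω := by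
  unfold cc; field_simp

theorem norm_vp_vs (hω : ‖ω‖ = 1) (hz : 0 < ‖v - vs‖) : ‖vp vs v ω - vs‖^2 = (‖v - vs‖ * cc (v-vs) ω)^2 := by
  rw [vp, add_sub_cancel_left, norm_smul, hω, mul_one, inner_cc hz, Real.norm_eq_abs, sq_abs]

theorem norm_vsh_vs (hω : ‖ω‖ = 1) : ‖vsh vs v ω - vs‖^2 = (‖v - vs‖ / cc (v-vs) ω)^2 := by
  rw [vsh, add_sub_cancel_left, norm_smul, hω, mul_one, Real.norm_eq_abs, sq_abs]

theorem norm_vp_v (hω : ‖ω‖ = 1) (hz : 0 < ‖v - vs‖) : ‖vp vs v ω - v‖^2 = ‖v - vs‖^2 * (1 - cc (v-vs) ω^2) := by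
  have e : vp vs v ω - v = ⟪v - vs, ω⟫ • ω - (v - vs) := by rw [vp]; abel
  rw [e, norm_sub_sq_real, norm_smul, inner_smul_left, real_inner_comm (v-vs) ω, hω, inner_cc hz]
  simp only [conj_trivial, mul_one, Real.norm_eq_abs, sq_abs]
  ring

theorem norm_vsh_v (hω : ‖ω‖ = 1) (hz : 0 < ‖v - vs‖) (hc : 0 < cc (v-vs) ω) :
    ‖vsh vs v ω - v‖^2 = ‖v - vs‖^2 * ((cc (v-vs) ω^2)⁻¹ - 1) := by
  have e : vsh vs v ω - v = (‖v - vs‖ / cc (v-vs) ω) • ω - (v - vs) := by rw [vsh]; abel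
  rw [e, norm_sub_sq_real, norm_smul, inner_smul_left, real_inner_comm (v-vs) ω, hω, inner_cc hz]
  simp only [conj_trivial, mul_one, Real.norm_eq_abs, sq_abs]
  field_simp
  ring

theorem norm_vsh_vp (hω : ‖ω‖ = 1) (hz : 0 < ‖v - vs‖) :
    ‖vsh vs v ω - vp vs v ω‖ = |‖v - vs‖ * ((cc (v-vs) ω)⁻¹ - cc (v-vs) ω)| := by
  have e : vsh vs v ω - vp vs v ω = (‖v - vs‖ * ((cc (v-vs) ω)⁻¹ - cc (v-vs) ω)) • ω := by
    rw [vsh, vp, inner_cc hz, add_sub_add_left_eq_sub, ← sub_smul]; congr 1; ring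
  rw [e, norm_smul, hω, mul_one, Real.norm_eq_abs]

theorem sq_diff (p q : V n) : ‖q‖^2 - ‖p‖^2 = (‖q - vs‖^2 - ‖p - vs‖^2) + 2 * ⟪q - p, vs⟫ := by
  rw [norm_sub_sq_real, norm_sub_sq_real, inner_sub_left]; ring

theorem aniso_near {q : V n} {ξ : ℝ} (hξ0 : 0 ≤ ξ) (hξ : ξ ≤ 1) (h1 : ‖q - v‖^2 ≤ ξ^2) (h2 : |‖q - vs‖^2 - ‖v - vs‖^2| ≤ ξ^2) :
    anisoDist v q ≤ √2 * ξ * jap vs := by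
  have hj := jap_pos vs
  refine sqrt_le_iff.2 ⟨by positivity, ?_⟩
  rw [mul_pow, mul_pow, jap_sq, sq_sqrt (by norm_num), norm_sub_rev v q]
  have h1' : ‖q - v‖ ≤ ξ := (abs_le_of_sq_le_sq' h1 hξ0).2
  have h3 := sq_diff (vs := vs) v q
  have h4 : |⟪q - v, vs⟫| ≤ ξ * ‖vs‖ := (abs_real_inner_le_norm _ _).trans (by gcongr)
  have h5 : |‖v‖^2 - ‖q‖^2| ≤ ξ * (ξ + 2*‖vs‖) := by
    rw [abs_sub_comm, h3]
    refine (abs_add_le _ _).trans ?_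
    rw [abs_mul, abs_two]
    linarith
  have h6 : (‖v‖^2 - ‖q‖^2)^2 ≤ (ξ * (ξ + 2*‖vs‖))^2 := by
    rw [← sq_abs]; exact pow_le_pow_left₀ (abs_nonneg _) h5 2
  have h7 : (ξ + 2*‖vs‖)^2 ≤ 2*ξ^2 + 8*‖vs‖^2 := by nlinarith [sq_nonneg (ξ - 2*‖vs‖)]
  have h8 : (ξ * (ξ + 2*‖vs‖))^2 ≤ ξ^2 * (2 + 8*‖vs‖^2) := by
    rw [mul_pow]; gcongr; nlinarith
  nlinarith

set_option maxHeartbeats 1000000 in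
/-- angular condition on the supports of the kernels -/
theorem geom_all {x : ℝ} (hx : 0 < x) (hx1 : x ≤ 1/4) (hω : ‖ω‖ = 1) (hz : 0 < ‖v - vs‖) (hc : 0 < cc (v-vs) ω)
    (hc2 : 1/2 ≤ cc (v-vs) ω^2) (hs : ‖v - vs‖ * √(1 - cc (v-vs) ω^2) ≤ x) :
    anisoDist v (vp vs v ω) ≤ 2 * x * jap vs ∧ anisoDist v (vsh vs v ω) ≤ 2 * x * jap vs ∧
    anisoDist (vsh vs v ω) (vp vs v ω) / (2 * x * jap vs) ≤ 3 * (x * (1 + 1/‖v - vs‖)) := by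
  set c := cc (v-vs) ω with hcd
  set ρ := ‖v - vs‖ with hρ
  have hc1 : c ≤ 1 := cc_le_one _ hω
  have hc21 : c^2 ≤ 1 := by nlinarith
  have hj := jap_pos vs
  have hj1 := one_le_jap vs
  have h0 : ρ^2 * (1 - c^2) ≤ x^2 := by
    have := pow_le_pow_left₀ (by positivity) hs 2
    rwa [mul_pow, sq_sqrt (by linarith)] at this
  have h1 : ρ^2 * ((c^2)⁻¹ - 1) ≤ 2 * x^2 := by
    have e : ρ^2 * ((c^2)⁻¹ - 1) = ρ^2 * (1-c^2) / c^2 := by field_simp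
    rw [e, div_le_iff₀ (by positivity)]
    nlinarith [sq_nonneg x]
  have hs2 : √2 * √2 = 2 := mul_self_sqrt (by norm_num)
  have hsq : (√2 * x)^2 = 2 * x^2 := by rw [mul_pow, sq_sqrt (by norm_num)]
  have hle2 : √2 ≤ 2 := by nlinarith [sqrt_nonneg 2, sq_nonneg (√2 - 1)]
  have hξ : √2 * x ≤ 1 := by nlinarith
  have eR : √2 * (√2 * x) * jap vs = 2 * x * jap vs := by rw [← mul_assoc, hs2]
  have n1 := norm_vp_v (vs := vs) (v := v) hω hz
  have n2 := norm_vsh_v (vs := vs) (v := v) hω hz hc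
  have n3 := norm_vp_vs (vs := vs) (v := v) hω hz
  have n4 := norm_vsh_vs (vs := vs) (v := v) hω
  have n5 := norm_vsh_vp (vs := vs) (v := v) hω hz
  rw [← hcd, ← hρ] at n1 n2 n3 n4 n5
  have e4 : (ρ/c)^2 = ρ^2 * (c^2)⁻¹ := by rw [div_pow]; rfl
  refine ⟨?_, ?_, ?_⟩
  · rw [← eR]
    refine aniso_near (by positivity) hξ ?_ ?_
    · rw [n1, hsq]; nlinarith [sq_nonneg x]
    · rw [n3, hsq, abs_le, ← hρ]
      have h01 : 0 ≤ ρ^2 * (1-c^2) := mul_nonneg (by positivity) (by linarith)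
      have h02 : (ρ*c)^2 - ρ^2 = -(ρ^2*(1-c^2)) := by ring
      have h03 := sq_nonneg x
      rw [h02]
      constructor <;> linarith
  · rw [← eR]
    refine aniso_near (by positivity) hξ ?_ ?_
    · rw [n2, hsq]; exact h1
    · rw [n4, hsq, abs_le, ← hρ, e4]
      have : 0 ≤ ρ^2 * ((c^2)⁻¹ - 1) := by
        have := (one_le_inv₀ (show 0 < c^2 by positivity)).2 hc21
        apply mul_nonneg (by positivity) (by linarith)
      have h02 : ρ^2 * (c^2)⁻¹ - ρ^2 = (ρ^2 * ((c^2)⁻¹ - 1)) := by ring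
      have h03 := sq_nonneg x
      rw [h02]
      constructor <;> linarith
  · have hci : c⁻¹ ≤ 2 := by rw [inv_le_comm₀ hc (by norm_num)]; nlinarith
    have hρi : (1/ρ) * ρ = 1 := by field_simp
    set r := 1/ρ with hr
    have hr0 : 0 < r := by positivity
    have m1 : ‖vsh vs v ω - vp vs v ω‖ ≤ 2 * x^2 * r := by
      rw [n5]
      have e : ρ * (c⁻¹ - c) = r * c⁻¹ * (ρ^2 * (1-c^2)) := by
        rw [hr]; field_simp
      have : 0 ≤ ρ^2 * (1-c^2) := mul_nonneg (by positivity) (by linarith)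
      rw [e, abs_of_nonneg (by positivity)]
      calc r * c⁻¹ * (ρ^2 * (1-c^2)) ≤ r * 2 * x^2 := by gcongr
        _ = _ := by ring
    have m2 := sq_diff (vs := vs) (vp vs v ω) (vsh vs v ω)
    rw [n3, n4, e4] at m2
    have m3 : |⟪vsh vs v ω - vp vs v ω, vs⟫| ≤ 2 * x^2 * r * jap vs := by
      refine (abs_real_inner_le_norm _ _).trans ?_
      gcongr
      unfold jap; exact le_sqrt_of_sq_le (by linarith)
    have m4 : |‖vsh vs v ω‖^2 - ‖vp vs v ω‖^2| ≤ 3 * x^2 + 2 * (2 * x^2 * r * jap vs) := by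
      rw [m2]
      refine (abs_add_le _ _).trans (add_le_add ?_ ?_)
      · have h01 : 0 ≤ ρ^2 * (1-c^2) := mul_nonneg (by positivity) (by linarith)
        have h02 : 0 ≤ ρ^2 * ((c^2)⁻¹ - 1) := by
          have := (one_le_inv₀ (show 0 < c^2 by positivity)).2 hc21
          apply mul_nonneg (by positivity) (by linarith)
        have h03 : ρ^2 * (c^2)⁻¹ - (ρ*c)^2 = ρ^2 * ((c^2)⁻¹ - 1) + ρ^2*(1-c^2) := by ring
        rw [h03, abs_of_nonneg (by linarith)]; linarith
      · rw [abs_mul, abs_two]; gcongr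
    have m5 : anisoDist (vsh vs v ω) (vp vs v ω) ≤ ‖vsh vs v ω - vp vs v ω‖ + |‖vsh vs v ω‖^2 - ‖vp vs v ω‖^2|/2 := by
      refine sqrt_le_iff.2 ⟨by positivity, ?_⟩
      rw [← sq_abs (‖vsh vs v ω‖^2 - ‖vp vs v ω‖^2)]
      nlinarith [mul_nonneg (norm_nonneg (vsh vs v ω - vp vs v ω)) (abs_nonneg (‖vsh vs v ω‖^2 - ‖vp vs v ω‖^2))]
    rw [div_le_iff₀ (by positivity)]
    have hx2 : 0 < x^2 := by positivity
    have a1 : x^2 ≤ x^2 * jap vs := le_mul_of_one_le_right hx2.le hj1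
    have a2 : 2 * x^2 * r ≤ 2 * x^2 * r * jap vs := le_mul_of_one_le_right (by positivity) hj1
    nlinarith [mul_pos (mul_pos hx2 hr0) hj]
end geom

theorem transfer {α β δ : Type*} [MeasurableSpace α] [MeasurableSpace β] [MeasurableSpace δ] {μ : Measure α} {ν : Measure β}
    {a : α → ℝ} {b : β → ℝ} {p : α → δ} {q : β → δ} (ha : Measurable a) (hb : Measurable b) (ha0 : ∀ w, 0 ≤ a w) (hb0 : ∀ w, 0 ≤ b w)
    (hp : Measurable p) (hq : Measurable q)
    (H : ∀ G : δ → ℝ≥0∞, Measurable G → ∫⁻ w, ENNReal.ofReal (a w) * G (p w) ∂μ = ∫⁻ w, ENNReal.ofReal (b w) * G (q w) ∂ν)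
    (Φ : δ → ℝ) (hΦ : Measurable Φ) :
    ∫ w, a w * Φ (p w) ∂μ = ∫ w, b w * Φ (q w) ∂ν := by
  have e : Measure.map p (μ.withDensity fun w => ENNReal.ofReal (a w)) = Measure.map q (ν.withDensity fun w => ENNReal.ofReal (b w)) := by
    refine Measure.ext_of_lintegral _ fun G hG => ?_
    rw [lintegral_map hG hp, lintegral_map hG hq, lintegral_withDensity_eq_lintegral_mul _ (by fun_prop) (by fun_prop),
      lintegral_withDensity_eq_lintegral_mul _ (by fun_prop) (by fun_prop)]
    exact H G hG
  have i1 : ∫ x, Φ x ∂(Measure.map p (μ.withDensity fun w => ENNReal.ofReal (a w))) = ∫ w, a w * Φ (p w) ∂μ := by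
    rw [integral_map hp.aemeasurable hΦ.aestronglyMeasurable, integral_withDensity_eq_integral_toReal_smul (by fun_prop) (by simp)]
    congr 1; ext w; rw [ENNReal.toReal_ofReal (ha0 w), smul_eq_mul]
  have i2 : ∫ x, Φ x ∂(Measure.map q (ν.withDensity fun w => ENNReal.ofReal (b w))) = ∫ w, b w * Φ (q w) ∂ν := by
    rw [integral_map hq.aemeasurable hΦ.aestronglyMeasurable, integral_withDensity_eq_integral_toReal_smul (by fun_prop) (by simp)]
    congr 1; ext w; rw [ENNReal.toReal_ofReal (hb0 w), smul_eq_mul]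
  rw [← i1, ← i2, e]

theorem measurable_BB {n : ℕ} {b : ℝ → ℝ} (hb : Measurable b) (CΦ γ : ℝ) (k : ℤ) {α : Type*} [MeasurableSpace α] {ρ c : α → ℝ}
    (hρ : Measurable ρ) (hc : Measurable c) : Measurable (fun a => BB n CΦ γ b k (ρ a) (c a)) := by
  unfold BB
  have h1 : Measurable (fun a => aK n b (c a)) := (measurable_aK hb).comp hc
  have h2 : Measurable (fun a => dy k (ρ a * √(1 - c a^2))) := (measurable_dy k).comp (by fun_prop)
  fun_prop

theorem measurable_BS {n : ℕ} {b : ℝ → ℝ} (hb : Measurable b) (CΦ γ : ℝ) (k : ℤ) {α : Type*} [MeasurableSpace α] {ρ c : α → ℝ}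
    (hρ : Measurable ρ) (hc : Measurable c) : Measurable (fun a => BS n CΦ γ b k (ρ a) (c a)) := by
  unfold BS
  have h1 : Measurable (fun a => aK n b (c a)) := (measurable_aK hb).comp hc
  have h2 : Measurable (fun a => dy k (ρ a * √((c a^2)⁻¹ - 1))) := (measurable_dy k).comp (by fun_prop)
  fun_prop

theorem measurable_cc {n : ℕ} {α : Type*} [MeasurableSpace α] {z ω : α → V n}
    (hz : Measurable z) (hω : Measurable ω) : Measurable (fun a => cc (z a) (ω a)) := by
  unfold cc
  fun_prop

theorem measurable_vp {n : ℕ} {α : Type*} [MeasurableSpace α] {vs v ω : α → V n}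
    (hs : Measurable vs) (hv : Measurable v) (hω : Measurable ω) : Measurable (fun a => vp (vs a) (v a) (ω a)) := by
  unfold vp
  fun_prop

theorem measurable_vsh {n : ℕ} {α : Type*} [MeasurableSpace α] {vs v ω : α → V n}
    (hs : Measurable vs) (hv : Measurable v) (hω : Measurable ω) : Measurable (fun a => vsh (vs a) (v a) (ω a)) := by
  unfold vsh
  have := measurable_cc (hv.sub hs) hω
  simp only [Pi.sub_apply] at this
  fun_prop

theorem BB_of_nonpos {n : ℕ} {b : ℝ → ℝ} (CΦ γ : ℝ) (k : ℤ) (ρ : ℝ) {c : ℝ} (hc : ¬ 0 < c) : BB n CΦ γ b k ρ c = 0 := by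
  simp [BB, aK, hc]
theorem BS_of_nonpos {n : ℕ} {b : ℝ → ℝ} (CΦ γ : ℝ) (k : ℤ) (ρ : ℝ) {c : ℝ} (hc : ¬ 0 < c) : BS n CΦ γ b k ρ c = 0 := by
  simp [BS, aK, hc]

theorem BB_nonneg {n : ℕ} {b : ℝ → ℝ} (hb : ∀ t, 0 ≤ b t) {CΦ γ : ℝ} (hC : 0 < CΦ) (k : ℤ) {ρ : ℝ} (hρ : 0 ≤ ρ) (c : ℝ) : 0 ≤ BB n CΦ γ b k ρ c := by
  unfold BB
  have := aK_nonneg (n := n) hb c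
  have := dy_nonneg k (ρ * √(1 - c^2))
  positivity

theorem BS_nonneg {n : ℕ} {b : ℝ → ℝ} (hb : ∀ t, 0 ≤ b t) {CΦ γ : ℝ} (hC : 0 < CΦ) (k : ℤ) {ρ : ℝ} (hρ : 0 ≤ ρ) (c : ℝ) : 0 ≤ BS n CΦ γ b k ρ c := by
  by_cases hc : 0 < c
  · unfold BS
    have := aK_nonneg (n := n) hb c
    have := dy_nonneg k (ρ * √((c^2)⁻¹ - 1))
    positivity
  · rw [BS_of_nonpos _ _ _ _ hc]

theorem ident1 {n : ℕ} (hn : 2 ≤ n) {b : ℝ → ℝ} (hb : Measurable b) (hb0 : ∀ t, 0 ≤ b t) {CΦ : ℝ} (hC : 0 < CΦ) (γ : ℝ) (k : ℤ)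
    {v vs : V n} (hv : v ≠ vs) (Φ : V n → ℝ≥0∞) (hΦ : Measurable Φ) :
    ∫⁻ σ, ENNReal.ofReal (Bker CΦ γ b v vs σ * dy k ‖vprime v vs σ - v‖) * Φ (vprime v vs σ) ∂sphMeas n =
    ∫⁻ ω, ENNReal.ofReal (BB n CΦ γ b k ‖v - vs‖ (cc (v-vs) ω)) * Φ (vp vs v ω) ∂sphMeas n := by
  have hz : 0 < ‖v - vs‖ := norm_pos_iff.2 (sub_ne_zero.2 hv)
  set e : V n := ‖v - vs‖⁻¹ • (v - vs) with he
  have he1 : ‖e‖ = 1 := by rw [he, norm_smul, norm_inv, norm_norm]; field_simp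
  have hM1 : Measurable (fun σ : V n => vprime v vs σ) := by unfold vprime; fun_prop
  have hM2 : Measurable (fun σ : V n => Bker CΦ γ b v vs σ) := by unfold Bker; fun_prop
  have hM3 : Measurable (fun σ : V n => dy k ‖vprime v vs σ - v‖) := (measurable_dy k).comp (by fun_prop)
  have := sigma_omega hn e he1 (fun σ => ENNReal.ofReal (Bker CΦ γ b v vs σ * dy k ‖vprime v vs σ - v‖) * Φ (vprime v vs σ)) (by fun_prop)
  rw [this]
  refine lintegral_congr fun ω => ?_
  have hω : ‖(ω : V n)‖ = 1 := by simp
  have hc : ⟪e, (ω : V n)⟫ = cc (v-vs) ω := by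
    rw [he, inner_smul_left, cc]; simp; field_simp
  rw [hc]
  split_ifs with h
  · have e1 : vprime v vs ((2 * cc (v-vs) ω) • (ω : V n) - e) = vp vs v ω := by
      rw [vprime, vp, inner_cc hz, he]
      have h2 : (‖v - vs‖ / 2) • (‖v - vs‖⁻¹ • (v - vs)) = (2:ℝ)⁻¹ • (v - vs) := by
        rw [smul_smul]; congr 1; field_simp
      rw [smul_sub, h2]
      module
    have e2 : ⟪e, (2 * cc (v-vs) ω) • (ω : V n) - e⟫ = 2 * cc (v-vs) ω ^2 - 1 := by
      rw [inner_sub_right, inner_smul_right, hc, real_inner_self_eq_norm_sq, he1]; ring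
    have e3 : ‖vp vs v ω - v‖ = ‖v - vs‖ * √(1 - cc (v-vs) ω^2) := by
      have := norm_vp_v (vs := vs) (v := v) hω hz
      have h1 : ‖vp vs v ω - v‖ = √(‖vp vs v ω - v‖^2) := (sqrt_sq (norm_nonneg _)).symm
      rw [h1, this, sqrt_mul (by positivity), sqrt_sq hz.le]
    rw [e1, ← mul_assoc, ← ENNReal.ofReal_mul (by positivity), e3, Bker, ← he, e2, BB, aK, if_pos h]
    congr 2; ring
  · rw [BB_of_nonpos _ _ _ _ h]; simp

theorem ident2 {n : ℕ} (hn : 2 ≤ n) {b : ℝ → ℝ} (hb : Measurable b) (hb0 : ∀ t, 0 ≤ b t) {CΦ : ℝ} (hC : 0 < CΦ) (γ : ℝ) (k : ℤ)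
    (vs : V n) (G : V n → V n → ℝ≥0∞) (hG : Measurable (Function.uncurry G)) :
    ∫⁻ v, ∫⁻ ω, ENNReal.ofReal (BB n CΦ γ b k ‖v - vs‖ (cc (v-vs) ω)) * G v (vp vs v ω) ∂sphMeas n =
    ∫⁻ v, ∫⁻ ω, ENNReal.ofReal (BS n CΦ γ b k ‖v - vs‖ (cc (v-vs) ω)) * G (vsh vs v ω) v ∂sphMeas n := by
  have := swap_lintegral (n := n) (by omega)
    (fun z y => ENNReal.ofReal (BB n CΦ γ b k ‖z‖ (‖y‖ / ‖z‖)) * G (z + vs) (vs + y)) (by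
      have h1 : Measurable (fun a : V n × V n => BB n CΦ γ b k ‖a.1‖ (‖a.2‖ / ‖a.1‖)) := measurable_BB hb _ _ _ (by fun_prop) (by fun_prop)
      have h2 : Measurable (fun a : V n × V n => G (a.1 + vs) (vs + a.2)) :=
        hG.comp (f := fun a : V n × V n => (a.1 + vs, vs + a.2)) (by fun_prop)
      exact h1.ennreal_ofReal.mul h2)
  rw [← lintegral_sub_right_eq_self _ vs, ← lintegral_sub_right_eq_self (fun z => ∫⁻ ω, (if 0 < ⟪z,(ω : V n)⟫ then ENNReal.ofReal (((⟪z,(ω : V n)⟫/‖z‖)^n)⁻¹) * _ else 0) ∂sphMeas n) vs] at this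
  convert this using 1
  · refine lintegral_congr fun v => lintegral_congr fun ω => ?_
    have hω : ‖(ω : V n)‖ = 1 := by simp
    split_ifs with h
    · have hz : 0 < ‖v - vs‖ := by
        rw [norm_pos_iff]; intro h0; rw [h0] at h; simp at h
      rw [norm_smul, hω, mul_one, Real.norm_eq_abs, abs_of_pos h]
      congr 2
      · simp
    · rw [BB_of_nonpos, ENNReal.ofReal_zero, zero_mul]
      unfold cc
      intro h'
      apply h
      by_contra h2
      exact absurd h' (not_lt.2 (div_nonpos_of_nonpos_of_nonneg (not_lt.1 h2) (norm_nonneg _)))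
  · refine lintegral_congr fun v => lintegral_congr fun ω => ?_
    have hω : ‖(ω : V n)‖ = 1 := by simp
    split_ifs with h
    · have hz : 0 < ‖v - vs‖ := by
        rw [norm_pos_iff]; intro h0; rw [h0] at h; simp at h
      have hc : 0 < cc (v - vs) ω := div_pos h hz
      change _ = ENNReal.ofReal ((cc (v-vs) ω ^ n)⁻¹) * (ENNReal.ofReal (BB n CΦ γ b k ‖(‖v-vs‖ / cc (v-vs) ω) • (ω : V n)‖ (‖v - vs‖ / ‖(‖v-vs‖ / cc (v-vs) ω) • (ω : V n)‖)) *
        G ((‖v-vs‖ / cc (v-vs) ω) • (ω : V n) + vs) (vs + (v - vs)))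
      have e1 : ‖(‖v-vs‖ / cc (v-vs) ω) • (ω : V n)‖ = ‖v - vs‖ / cc (v-vs) ω := by
        rw [norm_smul, hω, mul_one, Real.norm_eq_abs, abs_of_pos (by positivity)]
      have hc1 := cc_le_one (v - vs) hω
      rw [e1, add_comm _ vs, ← mul_assoc, ← ENNReal.ofReal_mul (by positivity), add_sub_cancel]
      rw [show vs + (‖v-vs‖ / cc (v-vs) ω) • (ω : V n) = vsh vs v ω from rfl]
      clear this
      generalize cc (v-vs) ω = c at *
      congr 2
      have e2 : ‖v - vs‖ / (‖v - vs‖ / c) = c := by field_simp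
      have e3 : (‖v - vs‖ / c) * √(1-c^2) = ‖v - vs‖ * √((c^2)⁻¹ - 1) := by
        have : (c^2)⁻¹ - 1 = (1 - c^2) / c^2 := by field_simp
        rw [this, sqrt_div' _ (by positivity), sqrt_sq hc.le]; ring
      rw [e2, BB, BS, e3, div_rpow hz.le hc.le, neg_add, rpow_add hc, rpow_neg hc.le, rpow_neg hc.le, rpow_natCast]
      ring
    · rw [BS_of_nonpos, ENNReal.ofReal_zero, zero_mul]
      unfold cc
      intro h'
      apply h
      by_contra h2
      exact absurd h' (not_lt.2 (div_nonpos_of_nonpos_of_nonneg (not_lt.1 h2) (norm_nonneg _)))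

/-- the kernel in the `ω` variables -/
def bbf (n : ℕ) (CΦ γ : ℝ) (b : ℝ → ℝ) (k : ℤ) (vs : V n) (p : V n × Metric.sphere (0 : V n) 1) : ℝ :=
  BB n CΦ γ b k ‖p.1 - vs‖ (cc (p.1 - vs) p.2)

/-- the swapped kernel in the `ω` variables -/
def bsf (n : ℕ) (CΦ γ : ℝ) (b : ℝ → ℝ) (k : ℤ) (vs : V n) (p : V n × Metric.sphere (0 : V n) 1) : ℝ :=
  BS n CΦ γ b k ‖p.1 - vs‖ (cc (p.1 - vs) p.2)

/-- the product measure -/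
abbrev lam (n : ℕ) : Measure (V n × Metric.sphere (0 : V n) 1) := (volume : Measure (V n)).prod (sphMeas n)

theorem bbf_meas {n : ℕ} {b : ℝ → ℝ} (hb : Measurable b) (CΦ γ : ℝ) (k : ℤ) (vs : V n) : Measurable (bbf n CΦ γ b k vs) :=
  measurable_BB hb _ _ _ (by fun_prop) (measurable_cc (by fun_prop) (by fun_prop))
theorem bsf_meas {n : ℕ} {b : ℝ → ℝ} (hb : Measurable b) (CΦ γ : ℝ) (k : ℤ) (vs : V n) : Measurable (bsf n CΦ γ b k vs) :=
  measurable_BS hb _ _ _ (by fun_prop) (measurable_cc (by fun_prop) (by fun_prop))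
theorem bbf_nonneg {n : ℕ} {b : ℝ → ℝ} (hb : ∀ t, 0 ≤ b t) {CΦ : ℝ} (hC : 0 < CΦ) (γ : ℝ) (k : ℤ) (vs : V n) (p) : 0 ≤ bbf n CΦ γ b k vs p :=
  BB_nonneg hb hC _ (norm_nonneg _) _
theorem bsf_nonneg {n : ℕ} {b : ℝ → ℝ} (hb : ∀ t, 0 ≤ b t) {CΦ : ℝ} (hC : 0 < CΦ) (γ : ℝ) (k : ℤ) (vs : V n) (p) : 0 ≤ bsf n CΦ γ b k vs p :=
  BS_nonneg hb hC _ (norm_nonneg _) _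

instance sph_sfin {n : ℕ} : SFinite (sphMeas n) := by have := sph_fin n; infer_instance

theorem ae_ne {n : ℕ} (hn : 2 ≤ n) (vs : V n) : ∀ᵐ v : V n, v ≠ vs := by
  have : Nonempty (Fin n) := ⟨⟨0, by omega⟩⟩
  exact (measure_singleton vs : volume {vs} = 0) |> fun h => by
    rw [ae_iff]; convert h using 2; ext; simp

theorem kint {n : ℕ} (hn : 2 ≤ n) {s γ CΦ cb : ℝ} (hs : s ∈ Set.Ioo (0:ℝ) 1) (hγ : -(n:ℝ) < γ) (hCΦ : 0 < CΦ) (hcb : 0 < cb) :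
    ∃ C : ℝ, 0 < C ∧ ∀ b : ℝ → ℝ, KernelAssumptions n s cb b → ∀ vs : V n, ∀ k : ℤ, ∀ φ : V n → ℝ≥0∞, Measurable φ →
      (∫⁻ p, ENNReal.ofReal (bbf n CΦ γ b k vs p) * φ p.1 ∂lam n ≤
        ENNReal.ofReal C * ∫⁻ v, ENNReal.ofReal (((2:ℝ)^(-k))^(-(2*s)) * ‖v - vs‖^(γ+2*s)) * φ v) ∧
      (∫⁻ p, ENNReal.ofReal (bsf n CΦ γ b k vs p) * φ p.1 ∂lam n ≤
        ENNReal.ofReal C * ∫⁻ v, ENNReal.ofReal (((2:ℝ)^(-k))^(-(2*s)) * ‖v - vs‖^(γ+2*s)) * φ v) := by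
  obtain ⟨C, hC, H⟩ := K12 hn hs hγ hCΦ hcb
  refine ⟨C, hC, fun b hb vs k φ hφ => ?_⟩
  have key : ∀ (β : V n × Metric.sphere (0 : V n) 1 → ℝ), Measurable β →
      (∀ v : V n, v ≠ vs → ∫⁻ ω, ENNReal.ofReal (β (v, ω)) ∂sphMeas n ≤ ENNReal.ofReal (C*(‖v - vs‖^(γ+2*s)*((2:ℝ)^(-k))^(-(2*s))))) →
      ∫⁻ p, ENNReal.ofReal (β p) * φ p.1 ∂lam n ≤
        ENNReal.ofReal C * ∫⁻ v, ENNReal.ofReal (((2:ℝ)^(-k))^(-(2*s)) * ‖v - vs‖^(γ+2*s)) * φ v := by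
    intro β hβ hb
    rw [lintegral_prod _ (by fun_prop), ← lintegral_const_mul _ (by fun_prop)]
    refine lintegral_mono_ae ?_
    filter_upwards [ae_ne hn vs] with v hv
    rw [lintegral_mul_const _ (by fun_prop), ← mul_assoc, ← ENNReal.ofReal_mul hC.le]
    gcongr
    refine (hb v hv).trans (le_of_eq ?_)
    congr 1; ring
  have hcc : ∀ v : V n, v ≠ vs → ‖‖v - vs‖⁻¹ • (v - vs)‖ = 1 ∧ ∀ ω : V n, ⟪‖v - vs‖⁻¹ • (v - vs), ω⟫ = cc (v - vs) ω := by
    intro v hv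
    have hz : 0 < ‖v - vs‖ := norm_pos_iff.2 (sub_ne_zero.2 hv)
    refine ⟨by rw [norm_smul, norm_inv, norm_norm]; field_simp, fun ω => ?_⟩
    rw [inner_smul_left, cc]; simp; field_simp
  constructor
  · refine key _ (bbf_meas hb.1 _ _ _ _) fun v hv => ?_
    have := (H b hb _ (hcc v hv).1 ‖v - vs‖ (norm_pos_iff.2 (sub_ne_zero.2 hv)) k).1
    simp only [(hcc v hv).2] at this
    exact this
  · refine key _ (bsf_meas hb.1 _ _ _ _) fun v hv => ?_
    have := (H b hb _ (hcc v hv).1 ‖v - vs‖ (norm_pos_iff.2 (sub_ne_zero.2 hv)) k).2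
    simp only [(hcc v hv).2] at this
    exact this

theorem kdiff {n : ℕ} (hn : 2 ≤ n) {s γ CΦ cb : ℝ} (hs : s ∈ Set.Ioo (0:ℝ) 1) (hγ : -(n:ℝ) < γ) (hCΦ : 0 < CΦ) (hcb : 0 < cb) :
    ∃ C : ℝ, 0 < C ∧ ∀ b : ℝ → ℝ, KernelAssumptions n s cb b → ∀ vs : V n, ∀ φ : V n → ℝ≥0∞, Measurable φ →
      ∑' k : ℤ, ∫⁻ p, ENNReal.ofReal |bsf n CΦ γ b k vs p - bbf n CΦ γ b k vs p| * φ p.1 ∂lam n ≤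
        ENNReal.ofReal C * ∫⁻ v, ENNReal.ofReal (‖v - vs‖^γ) * φ v := by
  obtain ⟨C, hC, H⟩ := K3 hn hs hγ hCΦ hcb
  refine ⟨C, hC, fun b hb vs φ hφ => ?_⟩
  have hm : ∀ k, Measurable (fun p => |bsf n CΦ γ b k vs p - bbf n CΦ γ b k vs p|) := fun k =>
    ((bsf_meas hb.1 _ _ _ _).sub (bbf_meas hb.1 _ _ _ _)).norm
  have e : ∀ k, ∫⁻ p, ENNReal.ofReal |bsf n CΦ γ b k vs p - bbf n CΦ γ b k vs p| * φ p.1 ∂lam n =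
      ∫⁻ v, (∫⁻ ω, ENNReal.ofReal |bsf n CΦ γ b k vs (v, ω) - bbf n CΦ γ b k vs (v, ω)| ∂sphMeas n) * φ v := by
    intro k
    have := hm k
    rw [lintegral_prod _ (by fun_prop)]
    refine lintegral_congr fun v => ?_
    dsimp only
    have h5 := bbf_meas hb.1 CΦ γ k vs
    have h6 := bsf_meas hb.1 CΦ γ k vs
    have h7 : Measurable (fun y => |bsf n CΦ γ b k vs (v, y) - bbf n CΦ γ b k vs (v, y)|) := (hm k).comp (by fun_prop)
    rw [lintegral_mul_const _ h7.ennreal_ofReal]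
  simp only [e]
  rw [← lintegral_tsum (fun k => by have := hm k; fun_prop), ← lintegral_const_mul _ (by fun_prop)]
  refine lintegral_mono_ae ?_
  filter_upwards [ae_ne hn vs] with v hv
  have hz : 0 < ‖v - vs‖ := norm_pos_iff.2 (sub_ne_zero.2 hv)
  rw [ENNReal.tsum_mul_right, ← mul_assoc, ← ENNReal.ofReal_mul hC.le]
  gcongr
  have := H b hb (‖v - vs‖⁻¹ • (v - vs)) (by rw [norm_smul, norm_inv, norm_norm]; field_simp) ‖v - vs‖ hz
  have h2 : ∀ ω : V n, ⟪‖v - vs‖⁻¹ • (v - vs), ω⟫ = cc (v - vs) ω := by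
    intro ω; rw [inner_smul_left, cc]; simp; field_simp
  simp only [h2] at this
  exact this

theorem kswap {n : ℕ} (hn : 2 ≤ n) {b : ℝ → ℝ} (hb : Measurable b) (hb0 : ∀ t, 0 ≤ b t) {CΦ : ℝ} (hC : 0 < CΦ) (γ : ℝ) (k : ℤ)
    (vs : V n) (G : V n × V n → ℝ≥0∞) (hG : Measurable G) :
    ∫⁻ p, ENNReal.ofReal (bbf n CΦ γ b k vs p) * G (p.1, vp vs p.1 p.2) ∂lam n =
    ∫⁻ p, ENNReal.ofReal (bsf n CΦ γ b k vs p) * G (vsh vs p.1 p.2, p.1) ∂lam n := by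
  have h1 := bbf_meas hb CΦ γ k vs
  have h2 := bsf_meas hb CΦ γ k vs
  have h3 : Measurable (fun p : V n × Metric.sphere (0 : V n) 1 => vp vs p.1 p.2) := measurable_vp (by fun_prop) (by fun_prop) (by fun_prop)
  have h4 : Measurable (fun p : V n × Metric.sphere (0 : V n) 1 => vsh vs p.1 p.2) := measurable_vsh (by fun_prop) (by fun_prop) (by fun_prop)
  rw [lintegral_prod _ (by fun_prop), lintegral_prod _ (by fun_prop)]
  exact ident2 hn hb hb0 hC γ k vs (fun a b => G (a, b)) hG

theorem kswapR {n : ℕ} (hn : 2 ≤ n) {b : ℝ → ℝ} (hb : Measurable b) (hb0 : ∀ t, 0 ≤ b t) {CΦ : ℝ} (hC : 0 < CΦ) (γ : ℝ) (k : ℤ)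
    (vs : V n) (G : V n × V n → ℝ) (hG : Measurable G) :
    ∫ p, (bbf n CΦ γ b k vs p) * G (p.1, vp vs p.1 p.2) ∂lam n =
    ∫ p, (bsf n CΦ γ b k vs p) * G (vsh vs p.1 p.2, p.1) ∂lam n := by
  have h3 : Measurable (fun p : V n × Metric.sphere (0 : V n) 1 => vp vs p.1 p.2) := measurable_vp (by fun_prop) (by fun_prop) (by fun_prop)
  have h4 : Measurable (fun p : V n × Metric.sphere (0 : V n) 1 => vsh vs p.1 p.2) := measurable_vsh (by fun_prop) (by fun_prop) (by fun_prop)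
  exact transfer (bbf_meas hb CΦ γ k vs) (bsf_meas hb CΦ γ k vs) (bbf_nonneg hb0 hC γ k vs) (bsf_nonneg hb0 hC γ k vs)
    (measurable_fst.prodMk h3) (h4.prodMk measurable_fst) (fun G hG => kswap hn hb hb0 hC γ k vs G hG) G hG

theorem bb_supp {n : ℕ} {s cb CΦ γ : ℝ} {b : ℝ → ℝ} (hb : KernelAssumptions n s cb b) {k : ℤ} {vs : V n} {p : V n × Metric.sphere (0 : V n) 1}
    (h : bbf n CΦ γ b k vs p ≠ 0) : 0 < ‖p.1 - vs‖ ∧ 0 < cc (p.1 - vs) p.2 ∧ 1/2 ≤ cc (p.1 - vs) p.2 ^2 ∧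
      ‖p.1 - vs‖ * √(1 - cc (p.1 - vs) p.2 ^2) ≤ 2^(-k) ∧ (2:ℝ)^(-k) ≤ 2 * ‖p.1 - vs‖ := by
  have hω : ‖(p.2 : V n)‖ = 1 := by simp
  have hc1 := cc_le_one (p.1 - vs) hω
  unfold bbf BB at h
  have h1 : aK n b (cc (p.1 - vs) p.2) ≠ 0 := fun h0 => h (by rw [h0]; ring)
  have h2 : dy k (‖p.1 - vs‖ * √(1 - cc (p.1 - vs) p.2 ^2)) ≠ 0 := fun h0 => h (by rw [h0]; ring)
  obtain ⟨h3, h4⟩ := aK_zero hb hc1 h1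
  obtain ⟨h5, h6⟩ := dy_ne h2
  have hx : (0:ℝ) < 2^(-k) := by positivity
  have h7 : √(1 - cc (p.1 - vs) p.2 ^2) ≤ 1 := sqrt_le_one.2 (by nlinarith)
  have h8 : ‖p.1 - vs‖ * √(1 - cc (p.1 - vs) p.2 ^2) ≤ ‖p.1 - vs‖ := mul_le_of_le_one_right (norm_nonneg _) h7
  exact ⟨by linarith, h3, h4, h6, by linarith⟩

theorem bs_supp {n : ℕ} {s cb CΦ γ : ℝ} {b : ℝ → ℝ} (hb : KernelAssumptions n s cb b) {k : ℤ} {vs : V n} {p : V n × Metric.sphere (0 : V n) 1}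
    (h : bsf n CΦ γ b k vs p ≠ 0) : 0 < ‖p.1 - vs‖ ∧ 0 < cc (p.1 - vs) p.2 ∧ 1/2 ≤ cc (p.1 - vs) p.2 ^2 ∧
      ‖p.1 - vs‖ * √(1 - cc (p.1 - vs) p.2 ^2) ≤ 2^(-k) := by
  have hω : ‖(p.2 : V n)‖ = 1 := by simp
  have hc1 := cc_le_one (p.1 - vs) hω
  unfold bsf BS at h
  have h1 : aK n b (cc (p.1 - vs) p.2) ≠ 0 := fun h0 => h (by rw [h0]; ring)
  have h2 : dy k (‖p.1 - vs‖ * √((cc (p.1 - vs) p.2 ^2)⁻¹ - 1)) ≠ 0 := fun h0 => h (by rw [h0]; ring)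
  obtain ⟨h3, h4⟩ := aK_zero hb hc1 h1
  obtain ⟨h5, h6⟩ := dy_ne h2
  have hx : (0:ℝ) < 2^(-k) := by positivity
  have h7 : 0 < ‖p.1 - vs‖ := by
    refine lt_of_le_of_ne (norm_nonneg _) fun h0 => ?_
    rw [← h0, zero_mul] at h5; linarith
  refine ⟨h7, h3, h4, le_trans ?_ h6⟩
  refine mul_le_mul_of_nonneg_left (sqrt_le_sqrt ?_) h7.le
  generalize cc (p.1 - vs) p.2 = c at *
  have hc2 : 0 < c^2 := by positivity
  have hc3 : c^2 ≤ 1 := by nlinarith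
  have : (c^2)⁻¹ - 1 = (1 - c^2) * (c^2)⁻¹ := by field_simp
  rw [this]
  exact le_mul_of_one_le_right (by linarith) ((one_le_inv₀ hc2).2 hc3)

/-- the dyadic piece for fixed `vs` -/
def Tvs (n : ℕ) (CΦ γ : ℝ) (b : ℝ → ℝ) (k : ℤ) (vs : V n) (f h : V n → ℝ) : ℝ :=
  ∫ p, bbf n CΦ γ b k vs p * (f p.1 * (h (vp vs p.1 p.2) - h p.1)) ∂lam n

/-- weighted `L¹` finiteness -/
def fin1 {n : ℕ} (s γ : ℝ) (vs : V n) (φ : V n → ℝ) : Prop :=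
  ∫⁻ v, ENNReal.ofReal (‖v - vs‖^(γ+2*s)) * ENNReal.ofReal |φ v| ≠ ⊤

theorem int_both {n : ℕ} (hn : 2 ≤ n) {s γ CΦ cb : ℝ} (hs : s ∈ Set.Ioo (0:ℝ) 1) (hγ : -(n:ℝ) < γ) (hCΦ : 0 < CΦ) (hcb : 0 < cb)
  {b : ℝ → ℝ} (hb : KernelAssumptions n s cb b) (k : ℤ) {vs : V n} {φ : V n → ℝ} (hφ : Measurable φ) (hfin : fin1 s γ vs φ)
  {M : ℝ} {Φ : V n × Metric.sphere (0 : V n) 1 → ℝ} (hΦ : Measurable Φ) (hM : ∀ p, |Φ p| ≤ M * |φ p.1|) :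
    Integrable (fun p => bbf n CΦ γ b k vs p * Φ p) (lam n) ∧ Integrable (fun p => bsf n CΦ γ b k vs p * Φ p) (lam n) := by
  obtain ⟨C, hC, H⟩ := kint hn hs hγ hCΦ hcb
  have h1 := H b hb vs k (fun v => ENNReal.ofReal |φ v|) (hφ.norm.ennreal_ofReal)
  have hx : (0:ℝ) ≤ ((2:ℝ)^(-k))^(-(2*s)) := by positivity
  have hlt : ENNReal.ofReal C * ∫⁻ v, ENNReal.ofReal (((2:ℝ)^(-k))^(-(2*s)) * ‖v - vs‖^(γ+2*s)) * ENNReal.ofReal |φ v| < ⊤ := by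
    simp only [ENNReal.ofReal_mul hx, mul_assoc]
    rw [lintegral_const_mul' _ _ ENNReal.ofReal_ne_top]
    exact ENNReal.mul_lt_top ENNReal.ofReal_lt_top (ENNReal.mul_lt_top ENNReal.ofReal_lt_top (lt_top_iff_ne_top.2 hfin))
  have key : ∀ β : V n × Metric.sphere (0 : V n) 1 → ℝ, Measurable β → (∀ p, 0 ≤ β p) →
      (∫⁻ p, ENNReal.ofReal (β p) * ENNReal.ofReal |φ p.1| ∂lam n) < ⊤ → Integrable (fun p => β p * Φ p) (lam n) := by
    intro β hβ hβ0 hf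
    have i1 : Integrable (fun p => M * (β p * |φ p.1|)) (lam n) := by
      refine Integrable.const_mul ?_ M
      refine ⟨(by fun_prop : Measurable _).aestronglyMeasurable, ?_⟩
      rw [hasFiniteIntegral_iff_ofReal (Filter.Eventually.of_forall fun p => mul_nonneg (hβ0 p) (abs_nonneg _))]
      simpa only [ENNReal.ofReal_mul (hβ0 _)] using hf
    refine i1.mono' (hβ.mul hΦ).aestronglyMeasurable (Filter.Eventually.of_forall fun p => ?_)
    rw [Real.norm_eq_abs, abs_mul, abs_of_nonneg (hβ0 p)]
    have := mul_le_mul_of_nonneg_left (hM p) (hβ0 p)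
    linarith
  exact ⟨key _ (bbf_meas hb.1 _ _ _ _) (bbf_nonneg hb.2.1 hCΦ _ _ _) (h1.1.trans_lt hlt),
    key _ (bsf_meas hb.1 _ _ _ _) (bsf_nonneg hb.2.1 hCΦ _ _ _) (h1.2.trans_lt hlt)⟩

theorem int_prime {n : ℕ} (hn : 2 ≤ n) {s γ CΦ cb : ℝ} (hs : s ∈ Set.Ioo (0:ℝ) 1) (hγ : -(n:ℝ) < γ) (hCΦ : 0 < CΦ) (hcb : 0 < cb)
  {b : ℝ → ℝ} (hb : KernelAssumptions n s cb b) (k : ℤ) {vs : V n} {φ : V n → ℝ} (hφ : Measurable φ) (hfin : fin1 s γ vs φ)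
  {M : ℝ} {G : V n × V n → ℝ} (hG : Measurable G) (hM : ∀ p, |G p| ≤ M * |φ p.2|) :
    Integrable (fun p => bbf n CΦ γ b k vs p * G (p.1, vp vs p.1 p.2)) (lam n) := by
  have h3 : Measurable (fun p : V n × Metric.sphere (0 : V n) 1 => vp vs p.1 p.2) := measurable_vp (by fun_prop) (by fun_prop) (by fun_prop)
  have h4 : Measurable (fun p : V n × Metric.sphere (0 : V n) 1 => vsh vs p.1 p.2) := measurable_vsh (by fun_prop) (by fun_prop) (by fun_prop)
  have h := (int_both hn hs hγ hCΦ hcb hb k hφ hfin (Φ := fun p => G (vsh vs p.1 p.2, p.1)) (by fun_prop) (fun p => hM _)).2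
  have hmm := bbf_meas hb.1 CΦ γ k vs
  refine ⟨(by fun_prop : Measurable _).aestronglyMeasurable, ?_⟩
  have h5 := h.2
  unfold HasFiniteIntegral at h5 ⊢
  have e1 := kswap hn hb.1 hb.2.1 hCΦ γ k vs (fun q => ‖G q‖ₑ) (by fun_prop)
  have e2 : ∀ β : ℝ, 0 ≤ β → ∀ t : ℝ, ‖β * t‖ₑ = ENNReal.ofReal β * ‖t‖ₑ := by
    intro β hβ t
    rw [enorm_mul, Real.enorm_of_nonneg hβ]
  simp only [e2 _ (bsf_nonneg hb.2.1 hCΦ _ _ _ _)] at h5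
  simp only [e2 _ (bbf_nonneg hb.2.1 hCΦ _ _ _ _)]
  rw [e1]; exact h5

theorem decomp {n : ℕ} (hn : 2 ≤ n) {s γ CΦ cb : ℝ} (hs : s ∈ Set.Ioo (0:ℝ) 1) (hγ : -(n:ℝ) < γ) (hCΦ : 0 < CΦ) (hcb : 0 < cb)
    {b : ℝ → ℝ} (hb : KernelAssumptions n s cb b) (k : ℤ) {vs : V n} {f h F : V n → ℝ} {M : ℝ}
    (hf : Measurable f) (hh : Measurable h) (hF : Measurable F) (hhM : ∀ v, |h v| ≤ M) (hFM : ∀ v, |F v| ≤ M)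
    (hff : fin1 s γ vs f) (hfh : fin1 s γ vs h) :
    ‖Tvs n CΦ γ b k vs f h‖ₑ ≤
      (∫⁻ p, ENNReal.ofReal (bbf n CΦ γ b k vs p * (|f p.1 - (F p.1 + F (vp vs p.1 p.2))/2| * |h (vp vs p.1 p.2) - h p.1|)) ∂lam n) +
      (∫⁻ p, ENNReal.ofReal (|bsf n CΦ γ b k vs p - bbf n CΦ γ b k vs p| * (|h p.1| * |F (vsh vs p.1 p.2) + F p.1|)) ∂lam n) +
      (∫⁻ p, ENNReal.ofReal (bbf n CΦ γ b k vs p * (|h p.1| * |F (vsh vs p.1 p.2) - F (vp vs p.1 p.2)|)) ∂lam n) := by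
  have h3 : Measurable (fun p : V n × Metric.sphere (0 : V n) 1 => vp vs p.1 p.2) := measurable_vp (by fun_prop) (by fun_prop) (by fun_prop)
  have h4 : Measurable (fun p : V n × Metric.sphere (0 : V n) 1 => vsh vs p.1 p.2) := measurable_vsh (by fun_prop) (by fun_prop) (by fun_prop)
  have m1 := bbf_meas hb.1 CΦ γ k vs
  have m2 := bsf_meas hb.1 CΦ γ k vs
  have p1 := bbf_nonneg hb.2.1 hCΦ γ k vs
  have p2 := bsf_nonneg hb.2.1 hCΦ γ k vs
  have hM0 : 0 ≤ M := (abs_nonneg _).trans (hhM 0)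
  have iA : Integrable (fun p => bbf n CΦ γ b k vs p * (f p.1 * (h (vp vs p.1 p.2) - h p.1))) (lam n) := by
    refine (int_both hn hs hγ hCΦ hcb hb k hf hff (M := 2*M) (by fun_prop) fun p => ?_).1
    rw [abs_mul, mul_comm]
    gcongr
    refine (abs_sub _ _).trans ?_
    linarith [hhM (vp vs p.1 p.2), hhM p.1]
  have hFF : ∀ a c, |F a + F c| ≤ 2 * M := fun a c => (abs_add_le _ _).trans (by linarith [hFM a, hFM c])
  have iB : Integrable (fun p => bbf n CΦ γ b k vs p * ((F p.1 + F (vp vs p.1 p.2)) * h (vp vs p.1 p.2))) (lam n) := by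
    refine int_prime hn hs hγ hCΦ hcb hb k hh hfh (M := 2*M) (G := fun q => (F q.1 + F q.2) * h q.2) (by fun_prop) fun p => ?_
    rw [abs_mul]
    gcongr
    exact hFF _ _
  have iC : Integrable (fun p => bbf n CΦ γ b k vs p * ((F p.1 + F (vp vs p.1 p.2)) * h p.1)) (lam n) := by
    refine (int_both hn hs hγ hCΦ hcb hb k hh hfh (M := 2*M) (by fun_prop) fun p => ?_).1
    rw [abs_mul]
    gcongr
    exact hFF _ _
  have iD : Integrable (fun p => bsf n CΦ γ b k vs p * ((F (vsh vs p.1 p.2) + F p.1) * h p.1)) (lam n) := by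
    refine (int_both hn hs hγ hCΦ hcb hb k hh hfh (M := 2*M) (by fun_prop) fun p => ?_).2
    rw [abs_mul]
    gcongr
    exact hFF _ _
  have eBD := kswapR hn hb.1 hb.2.1 hCΦ γ k vs (fun q => (F q.1 + F q.2) * h q.2) (by fun_prop)
  dsimp only at eBD
  have iBC : Integrable (fun p => (1/2) * (bbf n CΦ γ b k vs p * ((F p.1 + F (vp vs p.1 p.2)) * h (vp vs p.1 p.2)) - bbf n CΦ γ b k vs p * ((F p.1 + F (vp vs p.1 p.2)) * h p.1))) (lam n) := (iB.sub iC).const_mul _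
  have e1 : Tvs n CΦ γ b k vs f h = (∫ p, bbf n CΦ γ b k vs p * ((f p.1 - (F p.1 + F (vp vs p.1 p.2))/2) * (h (vp vs p.1 p.2) - h p.1)) ∂lam n) +
      (1/2) * ∫ p, ((bsf n CΦ γ b k vs p - bbf n CΦ γ b k vs p) * (h p.1 * (F (vsh vs p.1 p.2) + F p.1)) +
        bbf n CΦ γ b k vs p * (h p.1 * (F (vsh vs p.1 p.2) - F (vp vs p.1 p.2)))) ∂lam n := by
    have e2 : (∫ p, ((bsf n CΦ γ b k vs p - bbf n CΦ γ b k vs p) * (h p.1 * (F (vsh vs p.1 p.2) + F p.1)) +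
        bbf n CΦ γ b k vs p * (h p.1 * (F (vsh vs p.1 p.2) - F (vp vs p.1 p.2)))) ∂lam n) =
        (∫ p, bsf n CΦ γ b k vs p * ((F (vsh vs p.1 p.2) + F p.1) * h p.1) ∂lam n) -
        ∫ p, bbf n CΦ γ b k vs p * ((F p.1 + F (vp vs p.1 p.2)) * h p.1) ∂lam n := by
      rw [← integral_sub iD iC]
      congr 1; ext p; ring
    rw [e2, ← eBD, ← integral_sub iB iC, ← integral_const_mul, Tvs, ← integral_add (f := fun p => bbf n CΦ γ b k vs p * ((f p.1 - (F p.1 + F (vp vs p.1 p.2))/2) * (h (vp vs p.1 p.2) - h p.1))) _ iBC]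
    · congr 1; ext p; ring
    · convert iA.sub iBC using 1
      ext p; simp only [Pi.sub_apply]; ring
  rw [e1, add_assoc]
  refine (enorm_add_le _ _).trans (add_le_add ?_ ?_)
  · refine (enorm_integral_le_lintegral_enorm _).trans (lintegral_mono fun p => ?_)
    rw [← ofReal_norm, norm_mul, norm_mul, Real.norm_eq_abs, Real.norm_eq_abs, Real.norm_eq_abs, abs_of_nonneg (p1 p)]
  · rw [enorm_mul]
    have hle : ‖(1/2:ℝ)‖ₑ ≤ 1 := by
      rw [← ofReal_norm]; simp
    refine (mul_le_of_le_one_left zero_le hle).trans ((enorm_integral_le_lintegral_enorm _).trans ?_)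
    rw [← lintegral_add_left (by fun_prop)]
    refine lintegral_mono fun p => (enorm_add_le _ _).trans (add_le_add ?_ ?_)
    · rw [← ofReal_norm, norm_mul, norm_mul, Real.norm_eq_abs, Real.norm_eq_abs, Real.norm_eq_abs]
    · rw [← ofReal_norm, norm_mul, norm_mul, Real.norm_eq_abs, Real.norm_eq_abs, Real.norm_eq_abs, abs_of_nonneg (p1 p)]

theorem ptA {C Qf Qh Qh' f h h' F F' H : ℝ} (a1 : (F - f)^2 ≤ C * Qf) (a2 : (F' - f)^2 ≤ C * Qf)
    (a3 : (H - h)^2 ≤ C * Qh) (a4 : (H - h')^2 ≤ C * Qh') :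
    |f - (F + F')/2| * |h' - h| ≤ C * (Qf + Qh + Qh') := by
  have e1 : (f - (F+F')/2)^2 ≤ C * Qf := by nlinarith [sq_nonneg (F - F')]
  have e2 : (h' - h)^2 ≤ 2 * C * (Qh + Qh') := by nlinarith [sq_nonneg (H - h + (H - h'))]
  have e3 : |f - (F + F')/2| * |h' - h| ≤ ((f - (F+F')/2)^2 + (h'-h)^2)/2 := by
    rw [← sq_abs (f - (F+F')/2), ← sq_abs (h' - h)]
    nlinarith [sq_nonneg (|f - (F + F')/2| - |h' - h|)]
  have e4 : 0 ≤ C * Qf := (sq_nonneg _).trans a1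
  nlinarith

theorem ptB {C Qf f h F F' : ℝ} (a1 : (F - f)^2 ≤ C * Qf) (a2 : (F' - f)^2 ≤ C * Qf) :
    |h| * |F' + F| ≤ 4 * (f^2 + h^2) + 4 * C * Qf := by
  have e1 : (F' + F)^2 ≤ 8 * f^2 + 8 * (C * Qf) := by
    have : (F' + F)^2 ≤ 2 * F^2 + 2 * F'^2 := by nlinarith [sq_nonneg (F - F')]
    have h1 : F^2 ≤ 2 * (F - f)^2 + 2 * f^2 := by nlinarith [sq_nonneg (F - 2 * f)]
    have h2 : F'^2 ≤ 2 * (F' - f)^2 + 2 * f^2 := by nlinarith [sq_nonneg (F' - 2 * f)]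
    linarith
  have e3 : |h| * |F' + F| ≤ (h^2 + (F'+F)^2)/2 := by
    rw [← sq_abs h, ← sq_abs (F' + F)]
    nlinarith [sq_nonneg (|h| - |F' + F|)]
  nlinarith [sq_nonneg h]

theorem ptC {C Qf f h D y d : ℝ} (hC : 0 ≤ C) (hQ : 0 ≤ Qf) (hy : 0 < y) (hd : 0 ≤ d) (hdy : d ≤ 3 * y) (a1 : D^2 ≤ C * d^2 * Qf) :
    |h| * |D| ≤ y^2 * (f^2 + h^2) + 5 * C * Qf := by
  have e1 : D^2 ≤ y^2 * (9 * C * Qf) := by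
    have : d^2 ≤ (3*y)^2 := pow_le_pow_left₀ hd hdy 2
    calc D^2 ≤ C * d^2 * Qf := a1
      _ ≤ C * (3*y)^2 * Qf := by gcongr
      _ = _ := by ring
  have e2 : (|D| / y)^2 ≤ 9 * C * Qf := by
    rw [div_pow, sq_abs, div_le_iff₀ (by positivity)]; linarith
  have e3 : |h| * |D| = (y * |h|) * (|D| / y) := by field_simp
  have e4 : (y * |h|)^2 = y^2 * h^2 := by rw [mul_pow, sq_abs]
  have e5 : 0 ≤ y^2 * h^2 := by positivity
  have e6 : 0 ≤ y^2 * f^2 := by positivity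
  have e7 : 0 ≤ C * Qf := by positivity
  rw [e3]
  nlinarith [sq_nonneg (y * |h| - |D| / y)]

set_option maxHeartbeats 1000000 in
theorem fine_k {n : ℕ} (hn : 2 ≤ n) {s γ CΦ cb : ℝ} (hs : s ∈ Set.Ioo (0:ℝ) 1) (hγ : -(n:ℝ) < γ) (hCΦ : 0 < CΦ) (hcb : 0 < cb) :
    ∃ C : ℝ, 0 < C ∧ ∀ b : ℝ → ℝ, KernelAssumptions n s cb b → ∀ (f h : V n → ℝ) (M : ℝ), Measurable f → Measurable h →
      (∀ v, |f v| ≤ M) → (∀ v, |h v| ≤ M) → ∀ (vs : V n) (k : ℤ), 2 * (2:ℝ)^(-k) * jap vs ≤ 1/2 → fin1 s γ vs f → fin1 s γ vs h →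
      ‖Tvs n CΦ γ b k vs f h‖ₑ ≤ ENNReal.ofReal C * (
        (∫⁻ v, ENNReal.ofReal (((2:ℝ)^(-k))^(-(2*s)) * ‖v - vs‖^(γ+2*s)) *
          (ENNReal.ofReal (QQ (2 * (2:ℝ)^(-k) * jap vs) f v) + ENNReal.ofReal (QQ (2 * (2:ℝ)^(-k) * jap vs) h v))) +
        (∫⁻ p, ENNReal.ofReal |bsf n CΦ γ b k vs p - bbf n CΦ γ b k vs p| * ENNReal.ofReal (f p.1^2 + h p.1^2) ∂lam n) +
        (∫⁻ v, ENNReal.ofReal (((2:ℝ)^(-k))^(-(2*s)) * ‖v - vs‖^(γ+2*s)) *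
          ((if (2:ℝ)^(-k) ≤ 2 * ‖v - vs‖ then ENNReal.ofReal (((2:ℝ)^(-k) * (1 + 1/‖v - vs‖))^2) else 0) * ENNReal.ofReal (f v^2 + h v^2)))) := by
  obtain ⟨C1, hC1, A1⟩ := avg1 n
  obtain ⟨C2, hC2, A2⟩ := avg2 n
  obtain ⟨Ck, hCk, K⟩ := kint hn hs hγ hCΦ hcb
  refine ⟨(10 * C1 + 5 * C2) * Ck + 4 + Ck, by positivity, ?_⟩
  intro b hb f h M hf hh hfM hhM vs k hR1 hff hfh
  set x : ℝ := (2:ℝ)^(-k) with hx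
  have hx0 : 0 < x := by positivity
  have hj := jap_pos vs
  have hj1 := one_le_jap vs
  set R : ℝ := 2 * x * jap vs with hR
  have hR0 : 0 < R := by positivity
  have hx14 : x ≤ 1/4 := by
    have : 2 * x ≤ R := le_mul_of_one_le_right (by positivity) hj1
    linarith
  have m1 := bbf_meas hb.1 CΦ γ k vs
  have m2 := bsf_meas hb.1 CΦ γ k vs
  have p1 := bbf_nonneg hb.2.1 hCΦ γ k vs
  have p2 := bsf_nonneg hb.2.1 hCΦ γ k vs
  have h3 : Measurable (fun p : V n × Metric.sphere (0 : V n) 1 => vp vs p.1 p.2) := measurable_vp (by fun_prop) (by fun_prop) (by fun_prop)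
  have mQf := QQ_meas hf hfM hR0
  have mQh := QQ_meas hh hhM hR0
  have mW : Measurable (fun v : V n => (if x ≤ 2 * ‖v - vs‖ then ENNReal.ofReal ((x * (1 + 1/‖v - vs‖))^2) else 0) * ENNReal.ofReal (f v^2 + h v^2)) :=
    (Measurable.ite (measurableSet_le (by fun_prop) (by fun_prop)) (by fun_prop) (by fun_prop)).mul (by fun_prop)
  have mS : Measurable (fun p : V n × Metric.sphere (0 : V n) 1 => ENNReal.ofReal (bbf n CΦ γ b k vs p) * (ENNReal.ofReal (QQ R f p.1) + ENNReal.ofReal (QQ R h p.1))) :=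
    m1.ennreal_ofReal.mul ((mQf.add mQh).comp measurable_fst)
  have mWp : Measurable (fun p : V n × Metric.sphere (0 : V n) 1 => ENNReal.ofReal (bbf n CΦ γ b k vs p) * ((if x ≤ 2 * ‖p.1 - vs‖ then ENNReal.ofReal ((x * (1 + 1/‖p.1 - vs‖))^2) else 0) * ENNReal.ofReal (f p.1^2 + h p.1^2))) :=
    m1.ennreal_ofReal.mul (mW.comp measurable_fst)
  have q0 : ∀ (φ : V n → ℝ) v, 0 ≤ QQ R φ v := fun φ v => QQ_nonneg hR0 φ v
  set S1 := ∫⁻ v, ENNReal.ofReal (x^(-(2*s)) * ‖v - vs‖^(γ+2*s)) * (ENNReal.ofReal (QQ R f v) + ENNReal.ofReal (QQ R h v)) with hS1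
  set S2 := ∫⁻ p, ENNReal.ofReal |bsf n CΦ γ b k vs p - bbf n CΦ γ b k vs p| * ENNReal.ofReal (f p.1^2 + h p.1^2) ∂lam n with hS2
  set S3 := ∫⁻ v, ENNReal.ofReal (x^(-(2*s)) * ‖v - vs‖^(γ+2*s)) * ((if x ≤ 2 * ‖v - vs‖ then ENNReal.ofReal ((x * (1 + 1/‖v - vs‖))^2) else 0) * ENNReal.ofReal (f v^2 + h v^2)) with hS3
  -- kernel integrals
  have kS : ∫⁻ p, ENNReal.ofReal (bbf n CΦ γ b k vs p) * (ENNReal.ofReal (QQ R f p.1) + ENNReal.ofReal (QQ R h p.1)) ∂lam n ≤ ENNReal.ofReal Ck * S1 :=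
    (K b hb vs k (fun v => ENNReal.ofReal (QQ R f v) + ENNReal.ofReal (QQ R h v)) (mQf.add mQh)).1
  have kS' : ∫⁻ p, ENNReal.ofReal (bsf n CΦ γ b k vs p) * (ENNReal.ofReal (QQ R f p.1) + ENNReal.ofReal (QQ R h p.1)) ∂lam n ≤ ENNReal.ofReal Ck * S1 :=
    (K b hb vs k (fun v => ENNReal.ofReal (QQ R f v) + ENNReal.ofReal (QQ R h v)) (mQf.add mQh)).2
  have kh' : ∫⁻ p, ENNReal.ofReal (bbf n CΦ γ b k vs p) * ENNReal.ofReal (QQ R h (vp vs p.1 p.2)) ∂lam n ≤ ENNReal.ofReal Ck * S1 := by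
    rw [kswap hn hb.1 hb.2.1 hCΦ γ k vs (fun q => ENNReal.ofReal (QQ R h q.2)) (mQh.comp measurable_snd)]
    refine le_trans (lintegral_mono fun p => ?_) kS'
    gcongr
    exact le_add_self
  have kW : ∫⁻ p, ENNReal.ofReal (bbf n CΦ γ b k vs p) * ((if x ≤ 2 * ‖p.1 - vs‖ then ENNReal.ofReal ((x * (1 + 1/‖p.1 - vs‖))^2) else 0) * ENNReal.ofReal (f p.1^2 + h p.1^2)) ∂lam n ≤ ENNReal.ofReal Ck * S3 :=
    (K b hb vs k (fun v => (if x ≤ 2 * ‖v - vs‖ then ENNReal.ofReal ((x * (1 + 1/‖v - vs‖))^2) else 0) * ENNReal.ofReal (f v^2 + h v^2)) mW).1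
  -- geometry
  have geo : ∀ p : V n × Metric.sphere (0 : V n) 1, (bbf n CΦ γ b k vs p ≠ 0 ∨ bsf n CΦ γ b k vs p ≠ 0) →
      anisoDist p.1 (vp vs p.1 p.2) ≤ R ∧ anisoDist p.1 (vsh vs p.1 p.2) ≤ R ∧
      anisoDist (vsh vs p.1 p.2) (vp vs p.1 p.2) / R ≤ 3 * (x * (1 + 1/‖p.1 - vs‖)) := by
    intro p hp
    have hω : ‖(p.2 : V n)‖ = 1 := by simp
    rcases hp with hp | hp
    · obtain ⟨g1, g2, g3, g4, -⟩ := bb_supp hb hp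
      exact geom_all hx0 hx14 hω g1 g2 g3 g4
    · obtain ⟨g1, g2, g3, g4⟩ := bs_supp hb hp
      exact geom_all hx0 hx14 hω g1 g2 g3 g4
  have self0 : ∀ v : V n, anisoDist v v ≤ R := fun v => by rw [aniso_self]; exact hR0.le
  have hdec := decomp hn hs hγ hCΦ hcb hb k hf hh (FF_meas hf R) hhM (fun v => FF_bound hf hfM hR0 (by linarith) v) hff hfh
  refine hdec.trans ?_
  -- term A
  have tA : (∫⁻ p, ENNReal.ofReal (bbf n CΦ γ b k vs p * (|f p.1 - (FF R f p.1 + FF R f (vp vs p.1 p.2))/2| * |h (vp vs p.1 p.2) - h p.1|)) ∂lam n)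
      ≤ ENNReal.ofReal (2 * C1 * Ck) * S1 := by
    calc _ ≤ ∫⁻ p, ENNReal.ofReal C1 * (ENNReal.ofReal (bbf n CΦ γ b k vs p) * (ENNReal.ofReal (QQ R f p.1) + ENNReal.ofReal (QQ R h p.1)) + ENNReal.ofReal (bbf n CΦ γ b k vs p) * ENNReal.ofReal (QQ R h (vp vs p.1 p.2))) ∂lam n := by
          refine lintegral_mono fun p => ?_
          dsimp only
          by_cases hp : bbf n CΦ γ b k vs p = 0
          · rw [hp]; simp
          · obtain ⟨g1, g2, -⟩ := geo p (Or.inl hp)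
            have := ptA (A1 f M hf hfM R hR0 hR1 p.1 p.1 (self0 _)) (A1 f M hf hfM R hR0 hR1 p.1 _ g1)
              (A1 h M hh hhM R hR0 hR1 p.1 p.1 (self0 _)) (A1 h M hh hhM R hR0 hR1 (vp vs p.1 p.2) p.1 (by rw [aniso_comm]; exact g1))
            rw [← mul_add, ← ENNReal.ofReal_add (q0 f _) (q0 h _), ← ENNReal.ofReal_add (add_nonneg (q0 f _) (q0 h _)) (q0 h _),
              ← ENNReal.ofReal_mul (p1 p), ← ENNReal.ofReal_mul hC1.le]
            refine ENNReal.ofReal_le_ofReal ?_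
            have := mul_le_mul_of_nonneg_left this (p1 p)
            linarith
      _ ≤ ENNReal.ofReal C1 * (ENNReal.ofReal Ck * S1 + ENNReal.ofReal Ck * S1) := by
          rw [lintegral_const_mul' _ _ ENNReal.ofReal_ne_top, lintegral_add_left mS]
          gcongr
      _ = _ := by
          rw [← two_mul, ENNReal.ofReal_mul (by positivity), ENNReal.ofReal_mul (by positivity), ENNReal.ofReal_ofNat]; ring
  have tB : (∫⁻ p, ENNReal.ofReal (|bsf n CΦ γ b k vs p - bbf n CΦ γ b k vs p| * (|h p.1| * |FF R f (vsh vs p.1 p.2) + FF R f p.1|)) ∂lam n)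
      ≤ ENNReal.ofReal 4 * S2 + ENNReal.ofReal (8 * C1 * Ck) * S1 := by
    calc _ ≤ ∫⁻ p, (ENNReal.ofReal 4 * (ENNReal.ofReal |bsf n CΦ γ b k vs p - bbf n CΦ γ b k vs p| * ENNReal.ofReal (f p.1^2 + h p.1^2)) + ENNReal.ofReal (4 * C1) * (ENNReal.ofReal (bbf n CΦ γ b k vs p) * (ENNReal.ofReal (QQ R f p.1) + ENNReal.ofReal (QQ R h p.1)) + ENNReal.ofReal (bsf n CΦ γ b k vs p) * (ENNReal.ofReal (QQ R f p.1) + ENNReal.ofReal (QQ R h p.1)))) ∂lam n := by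
          refine lintegral_mono fun p => ?_
          dsimp only
          by_cases hp : bbf n CΦ γ b k vs p ≠ 0 ∨ bsf n CΦ γ b k vs p ≠ 0
          · obtain ⟨-, g2, -⟩ := geo p hp
            have := ptB (h := h p.1) (A1 f M hf hfM R hR0 hR1 p.1 p.1 (self0 _)) (A1 f M hf hfM R hR0 hR1 p.1 _ g2)
            have hab : |bsf n CΦ γ b k vs p - bbf n CΦ γ b k vs p| ≤ bbf n CΦ γ b k vs p + bsf n CΦ γ b k vs p := by
              rw [abs_le]; constructor <;> linarith [p1 p, p2 p]
            rw [← add_mul, ← ENNReal.ofReal_add (p1 p) (p2 p), ← ENNReal.ofReal_add (q0 f _) (q0 h _), ← ENNReal.ofReal_mul (add_nonneg (p1 p) (p2 p)),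
              ← ENNReal.ofReal_mul (by positivity), ← ENNReal.ofReal_mul (by positivity), ← ENNReal.ofReal_mul (by positivity),
              ← ENNReal.ofReal_add (by positivity) (by have := p1 p; have := p2 p; have := q0 f p.1; have := q0 h p.1; positivity)]
            refine ENNReal.ofReal_le_ofReal ?_
            have e1 := mul_le_mul_of_nonneg_left this (abs_nonneg (bsf n CΦ γ b k vs p - bbf n CΦ γ b k vs p))
            have e2 : |bsf n CΦ γ b k vs p - bbf n CΦ γ b k vs p| * (C1 * QQ R f p.1) ≤ (bbf n CΦ γ b k vs p + bsf n CΦ γ b k vs p) * (C1 * (QQ R f p.1 + QQ R h p.1)) := by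
              have := q0 f p.1
              have := q0 h p.1
              have := p1 p
              have := p2 p
              gcongr
              linarith
            linarith
          · push Not at hp
            rw [hp.1, hp.2]; simp
      _ ≤ ENNReal.ofReal 4 * S2 + ENNReal.ofReal (4 * C1) * (ENNReal.ofReal Ck * S1 + ENNReal.ofReal Ck * S1) := by
          have mm : Measurable (fun p : V n × Metric.sphere (0 : V n) 1 => ENNReal.ofReal |bsf n CΦ γ b k vs p - bbf n CΦ γ b k vs p|) := (m2.sub m1).norm.ennreal_ofReal
          rw [lintegral_add_left (by fun_prop), lintegral_const_mul' _ _ ENNReal.ofReal_ne_top, lintegral_const_mul' _ _ ENNReal.ofReal_ne_top, lintegral_add_left mS]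
          gcongr
      _ = _ := by
          rw [← two_mul, show 8 * C1 * Ck = (4 * C1) * (2 * Ck) by ring, ENNReal.ofReal_mul (p := 4 * C1) (by positivity), ENNReal.ofReal_mul (p := 2) (by positivity), ENNReal.ofReal_ofNat 2]; ring
  have tC : (∫⁻ p, ENNReal.ofReal (bbf n CΦ γ b k vs p * (|h p.1| * |FF R f (vsh vs p.1 p.2) - FF R f (vp vs p.1 p.2)|)) ∂lam n)
      ≤ ENNReal.ofReal Ck * S3 + ENNReal.ofReal (5 * C2 * Ck) * S1 := by
    calc _ ≤ ∫⁻ p, (ENNReal.ofReal (bbf n CΦ γ b k vs p) * ((if x ≤ 2 * ‖p.1 - vs‖ then ENNReal.ofReal ((x * (1 + 1/‖p.1 - vs‖))^2) else 0) * ENNReal.ofReal (f p.1^2 + h p.1^2)) + ENNReal.ofReal (5 * C2) * (ENNReal.ofReal (bbf n CΦ γ b k vs p) * (ENNReal.ofReal (QQ R f p.1) + ENNReal.ofReal (QQ R h p.1)))) ∂lam n := by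
          refine lintegral_mono fun p => ?_
          dsimp only
          by_cases hp : bbf n CΦ γ b k vs p = 0
          · rw [hp]; simp
          · obtain ⟨g1, g2, g3⟩ := geo p (Or.inl hp)
            have hρ := (bb_supp hb hp).1
            have := ptC (f := f p.1) (h := h p.1) hC2.le (q0 f p.1) (by positivity) (div_nonneg (aniso_nonneg _ _) hR0.le) g3 (A2 f M hf hfM R hR0 hR1 p.1 _ _ g2 g1)
            rw [if_pos (bb_supp hb hp).2.2.2.2, ← ENNReal.ofReal_add (q0 f _) (q0 h _), ← ENNReal.ofReal_mul (p1 p), ← ENNReal.ofReal_mul (by positivity),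
              ← ENNReal.ofReal_mul (p1 p), ← ENNReal.ofReal_mul (by positivity), ← ENNReal.ofReal_add (by have := p1 p; positivity) (by have := p1 p; have := q0 f p.1; have := q0 h p.1; positivity)]
            refine ENNReal.ofReal_le_ofReal ?_
            have e1 := mul_le_mul_of_nonneg_left this (p1 p)
            have e2 : 0 ≤ bbf n CΦ γ b k vs p * (5 * C2 * QQ R h p.1) := by have := p1 p; have := q0 h p.1; positivity
            linarith
      _ ≤ ENNReal.ofReal Ck * S3 + ENNReal.ofReal (5 * C2) * (ENNReal.ofReal Ck * S1) := by
          rw [lintegral_add_left mWp, lintegral_const_mul' _ _ ENNReal.ofReal_ne_top]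
          gcongr
      _ = _ := by
          rw [ENNReal.ofReal_mul (p := 5 * C2) (by positivity)]; ring
  calc _ ≤ ENNReal.ofReal (2 * C1 * Ck) * S1 + (ENNReal.ofReal 4 * S2 + ENNReal.ofReal (8 * C1 * Ck) * S1) + (ENNReal.ofReal Ck * S3 + ENNReal.ofReal (5 * C2 * Ck) * S1) :=
        add_le_add (add_le_add tA tB) tC
    _ = ENNReal.ofReal ((10 * C1 + 5 * C2) * Ck) * S1 + ENNReal.ofReal 4 * S2 + ENNReal.ofReal Ck * S3 := by
        rw [show (10 * C1 + 5 * C2) * Ck = 2 * C1 * Ck + 8 * C1 * Ck + 5 * C2 * Ck by ring, ENNReal.ofReal_add (by positivity) (by positivity), ENNReal.ofReal_add (by positivity) (by positivity)]; ring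
    _ ≤ ENNReal.ofReal ((10 * C1 + 5 * C2) * Ck + 4 + Ck) * S1 + ENNReal.ofReal ((10 * C1 + 5 * C2) * Ck + 4 + Ck) * S2 + ENNReal.ofReal ((10 * C1 + 5 * C2) * Ck + 4 + Ck) * S3 := by
        have : (0:ℝ) < (10 * C1 + 5 * C2) * Ck := by positivity
        gcongr
        · linarith
        · linarith
        · linarith
    _ = _ := by ring

theorem coarse_k {n : ℕ} (hn : 2 ≤ n) {s γ CΦ cb : ℝ} (hs : s ∈ Set.Ioo (0:ℝ) 1) (hγ : -(n:ℝ) < γ) (hCΦ : 0 < CΦ) (hcb : 0 < cb) :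
    ∃ C : ℝ, 0 < C ∧ ∀ b : ℝ → ℝ, KernelAssumptions n s cb b → ∀ (f h : V n → ℝ), Measurable f → Measurable h →
      ∀ (vs : V n) (k : ℤ),
      ‖Tvs n CΦ γ b k vs f h‖ₑ ≤ ENNReal.ofReal C * 
        (∫⁻ v, ENNReal.ofReal (((2:ℝ)^(-k))^(-(2*s)) * ‖v - vs‖^(γ+2*s)) * ENNReal.ofReal (f v^2 + h v^2)) := by
  obtain ⟨Ck, hCk, K⟩ := kint hn hs hγ hCΦ hcb
  refine ⟨2 * Ck, by positivity, ?_⟩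
  intro b hb f h hf hh vs k
  have m1 := bbf_meas hb.1 CΦ γ k vs
  have p1 := bbf_nonneg hb.2.1 hCΦ γ k vs
  have h3 : Measurable (fun p : V n × Metric.sphere (0 : V n) 1 => vp vs p.1 p.2) := measurable_vp (by fun_prop) (by fun_prop) (by fun_prop)
  have k1 := K b hb vs k (fun v => ENNReal.ofReal (f v^2 + h v^2)) (by fun_prop)
  set S := (∫⁻ v, ENNReal.ofReal (((2:ℝ)^(-k))^(-(2*s)) * ‖v - vs‖^(γ+2*s)) * ENNReal.ofReal (f v^2 + h v^2)) with hS
  have k2 : ∫⁻ p, ENNReal.ofReal (bbf n CΦ γ b k vs p) * ENNReal.ofReal (h (vp vs p.1 p.2)^2) ∂lam n ≤ ENNReal.ofReal Ck * S := by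
    rw [kswap hn hb.1 hb.2.1 hCΦ γ k vs (fun q => ENNReal.ofReal (h q.2^2)) (by fun_prop)]
    refine le_trans (lintegral_mono fun p => ?_) k1.2
    gcongr
    linarith [sq_nonneg (f p.1)]
  refine (enorm_integral_le_lintegral_enorm _).trans ?_
  calc _ ≤ ∫⁻ p, (ENNReal.ofReal (bbf n CΦ γ b k vs p) * ENNReal.ofReal (f p.1^2 + h p.1^2) + ENNReal.ofReal (bbf n CΦ γ b k vs p) * ENNReal.ofReal (h (vp vs p.1 p.2)^2)) ∂lam n := by
        refine lintegral_mono fun p => ?_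
        rw [← mul_add, ← ENNReal.ofReal_add (by positivity) (by positivity), ← ENNReal.ofReal_mul (p1 p), ← ofReal_norm]
        refine ENNReal.ofReal_le_ofReal ?_
        rw [norm_mul, Real.norm_eq_abs, abs_of_nonneg (p1 p)]
        refine mul_le_mul_of_nonneg_left ?_ (p1 p)
        rw [Real.norm_eq_abs]
        generalize f p.1 = a
        generalize h p.1 = c
        generalize h (vp vs p.1 p.2) = d
        rw [abs_le]
        constructor <;> nlinarith [sq_nonneg (a + (d - c)), sq_nonneg (a - (d - c)), sq_nonneg (d + c), sq_nonneg a, sq_nonneg c, sq_nonneg d]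
    _ ≤ ENNReal.ofReal Ck * S + ENNReal.ofReal Ck * S := by
        rw [lintegral_add_left (by fun_prop)]
        exact add_le_add k1.1 k2
    _ = _ := by
        rw [ENNReal.ofReal_mul (by norm_num), ENNReal.ofReal_ofNat]; ring

theorem wsum {s : ℝ} (hs : s ∈ Set.Ioo (0:ℝ) 1) (γ : ℝ) :
    ∃ C : ℝ, 0 < C ∧ ∀ ρ : ℝ, 0 < ρ → ∑' k : ℤ, (if (2:ℝ)^(-k) ≤ 2*ρ ∧ (2:ℝ)^(-k) ≤ 1 then
      ENNReal.ofReal (((2:ℝ)^(-k))^(-(2*s)) * ρ^(γ+2*s)) * ENNReal.ofReal (((2:ℝ)^(-k) * (1 + 1/ρ))^2) else 0) ≤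
      ENNReal.ofReal C * (ENNReal.ofReal (ρ^γ) + ENNReal.ofReal (ρ^(γ+2*s))) := by
  obtain ⟨hs0, hs1⟩ := hs
  obtain ⟨D, hD, H⟩ := geo_small (p := 2-2*s) (by linarith)
  refine ⟨D * 16, by positivity, fun ρ hρ => ?_⟩
  have hA : 0 < min (2*ρ) 1 := by positivity
  have h1 := H _ hA
  have e : ∀ k : ℤ, (if (2:ℝ)^(-k) ≤ 2*ρ ∧ (2:ℝ)^(-k) ≤ 1 then
      ENNReal.ofReal (((2:ℝ)^(-k))^(-(2*s)) * ρ^(γ+2*s)) * ENNReal.ofReal (((2:ℝ)^(-k) * (1 + 1/ρ))^2) else 0) =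
      ENNReal.ofReal (ρ^(γ+2*s) * (1 + 1/ρ)^2) * (if (2:ℝ)^(-k) ≤ min (2*ρ) 1 then ENNReal.ofReal (((2:ℝ)^(-k))^(2-2*s)) else 0) := by
    intro k
    have hx : (0:ℝ) < 2^(-k) := by positivity
    simp only [le_min_iff]
    split_ifs
    · rw [← ENNReal.ofReal_mul (by positivity), ← ENNReal.ofReal_mul (by positivity), show 2 - 2*s = -(2*s) + (2:ℕ) by push_cast; ring, rpow_add hx, rpow_natCast]
      congr 1; ring
    · simp
  simp only [e]
  rw [ENNReal.tsum_mul_left]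
  refine (mul_le_mul_right h1 _).trans ?_
  rw [← ENNReal.ofReal_mul (by positivity), ← ENNReal.ofReal_add (by positivity) (by positivity), ← ENNReal.ofReal_mul (by positivity)]
  refine ENNReal.ofReal_le_ofReal ?_
  have key : ρ^(γ+2*s) * (1+1/ρ)^2 * (min (2*ρ) 1)^(2-2*s) ≤ 16 * (ρ^γ + ρ^(γ+2*s)) := by
    rcases le_total 1 ρ with h | h
    · have a1 : (min (2*ρ) 1)^(2-2*s) ≤ 1 := rpow_le_one hA.le (min_le_right _ _) (by linarith)
      have a2 : (1+1/ρ)^2 ≤ 2^2 := by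
        have : 1/ρ ≤ 1 := by rw [div_le_one hρ]; exact h
        gcongr; linarith
      calc _ ≤ ρ^(γ+2*s) * 2^2 * 1 := by gcongr
        _ ≤ _ := by
          have : 0 < ρ^γ := by positivity
          have : 0 < ρ^(γ+2*s) := by positivity
          linarith
    · have a1 : (min (2*ρ) 1)^(2-2*s) ≤ 4 * ρ^(2-2*s) := by
        calc _ ≤ (2*ρ)^(2-2*s) := rpow_le_rpow hA.le (min_le_left _ _) (by linarith)
          _ = 2^(2-2*s) * ρ^(2-2*s) := mul_rpow (by norm_num) hρ.le
          _ ≤ 2^(2:ℝ) * ρ^(2-2*s) := by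
              gcongr
              · norm_num
              · linarith
          _ = _ := by norm_num
      have a2 : (1+1/ρ)^2 ≤ 4 * (ρ^2)⁻¹ := by
        have : 1 ≤ 1/ρ := by rw [le_div_iff₀ hρ]; linarith
        calc (1+1/ρ)^2 ≤ (1/ρ+1/ρ)^2 := by gcongr
          _ = _ := by field_simp; norm_num
      have a3 : ρ^(γ+2*s) * ρ^(2-2*s) = ρ^γ * ρ^2 := by
        rw [← rpow_add hρ, ← rpow_natCast ρ 2, ← rpow_add hρ]; congr 1; push_cast; ring
      calc _ ≤ ρ^(γ+2*s) * (4 * (ρ^2)⁻¹) * (4 * ρ^(2-2*s)) := by gcongr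
        _ = 16 * (ρ^2)⁻¹ * (ρ^(γ+2*s) * ρ^(2-2*s)) := by ring
        _ = 16 * ρ^γ := by rw [a3]; field_simp
        _ ≤ _ := by
          have : 0 < ρ^(γ+2*s) := by positivity
          linarith
  nlinarith

/-- the integrand of the norm -/
def XX {n : ℕ} (s : ℝ) (f h : V n → ℝ) (v : V n) : ℝ≥0∞ :=
  ENNReal.ofReal (jap v) * (DD s f v + DD s h v) + ENNReal.ofReal (f v^2 + h v^2)

theorem sum_vs {n : ℕ} (hn : 2 ≤ n) {s γ CΦ cb : ℝ} (hs : s ∈ Set.Ioo (0:ℝ) 1) (hγ : -(n:ℝ) < γ) (hCΦ : 0 < CΦ) (hcb : 0 < cb) :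
    ∃ C : ℝ, 0 < C ∧ ∀ b : ℝ → ℝ, KernelAssumptions n s cb b → ∀ (f h : V n → ℝ) (M : ℝ), Measurable f → Measurable h →
      (∀ v, |f v| ≤ M) → (∀ v, |h v| ≤ M) → ∀ (vs : V n), fin1 s γ vs f → fin1 s γ vs h →
      ∑' k : ℤ, ‖Tvs n CΦ γ b k vs f h‖ₑ ≤ ENNReal.ofReal (C * jap vs^(2*s)) *
        ∫⁻ v, (ENNReal.ofReal (‖v - vs‖^γ) + ENNReal.ofReal (‖v - vs‖^(γ+2*s))) * XX s f h v := by
  obtain ⟨Cf, hCf, Hf⟩ := fine_k hn hs hγ hCΦ hcb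
  obtain ⟨Cc, hCc, Hc⟩ := coarse_k hn hs hγ hCΦ hcb
  obtain ⟨Cd, hCd, Hd⟩ := kdiff hn hs hγ hCΦ hcb
  obtain ⟨Cw, hCw, Hw⟩ := wsum hs γ
  obtain ⟨Cq, hCq, Hq⟩ := QQ_sum n hs
  obtain ⟨Cg, hCg, Hg⟩ := geo_large (p := 2*s) (by linarith [hs.1])
  refine ⟨Cf * (Cq + Cd + Cw) + Cc * (Cg * 16), by positivity, ?_⟩
  intro b hb f h M hf hh hfM hhM vs hff hfh
  have hj := jap_pos vs
  have hj1 := one_le_jap vs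
  set J := jap vs with hJ
  have hJs : 1 ≤ J^(2*s) := one_le_rpow hj1 (by linarith [hs.1])
  set I := ∫⁻ v, (ENNReal.ofReal (‖v - vs‖^γ) + ENNReal.ofReal (‖v - vs‖^(γ+2*s))) * XX s f h v with hI
  set a : ℤ → V n → ℝ≥0∞ := fun k v => if 2 * (2:ℝ)^(-k) * J ≤ 1/2 then ENNReal.ofReal (((2:ℝ)^(-k))^(-(2*s)) * ‖v - vs‖^(γ+2*s)) *
          (ENNReal.ofReal (QQ (2 * (2:ℝ)^(-k) * J) f v) + ENNReal.ofReal (QQ (2 * (2:ℝ)^(-k) * J) h v)) else 0 with ha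
  set c : ℤ → V n → ℝ≥0∞ := fun k v => (if (2:ℝ)^(-k) ≤ 2*‖v - vs‖ ∧ (2:ℝ)^(-k) ≤ 1 then
      ENNReal.ofReal (((2:ℝ)^(-k))^(-(2*s)) * ‖v - vs‖^(γ+2*s)) * ENNReal.ofReal (((2:ℝ)^(-k) * (1 + 1/‖v - vs‖))^2) else 0) * ENNReal.ofReal (f v^2 + h v^2) with hc
  set d : ℤ → V n → ℝ≥0∞ := fun k v => (if 1/(4*J) ≤ (2:ℝ)^(-k) then ENNReal.ofReal (((2:ℝ)^(-k))^(-(2*s))) else 0) * (ENNReal.ofReal (‖v - vs‖^(γ+2*s)) * ENNReal.ofReal (f v^2 + h v^2)) with hd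
  have ma : ∀ k, Measurable (a k) := by
    intro k
    rw [ha]; dsimp only
    by_cases hk : 2 * (2:ℝ)^(-k) * J ≤ 1/2
    · simp only [if_pos hk]
      have mQf := QQ_meas hf hfM (show 0 < 2 * (2:ℝ)^(-k) * J by positivity)
      have mQh := QQ_meas hh hhM (show 0 < 2 * (2:ℝ)^(-k) * J by positivity)
      fun_prop
    · simp only [if_neg hk]; fun_prop
  have mc : ∀ k, Measurable (c k) := by
    intro k
    have hset : MeasurableSet {v : V n | (2:ℝ)^(-k) ≤ 2*‖v - vs‖ ∧ (2:ℝ)^(-k) ≤ 1} :=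
      (measurableSet_le (f := fun _ : V n => (2:ℝ)^(-k)) (g := fun v : V n => 2*‖v - vs‖) (by fun_prop) (by fun_prop)).inter (MeasurableSet.const _)
    simp only [hc]
    exact (Measurable.ite hset (by fun_prop) (by fun_prop)).mul (by fun_prop)
  have md : ∀ k, Measurable (d k) := by
    intro k
    rw [hd]; fun_prop
  have step : ∀ k, ‖Tvs n CΦ γ b k vs f h‖ₑ ≤ ENNReal.ofReal Cf * ((∫⁻ v, a k v) +
      (∫⁻ p, ENNReal.ofReal |bsf n CΦ γ b k vs p - bbf n CΦ γ b k vs p| * ENNReal.ofReal (f p.1^2 + h p.1^2) ∂lam n) + ∫⁻ v, c k v) + ENNReal.ofReal Cc * ∫⁻ v, d k v := by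
    intro k
    have hx : (0:ℝ) < 2^(-k) := by positivity
    by_cases hk : 2 * (2:ℝ)^(-k) * J ≤ 1/2
    · have hx1 : (2:ℝ)^(-k) ≤ 1 := by nlinarith
      refine le_trans (Hf b hb f h M hf hh hfM hhM vs k hk hff hfh) (le_trans ?_ le_self_add)
      gcongr with v
      · simp only [ha, if_pos hk]; rfl
      · simp only [hc, and_iff_left hx1]
        rw [← mul_assoc]
        split_ifs <;> simp
    · refine le_trans (Hc b hb f h hf hh vs k) (le_trans ?_ le_add_self)
      have hk' : 1/(4*J) ≤ (2:ℝ)^(-k) := by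
        rw [div_le_iff₀ (by positivity)]; push Not at hk; linarith
      gcongr with v
      simp only [hd, if_pos hk']
      rw [ENNReal.ofReal_mul (by positivity), mul_assoc]
  have XX1 : ∀ v, ENNReal.ofReal (f v^2 + h v^2) ≤ XX s f h v := fun v => le_add_self
  have XX2 : ∀ v, ENNReal.ofReal (jap v) * (DD s f v + DD s h v) ≤ XX s f h v := fun v => le_self_add
  have sa : ∑' k, ∫⁻ v, a k v ≤ ENNReal.ofReal (Cq * J^(2*s)) * I := by
    rw [← lintegral_tsum (fun k => (ma k).aemeasurable), hI, ← lintegral_const_mul' _ _ ENNReal.ofReal_ne_top]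
    refine lintegral_mono fun v => ?_
    have q1 := Hq f M hf hfM J hj1 v
    have q2 := Hq h M hh hhM J hj1 v
    have e : ∀ k, a k v = ENNReal.ofReal (‖v - vs‖^(γ+2*s)) * ((if 2 * (2:ℝ)^(-k) * J ≤ 1/2 then ENNReal.ofReal (((2:ℝ)^(-k))^(-(2*s))) * ENNReal.ofReal (QQ (2 * (2:ℝ)^(-k) * J) f v) else 0)
        + (if 2 * (2:ℝ)^(-k) * J ≤ 1/2 then ENNReal.ofReal (((2:ℝ)^(-k))^(-(2*s))) * ENNReal.ofReal (QQ (2 * (2:ℝ)^(-k) * J) h v) else 0)) := by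
      intro k
      simp only [ha]
      split_ifs
      · rw [ENNReal.ofReal_mul (by positivity)]; ring
      · simp
    simp only [e]
    rw [ENNReal.tsum_mul_left, ENNReal.tsum_add]
    calc _ ≤ ENNReal.ofReal (‖v - vs‖^(γ+2*s)) * (ENNReal.ofReal (Cq * J^(2*s)) * (ENNReal.ofReal (jap v) * DD s f v) + ENNReal.ofReal (Cq * J^(2*s)) * (ENNReal.ofReal (jap v) * DD s h v)) := by gcongr
      _ = ENNReal.ofReal (Cq * J^(2*s)) * (ENNReal.ofReal (‖v - vs‖^(γ+2*s)) * (ENNReal.ofReal (jap v) * (DD s f v + DD s h v))) := by ring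
      _ ≤ _ := by
        gcongr
        · exact le_add_self
        · exact XX2 v
  have sd : ∑' k, ∫⁻ v, d k v ≤ ENNReal.ofReal (Cg * 16 * J^(2*s)) * I := by
    rw [← lintegral_tsum (fun k => (md k).aemeasurable), hI, ← lintegral_const_mul' _ _ ENNReal.ofReal_ne_top]
    refine lintegral_mono fun v => ?_
    simp only [hd]
    rw [ENNReal.tsum_mul_right]
    gcongr
    · refine (Hg (1/(4*J)) (by positivity)).trans (ENNReal.ofReal_le_ofReal ?_)
      rw [mul_assoc]
      gcongr
      rw [one_div, inv_rpow (by positivity), rpow_neg (by positivity), inv_inv, mul_rpow (by norm_num) hj.le]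
      gcongr
      calc (4:ℝ)^(2*s) ≤ 4^(2:ℝ) := by
            gcongr
            · norm_num
            · linarith [hs.2]
        _ = 16 := by norm_num
    · exact le_add_self
    · exact XX1 v
  have sc : ∑' k, ∫⁻ v, c k v ≤ ENNReal.ofReal Cw * I := by
    rw [← lintegral_tsum (fun k => (mc k).aemeasurable), hI, ← lintegral_const_mul' _ _ ENNReal.ofReal_ne_top]
    refine lintegral_mono_ae ?_
    filter_upwards [ae_ne hn vs] with v hv
    have hz : 0 < ‖v - vs‖ := norm_pos_iff.2 (sub_ne_zero.2 hv)
    simp only [hc]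
    rw [ENNReal.tsum_mul_right, ← mul_assoc]
    gcongr
    · exact Hw _ hz
    · exact XX1 v
  have sb := Hd b hb vs (fun v => ENNReal.ofReal (f v^2 + h v^2)) (by fun_prop)
  have sb' : ENNReal.ofReal Cd * ∫⁻ v, ENNReal.ofReal (‖v - vs‖^γ) * ENNReal.ofReal (f v^2 + h v^2) ≤ ENNReal.ofReal Cd * I := by
    refine mul_le_mul_right (lintegral_mono fun v => ?_) _
    exact mul_le_mul' le_self_add (XX1 v)
  calc _ ≤ ∑' k : ℤ, (ENNReal.ofReal Cf * ((∫⁻ v, a k v) +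
      (∫⁻ p, ENNReal.ofReal |bsf n CΦ γ b k vs p - bbf n CΦ γ b k vs p| * ENNReal.ofReal (f p.1^2 + h p.1^2) ∂lam n) + ∫⁻ v, c k v) + ENNReal.ofReal Cc * ∫⁻ v, d k v) := ENNReal.tsum_le_tsum step
    _ = ENNReal.ofReal Cf * ((∑' k : ℤ, ∫⁻ v, a k v) +
      (∑' k : ℤ, ∫⁻ p, ENNReal.ofReal |bsf n CΦ γ b k vs p - bbf n CΦ γ b k vs p| * ENNReal.ofReal (f p.1^2 + h p.1^2) ∂lam n) + ∑' k : ℤ, ∫⁻ v, c k v) + ENNReal.ofReal Cc * ∑' k : ℤ, ∫⁻ v, d k v := by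
        rw [ENNReal.tsum_add, ENNReal.tsum_mul_left, ENNReal.tsum_mul_left, ENNReal.tsum_add, ENNReal.tsum_add]
    _ ≤ ENNReal.ofReal Cf * (ENNReal.ofReal (Cq * J^(2*s)) * I + ENNReal.ofReal (Cd * J^(2*s)) * I + ENNReal.ofReal (Cw * J^(2*s)) * I) + ENNReal.ofReal Cc * (ENNReal.ofReal (Cg * 16 * J^(2*s)) * I) := by
        gcongr
        · refine (sb.trans sb').trans ?_
          gcongr
          exact le_mul_of_one_le_right hCd.le hJs
        · refine sc.trans ?_
          gcongr
          exact le_mul_of_one_le_right hCw.le hJs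
    _ = _ := by
        rw [← add_mul, ← add_mul, ← mul_assoc, ← mul_assoc, ← add_mul, ← ENNReal.ofReal_add (by positivity) (by positivity), ← ENNReal.ofReal_add (by positivity) (by positivity),
          ← ENNReal.ofReal_mul (by positivity), ← ENNReal.ofReal_mul (by positivity), ← ENNReal.ofReal_add (by positivity) (by positivity)]
        congr 2; ring

theorem DD_meas {n : ℕ} {f : V n → ℝ} (hf : Measurable f) (s : ℝ) : Measurable (DD s f) := by
  unfold DD
  refine Measurable.lintegral_prod_right (f := fun p w : V n => (if anisoDist p w ≤ 1 then
    ENNReal.ofReal ((f w - f p) ^ 2 * anisoDist p w ^ (-((n : ℝ) + 2 * s))) else 0)) ?_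
  have := aniso_meas (n := n)
  exact Measurable.ite (measurableSet_le aniso_meas (by fun_prop)) (by fun_prop) (by fun_prop)

theorem XX_meas {n : ℕ} {f h : V n → ℝ} (hf : Measurable f) (hh : Measurable h) (s : ℝ) : Measurable (XX s f h) := by
  unfold XX
  have hj := (jap_cont (n := n)).measurable
  have := DD_meas hf s
  have := DD_meas hh s
  fun_prop

theorem sch_fin {n : ℕ} (ℓ : ℝ) (f : SchwartzMap (V n) ℝ) :
    ∫⁻ v : V n, ENNReal.ofReal (jap v ^ ℓ) * ENNReal.ofReal |f v| < ⊤ := by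
  obtain ⟨m, hm⟩ := exists_nat_ge ℓ
  have i1 := f.integrable_pow_mul volume m
  have i0 := f.integrable_pow_mul volume 0
  have i2 : Integrable (fun v : V n => (2:ℝ)^m * (‖v‖^0 * ‖f v‖ + ‖v‖^m * ‖f v‖)) volume := (i0.add i1).const_mul _
  refine lt_of_le_of_lt ?_ i2.lintegral_lt_top
  refine lintegral_mono fun v => ?_
  have hj := jap_pos v
  rw [← ENNReal.ofReal_mul (by positivity)]
  refine ENNReal.ofReal_le_ofReal ?_
  have h1 : jap v ^ ℓ ≤ jap v ^ m := by
    rw [← rpow_natCast]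
    exact rpow_le_rpow_of_exponent_le (one_le_jap v) hm
  have h2 : jap v ≤ 1 + ‖v‖ := by
    refine Real.sqrt_le_iff.2 ⟨by positivity, by nlinarith [norm_nonneg v]⟩
  have h3 : (1 + ‖v‖)^m ≤ 2^m * (1 + ‖v‖^m) := by
    rcases le_total 1 ‖v‖ with h | h
    · calc (1+‖v‖)^m ≤ (2*‖v‖)^m := by gcongr; linarith
        _ = 2^m * ‖v‖^m := mul_pow _ _ _
        _ ≤ _ := by gcongr; linarith
    · calc (1+‖v‖)^m ≤ 2^m := by gcongr; linarith
        _ ≤ _ := by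
          have : 0 ≤ ‖v‖^m := by positivity
          have : (0:ℝ) < 2^m := by positivity
          nlinarith
  calc jap v^ℓ * |f v| ≤ (2^m * (1 + ‖v‖^m)) * |f v| := by
        gcongr
        exact h1.trans ((pow_le_pow_left₀ hj.le h2 m).trans h3)
    _ = _ := by rw [Real.norm_eq_abs]; ring

theorem U1 {n : ℕ} {s γ Cg : ℝ} {g : V n → ℝ} (hs : s ∈ Set.Ioo (0:ℝ) 1) (hg : Measurable g) (hU : AssumptionU s γ Cg g)
    {a : ℝ} (ha : a ∈ Set.Icc γ (γ + 2*s)) (hCg : 0 < Cg) {φ : V n → ℝ≥0∞} (hφ : Measurable φ) :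
    ∫⁻ vs, ENNReal.ofReal |g vs| * ENNReal.ofReal (jap vs^(2*s)) * ∫⁻ v, ENNReal.ofReal (‖v - vs‖^a) * φ v ≤
      ENNReal.ofReal Cg * ∫⁻ v, ENNReal.ofReal (jap v^a) * φ v := by
  have hj := (jap_cont (n := n)).measurable
  calc _ = ∫⁻ vs, ∫⁻ v, ENNReal.ofReal |g vs| * ENNReal.ofReal (jap vs^(2*s)) * (ENNReal.ofReal (‖v - vs‖^a) * φ v) := by
        refine lintegral_congr fun vs => ?_
        rw [lintegral_const_mul' _ _ (by finiteness)]
    _ = ∫⁻ v, ∫⁻ vs, ENNReal.ofReal |g vs| * ENNReal.ofReal (jap vs^(2*s)) * (ENNReal.ofReal (‖v - vs‖^a) * φ v) := by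
        refine lintegral_lintegral_swap (Measurable.aemeasurable ?_)
        have : Measurable (fun p : V n × V n => |g p.1|) := (hg.comp measurable_fst).norm
        unfold Function.uncurry
        fun_prop
    _ ≤ ∫⁻ v, (∫⁻ vs, ENNReal.ofReal (‖v - vs‖ ^ a * jap vs ^ (if s < 2⁻¹ then (1:ℝ) else 2) * |g vs|)) * φ v := by
        refine lintegral_mono fun v => ?_
        rw [← lintegral_mul_const _ ?_]
        · refine lintegral_mono fun vs => ?_
          have hjp := jap_pos vs
          rw [← mul_assoc, ← ENNReal.ofReal_mul (abs_nonneg _), ← ENNReal.ofReal_mul (by positivity)]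
          refine mul_le_mul' (ENNReal.ofReal_le_ofReal ?_) le_rfl
          have : jap vs^(2*s) ≤ jap vs ^ (if s < 2⁻¹ then (1:ℝ) else 2) := by
            refine rpow_le_rpow_of_exponent_le (one_le_jap vs) ?_
            split_ifs with h
            · linarith
            · linarith [hs.2]
          calc |g vs| * jap vs^(2*s) * ‖v - vs‖^a = ‖v - vs‖^a * jap vs^(2*s) * |g vs| := by ring
            _ ≤ _ := by gcongr
        · have : Measurable (fun p : V n => |g p|) := hg.norm
          fun_prop
    _ ≤ ∫⁻ v, ENNReal.ofReal (Cg * jap v^a) * φ v := lintegral_mono fun v => mul_le_mul' (hU v a ha) le_rfl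
    _ = _ := by
        rw [← lintegral_const_mul' _ _ ENNReal.ofReal_ne_top]
        refine lintegral_congr fun v => ?_
        rw [ENNReal.ofReal_mul hCg.le, mul_assoc]

theorem rpow_comp {a b : ℝ} (ha : 0 < a) (hb : 0 < b) (h1 : a ≤ 2*b) (h2 : b ≤ 2*a) (t : ℝ) : a^t ≤ 2^|t| * b^t := by
  rcases le_total 0 t with h | h
  · rw [abs_of_nonneg h, ← mul_rpow (by norm_num) hb.le]
    exact rpow_le_rpow ha.le h1 h
  · rw [abs_of_nonpos h, rpow_neg (by norm_num), ← div_eq_inv_mul, ← div_rpow hb.le (by norm_num)]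
    exact rpow_le_rpow_of_nonpos (by positivity) (by linarith) h

theorem DD_N {n : ℕ} (s γ : ℝ) (f : V n → ℝ) :
    ∫⁻ v, ENNReal.ofReal (jap v^(γ+2*s)) * (ENNReal.ofReal (jap v) * DD s f v) ≤
      ENNReal.ofReal (2^|(γ+2*s+1)/2|) * NdotSq s γ f := by
  unfold NdotSq DD
  rw [← lintegral_const_mul' _ _ ENNReal.ofReal_ne_top]
  refine lintegral_mono fun v => ?_
  rw [← lintegral_const_mul' _ _ ENNReal.ofReal_ne_top, ← lintegral_const_mul' _ _ ENNReal.ofReal_ne_top, ← lintegral_const_mul' _ _ ENNReal.ofReal_ne_top]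
  refine lintegral_mono fun w => ?_
  have hv := jap_pos v
  have hw := jap_pos w
  dsimp only
  split_ifs with h
  · have hd := aniso_nonneg v w
    have hp : 0 ≤ anisoDist v w ^ (-((n : ℝ) + 2 * s)) := by positivity
    rw [← ENNReal.ofReal_mul (by positivity), ← ENNReal.ofReal_mul (by positivity), ← ENNReal.ofReal_mul (by positivity)]
    refine ENNReal.ofReal_le_ofReal ?_
    have key := rpow_comp hv hw (jap_le_of_aniso (by rwa [aniso_comm])) (jap_le_of_aniso h) ((γ+2*s+1)/2)
    have e : jap v^(γ+2*s) * jap v = jap v^((γ+2*s+1)/2) * jap v^((γ+2*s+1)/2) := by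
      rw [← rpow_add hv, ← rpow_add_one hv.ne']; congr 1; ring
    rw [mul_rpow hv.le hw.le]
    calc _ = (jap v^(γ+2*s) * jap v) * ((f w - f v) ^ 2 * anisoDist v w ^ (-((n : ℝ) + 2 * s))) := by ring
      _ ≤ (jap v^((γ+2*s+1)/2) * (2^|(γ+2*s+1)/2| * jap w^((γ+2*s+1)/2))) * ((f w - f v) ^ 2 * anisoDist v w ^ (-((n : ℝ) + 2 * s))) := by
          rw [e]; gcongr
      _ = _ := by ring
  · simp

theorem XX_N {n : ℕ} {s : ℝ} (hs : s ∈ Set.Ioo (0:ℝ) 1) (γ : ℝ) {f h : V n → ℝ} (hf : Measurable f) (hh : Measurable h) :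
    ∫⁻ v, ENNReal.ofReal (jap v^(γ+2*s)) * XX s f h v ≤
      ENNReal.ofReal (2^|(γ+2*s+1)/2|) * ((L2e (γ+2*s) f + NdotSq s γ f) + (L2e (γ+2*s) h + NdotSq s γ h)) := by
  have hj := (jap_cont (n := n)).measurable
  have d1 := DD_meas hf s
  have d2 := DD_meas hh s
  have n1 := DD_N s γ f
  have n2 := DD_N s γ h
  have h1 : (1:ℝ) ≤ 2^|(γ+2*s+1)/2| := one_le_rpow (by norm_num) (abs_nonneg _)
  have h1' : (1:ℝ≥0∞) ≤ ENNReal.ofReal (2^|(γ+2*s+1)/2|) := by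
    rw [← ENNReal.ofReal_one]; exact ENNReal.ofReal_le_ofReal h1
  set D := ENNReal.ofReal (2^|(γ+2*s+1)/2|)
  calc _ = ∫⁻ v, ((ENNReal.ofReal (jap v^(γ+2*s)) * (ENNReal.ofReal (jap v) * DD s f v) + ENNReal.ofReal (jap v^(γ+2*s)) * (ENNReal.ofReal (jap v) * DD s h v)) + 
          (ENNReal.ofReal (jap v^(γ+2*s) * f v^2) + ENNReal.ofReal (jap v^(γ+2*s) * h v^2))) := by
        refine lintegral_congr fun v => ?_
        have hv := jap_pos v
        rw [XX, ENNReal.ofReal_add (by positivity) (by positivity), ENNReal.ofReal_mul (by positivity), ENNReal.ofReal_mul (by positivity)]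
        ring
    _ = ((∫⁻ v, ENNReal.ofReal (jap v^(γ+2*s)) * (ENNReal.ofReal (jap v) * DD s f v)) + (∫⁻ v, ENNReal.ofReal (jap v^(γ+2*s)) * (ENNReal.ofReal (jap v) * DD s h v))) + (L2e (γ+2*s) f + L2e (γ+2*s) h) := by
        rw [lintegral_add_left (by fun_prop), lintegral_add_left (by fun_prop), lintegral_add_left (by fun_prop)]; rfl
    _ ≤ (D * NdotSq s γ f + D * NdotSq s γ h) + (D * L2e (γ+2*s) f + D * L2e (γ+2*s) h) := by
        refine add_le_add (add_le_add n1 n2) (add_le_add ?_ ?_)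
        · exact le_mul_of_one_le_left' h1'
        · exact le_mul_of_one_le_left' h1'
    _ = _ := by ring

/-- the coordinate exchange -/
def EE (n : ℕ) : (V n × V n × Metric.sphere (0 : V n) 1) ≃ᵐ (V n × V n × Metric.sphere (0 : V n) 1) where
  toFun p := (p.2.1, p.1, p.2.2)
  invFun p := (p.2.1, p.1, p.2.2)
  left_inv _ := rfl
  right_inv _ := rfl
  measurable_toFun := by
    show Measurable (fun p : V n × V n × Metric.sphere (0 : V n) 1 => (p.2.1, p.1, p.2.2))
    fun_prop
  measurable_invFun := by
    show Measurable (fun p : V n × V n × Metric.sphere (0 : V n) 1 => (p.2.1, p.1, p.2.2))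
    fun_prop

theorem EE_mp (n : ℕ) : MeasurePreserving (EE n) (collMeas n) (collMeas n) := by
  have := sph_fin n
  have h1 := measurePreserving_prodAssoc (volume : Measure (V n)) (volume : Measure (V n)) (sphMeas n)
  have h2 : MeasurePreserving (Prod.map Prod.swap id) (((volume : Measure (V n)).prod (volume : Measure (V n))).prod (sphMeas n)) (((volume : Measure (V n)).prod (volume : Measure (V n))).prod (sphMeas n)) :=
    (Measure.measurePreserving_swap).prod (MeasurePreserving.id _)
  exact h1.comp (h2.comp (h1.symm))

/-- the `σ` kernel -/
def bsig (n : ℕ) (CΦ γ : ℝ) (b : ℝ → ℝ) (k : ℤ) (vs : V n) (p : V n × Metric.sphere (0 : V n) 1) : ℝ :=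
  Bker CΦ γ b p.1 vs p.2 * dy k ‖vprime p.1 vs p.2 - p.1‖

theorem dy_meas (k : ℤ) : Measurable (dy k) := by
  unfold dy
  exact measurable_const.indicator measurableSet_Ioc

theorem bsig_meas2 {n : ℕ} {b : ℝ → ℝ} (hb : Measurable b) (CΦ γ : ℝ) (k : ℤ) :
    Measurable (fun q : V n × V n × Metric.sphere (0 : V n) 1 => bsig n CΦ γ b k q.1 q.2) := by
  have := dy_meas k
  unfold bsig Bker vprime
  fun_prop

theorem bsig_meas {n : ℕ} {b : ℝ → ℝ} (hb : Measurable b) (CΦ γ : ℝ) (k : ℤ) (vs : V n) : Measurable (bsig n CΦ γ b k vs) := by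
  have := dy_meas k
  unfold bsig Bker vprime
  fun_prop

theorem bsig_nonneg {n : ℕ} {b : ℝ → ℝ} (hb : ∀ t, 0 ≤ b t) {CΦ : ℝ} (hC : 0 < CΦ) (γ : ℝ) (k : ℤ) (vs : V n) (p) : 0 ≤ bsig n CΦ γ b k vs p := by
  refine mul_nonneg (mul_nonneg (by positivity) (hb _)) ?_
  unfold dy
  exact indicator_nonneg (fun _ _ => zero_le_one) _

theorem sig_lint {n : ℕ} (hn : 2 ≤ n) {b : ℝ → ℝ} (hb : Measurable b) (hb0 : ∀ t, 0 ≤ b t) {CΦ : ℝ} (hC : 0 < CΦ) (γ : ℝ) (k : ℤ) (vs : V n)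
    (G : V n × V n → ℝ≥0∞) (hG : Measurable G) :
    ∫⁻ p, ENNReal.ofReal (bsig n CΦ γ b k vs p) * G (p.1, vprime p.1 vs p.2) ∂lam n =
    ∫⁻ p, ENNReal.ofReal (bbf n CΦ γ b k vs p) * G (p.1, vp vs p.1 p.2) ∂lam n := by
  have m1 := bsig_meas hb CΦ γ k vs
  have m2 := bbf_meas hb CΦ γ k vs
  have h3 : Measurable (fun p : V n × Metric.sphere (0 : V n) 1 => vp vs p.1 p.2) := measurable_vp (by fun_prop) (by fun_prop) (by fun_prop)
  have h4 : Measurable (fun p : V n × Metric.sphere (0 : V n) 1 => vprime p.1 vs p.2) := by unfold vprime; fun_prop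
  rw [lintegral_prod _ (by fun_prop), lintegral_prod _ (by fun_prop)]
  refine lintegral_congr_ae ?_
  filter_upwards [ae_ne hn vs] with v hv
  exact ident1 hn hb hb0 hC γ k hv (fun w => G (v, w)) (by fun_prop)

theorem sig_int {n : ℕ} (hn : 2 ≤ n) {b : ℝ → ℝ} (hb : Measurable b) (hb0 : ∀ t, 0 ≤ b t) {CΦ : ℝ} (hC : 0 < CΦ) (γ : ℝ) (k : ℤ) (vs : V n)
    {f h : V n → ℝ} (hf : Measurable f) (hh : Measurable h) :
    ∫ p, bsig n CΦ γ b k vs p * (f p.1 * (h (vprime p.1 vs p.2) - h p.1)) ∂lam n = Tvs n CΦ γ b k vs f h := by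
  have m1 := bsig_meas hb CΦ γ k vs
  have m2 := bbf_meas hb CΦ γ k vs
  have h3 : Measurable (fun p : V n × Metric.sphere (0 : V n) 1 => vp vs p.1 p.2) := measurable_vp (by fun_prop) (by fun_prop) (by fun_prop)
  have h4 : Measurable (fun p : V n × Metric.sphere (0 : V n) 1 => vprime p.1 vs p.2) := by unfold vprime; fun_prop
  exact transfer (p := fun p : V n × Metric.sphere (0 : V n) 1 => (p.1, vprime p.1 vs p.2)) (q := fun p : V n × Metric.sphere (0 : V n) 1 => (p.1, vp vs p.1 p.2)) m1 m2 (bsig_nonneg hb0 hC γ k vs) (bbf_nonneg hb0 hC γ k vs) (by fun_prop) (by fun_prop)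
    (fun G hG => sig_lint hn hb hb0 hC γ k vs G hG) (fun q => f q.1 * (h q.2 - h q.1)) (by fun_prop)

theorem Tker_EE {n : ℕ} (CΦ γ : ℝ) (b : ℝ → ℝ) (g f h : V n → ℝ) (k : ℤ) (q : V n × V n × Metric.sphere (0 : V n) 1) :
    Tker CΦ γ b g f h k (EE n q) = g q.1 * (bsig n CΦ γ b k q.1 q.2 * (f q.2.1 * (h (vprime q.2.1 q.1 q.2.2) - h q.2.1))) := by
  show Bker CΦ γ b q.2.1 q.1 q.2.2 * dy k ‖vprime q.2.1 q.1 q.2.2 - q.2.1‖ * g q.1 * f q.2.1 * (h (vprime q.2.1 q.1 q.2.2) - h q.2.1) = _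
  unfold bsig
  ring

set_option maxHeartbeats 1000000 in
theorem coll_int {n : ℕ} (hn : 2 ≤ n) {s γ CΦ cb : ℝ} (hs : s ∈ Set.Ioo (0:ℝ) 1) (hγ : -(n:ℝ) < γ) (hCΦ : 0 < CΦ) (hcb : 0 < cb)
    {b : ℝ → ℝ} (hb : KernelAssumptions n s cb b) {g : V n → ℝ} (hg : Measurable g) {Cg : ℝ} (hCg : 0 < Cg) (hU : AssumptionU s γ Cg g)
    {f h : V n → ℝ} (hf : Measurable f) (hh : Measurable h) {M : ℝ} (hM : ∀ v, |h v| ≤ M)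
    (hfin : ∫⁻ v : V n, ENNReal.ofReal (jap v ^ (γ+2*s)) * ENNReal.ofReal |f v| < ⊤) (k : ℤ) :
    Integrable (fun q => Tker CΦ γ b g f h k (EE n q)) ((volume : Measure (V n)).prod (lam n)) := by
  obtain ⟨C, hC, H⟩ := kint hn hs hγ hCΦ hcb
  have mb := bsig_meas2 (n := n) hb.1 CΦ γ k
  have h4 : Measurable (fun q : V n × V n × Metric.sphere (0 : V n) 1 => vprime q.2.1 q.1 q.2.2) := by unfold vprime; fun_prop
  have mabs : Measurable (fun v => ENNReal.ofReal |f v|) := hf.norm.ennreal_ofReal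
  have hM0 : 0 ≤ M := (abs_nonneg _).trans (hM 0)
  have hmeas : Measurable (fun q => Tker CΦ γ b g f h k (EE n q)) := by
    simp only [Tker_EE]
    fun_prop
  refine ⟨hmeas.aestronglyMeasurable, ?_⟩
  rw [hasFiniteIntegral_iff_enorm, lintegral_prod _ hmeas.enorm.aemeasurable]
  set x := ((2:ℝ)^(-k))^(-(2*s)) with hx
  have hx0 : 0 ≤ x := by positivity
  calc _ ≤ ∫⁻ vs, ENNReal.ofReal (2*M*C*x) * (ENNReal.ofReal |g vs| * ENNReal.ofReal (jap vs^(2*s)) * ∫⁻ v, ENNReal.ofReal (‖v - vs‖^(γ+2*s)) * ENNReal.ofReal |f v|) := by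
        refine lintegral_mono fun vs => ?_
        have hj1 : (1:ℝ) ≤ jap vs^(2*s) := one_le_rpow (one_le_jap vs) (by linarith [hs.1])
        have e1 := (H b hb vs k (fun v => ENNReal.ofReal |f v|) mabs).1
        rw [← sig_lint hn hb.1 hb.2.1 hCΦ γ k vs (fun q => ENNReal.ofReal |f q.1|) (by fun_prop)] at e1
        rw [← hx] at e1
        simp only [ENNReal.ofReal_mul hx0, mul_assoc] at e1
        rw [lintegral_const_mul' _ _ ENNReal.ofReal_ne_top] at e1
        calc _ ≤ ∫⁻ p, ENNReal.ofReal (|g vs| * (2*M)) * (ENNReal.ofReal (bsig n CΦ γ b k vs p) * ENNReal.ofReal |f p.1|) ∂lam n := by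
              refine lintegral_mono fun p => ?_
              have b0 := bsig_nonneg hb.2.1 hCΦ γ k vs p
              rw [Tker_EE, ← ENNReal.ofReal_mul b0, ← ENNReal.ofReal_mul (by positivity), ← ofReal_norm]
              refine ENNReal.ofReal_le_ofReal ?_
              dsimp only
              simp only [norm_mul, Real.norm_eq_abs]
              rw [abs_of_nonneg b0]
              have : |h (vprime p.1 vs p.2) - h p.1| ≤ 2*M := by
                have := hM (vprime p.1 vs p.2)
                have := hM p.1
                refine (abs_sub _ _).trans ?_
                linarith
              calc _ ≤ |g vs| * (bsig n CΦ γ b k vs p * (|f p.1| * (2*M))) := by gcongr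
                _ = _ := by ring
          _ = ENNReal.ofReal (|g vs| * (2*M)) * ∫⁻ p, (ENNReal.ofReal (bsig n CΦ γ b k vs p) * ENNReal.ofReal |f p.1|) ∂lam n := lintegral_const_mul' _ _ ENNReal.ofReal_ne_top
          _ ≤ ENNReal.ofReal (|g vs| * (2*M)) * (ENNReal.ofReal C * (ENNReal.ofReal x * ∫⁻ v, ENNReal.ofReal (‖v - vs‖^(γ+2*s)) * ENNReal.ofReal |f v|)) := mul_le_mul_right e1 _
          _ = ENNReal.ofReal (2*M*C*x) * (ENNReal.ofReal |g vs| * 1 * ∫⁻ v, ENNReal.ofReal (‖v - vs‖^(γ+2*s)) * ENNReal.ofReal |f v|) := by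
              rw [ENNReal.ofReal_mul (abs_nonneg _), ENNReal.ofReal_mul (q := x) (by positivity), ENNReal.ofReal_mul (q := C) (by positivity)]; ring
          _ ≤ _ := by
              gcongr
              rw [← ENNReal.ofReal_one]; exact ENNReal.ofReal_le_ofReal hj1
    _ ≤ ENNReal.ofReal (2*M*C*x) * (ENNReal.ofReal Cg * ∫⁻ v, ENNReal.ofReal (jap v^(γ+2*s)) * ENNReal.ofReal |f v|) := by
        rw [lintegral_const_mul' _ _ ENNReal.ofReal_ne_top]
        exact mul_le_mul_right (U1 hs hg hU ⟨by linarith [hs.1], le_rfl⟩ hCg mabs) _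
    _ < ⊤ := ENNReal.mul_lt_top ENNReal.ofReal_lt_top (ENNReal.mul_lt_top ENNReal.ofReal_lt_top hfin)

theorem fin_ae {n : ℕ} {s γ Cg : ℝ} {g : V n → ℝ} (hs : s ∈ Set.Ioo (0:ℝ) 1) (hg : Measurable g) (hU : AssumptionU s γ Cg g)
    (hCg : 0 < Cg) {f : V n → ℝ} (hf : Measurable f)
    (hfin : ∫⁻ v : V n, ENNReal.ofReal (jap v ^ (γ+2*s)) * ENNReal.ofReal |f v| < ⊤) :
    ∀ᵐ vs : V n, g vs ≠ 0 → fin1 s γ vs f := by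
  have mabs : Measurable (fun v => ENNReal.ofReal |f v|) := hf.norm.ennreal_ofReal
  have u := U1 hs hg hU (a := γ+2*s) ⟨by linarith [hs.1], le_rfl⟩ hCg mabs
  have u2 := (u.trans_lt (ENNReal.mul_lt_top ENNReal.ofReal_lt_top hfin)).ne
  have hj := (jap_cont (n := n)).measurable
  have mg : Measurable (fun v => ENNReal.ofReal |g v|) := hg.norm.ennreal_ofReal
  have mI : Measurable (fun vs : V n => ∫⁻ v, ENNReal.ofReal (‖v - vs‖^(γ+2*s)) * ENNReal.ofReal |f v|) := by
    refine Measurable.lintegral_prod_right (f := fun vs v : V n => ENNReal.ofReal (‖v - vs‖^(γ+2*s)) * ENNReal.ofReal |f v|) ?_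
    unfold Function.uncurry
    fun_prop
  filter_upwards [ae_lt_top (by fun_prop) u2] with vs h hgv
  intro htop
  rw [htop, ENNReal.mul_top] at h
  · exact lt_irrefl _ h
  · refine mul_ne_zero ?_ ?_
    · simpa using hgv
    · have := jap_pos vs
      have : 0 < jap vs^(2*s) := by positivity
      simpa using this

theorem sum_all {n : ℕ} (hn : 2 ≤ n) {s γ CΦ cb : ℝ} (hs : s ∈ Set.Ioo (0:ℝ) 1) (hγ : -(n:ℝ) < γ) (hCΦ : 0 < CΦ) (hcb : 0 < cb) :
    ∃ C : ℝ, 0 < C ∧ ∀ b : ℝ → ℝ, KernelAssumptions n s cb b → ∀ g : V n → ℝ, Measurable g → ∀ Cg : ℝ, 0 < Cg → AssumptionU s γ Cg g →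
      ∀ (f h : V n → ℝ) (M : ℝ), Measurable f → Measurable h → (∀ v, |f v| ≤ M) → (∀ v, |h v| ≤ M) →
      ∫⁻ v : V n, ENNReal.ofReal (jap v ^ (γ+2*s)) * ENNReal.ofReal |f v| < ⊤ →
      ∫⁻ v : V n, ENNReal.ofReal (jap v ^ (γ+2*s)) * ENNReal.ofReal |h v| < ⊤ →
      (∀ k : ℤ, Integrable (Tker CΦ γ b g f h k) (collMeas n)) ∧
      ∑' k : ℤ, ENNReal.ofReal |∫ p, Tker CΦ γ b g f h k p ∂(collMeas n)| ≤
        ENNReal.ofReal (C * Cg) * ((L2e (γ+2*s) f + NdotSq s γ f) + (L2e (γ+2*s) h + NdotSq s γ h)) := by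
  obtain ⟨C, hC, H⟩ := sum_vs hn hs hγ hCΦ hcb
  refine ⟨C * 2 * 2^|(γ+2*s+1)/2|, by positivity, ?_⟩
  intro b hb g hg Cg hCg hU f h M hf hh hfM hhM ff fh
  have := sph_fin n
  have hi := coll_int hn hs hγ hCΦ hcb hb hg hCg hU hf hh hhM ff
  have hI : ∀ k, Integrable (Tker CΦ γ b g f h k) (collMeas n) := fun k =>
    ((EE_mp n).integrable_comp_emb (EE n).measurableEmbedding).1 (hi k)
  refine ⟨hI, ?_⟩
  set F : ℤ → V n → ℝ := fun k vs => ∫ p, Tker CΦ γ b g f h k (EE n (vs, p)) ∂lam n with hF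
  have e1 : ∀ k, ∫ p, Tker CΦ γ b g f h k p ∂(collMeas n) = ∫ vs, F k vs := by
    intro k
    rw [← (EE_mp n).integral_comp (EE n).measurableEmbedding]
    exact integral_prod _ (hi k)
  have e2 : ∀ k vs, F k vs = g vs * Tvs n CΦ γ b k vs f h := by
    intro k vs
    simp only [hF, Tker_EE]
    rw [integral_const_mul, sig_int hn hb.1 hb.2.1 hCΦ γ k vs hf hh]
  have mF : ∀ k, AEMeasurable (fun vs => ‖F k vs‖ₑ) := fun k =>
    (hi k).integral_prod_left.aestronglyMeasurable.enorm
  have mX := XX_meas hf hh s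
  have mg : Measurable (fun v => ENNReal.ofReal |g v|) := hg.norm.ennreal_ofReal
  have hj := (jap_cont (n := n)).measurable
  have mI : ∀ a : ℝ, Measurable (fun vs : V n => ∫⁻ v, ENNReal.ofReal (‖v - vs‖^a) * XX s f h v) := by
    intro a
    refine Measurable.lintegral_prod_right (f := fun vs v : V n => ENNReal.ofReal (‖v - vs‖^a) * XX s f h v) ?_
    unfold Function.uncurry
    fun_prop
  have mI1 := mI γ
  have mI2 := mI (γ+2*s)
  have u1 := U1 hs hg hU (a := γ) ⟨le_rfl, by linarith [hs.1]⟩ hCg mX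
  have u2 := U1 hs hg hU (a := γ+2*s) ⟨by linarith [hs.1], le_rfl⟩ hCg mX
  have xn := XX_N hs γ hf hh
  set NN := ((L2e (γ+2*s) f + NdotSq s γ f) + (L2e (γ+2*s) h + NdotSq s γ h)) with hNN
  have u1' : ∫⁻ v, ENNReal.ofReal (jap v^γ) * XX s f h v ≤ ∫⁻ v, ENNReal.ofReal (jap v^(γ+2*s)) * XX s f h v := by
    refine lintegral_mono fun v => ?_
    refine mul_le_mul' (ENNReal.ofReal_le_ofReal ?_) le_rfl
    exact rpow_le_rpow_of_exponent_le (one_le_jap v) (by linarith [hs.1])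
  calc _ ≤ ∑' k : ℤ, ∫⁻ vs, ‖F k vs‖ₑ := by
        refine ENNReal.tsum_le_tsum fun k => ?_
        rw [e1, ← Real.norm_eq_abs, ofReal_norm]
        exact enorm_integral_le_lintegral_enorm _
    _ = ∫⁻ vs, ∑' k : ℤ, ‖F k vs‖ₑ := (lintegral_tsum mF).symm
    _ ≤ ∫⁻ vs, ENNReal.ofReal C * ((ENNReal.ofReal |g vs| * ENNReal.ofReal (jap vs^(2*s)) * ∫⁻ v, ENNReal.ofReal (‖v - vs‖^γ) * XX s f h v) +
          (ENNReal.ofReal |g vs| * ENNReal.ofReal (jap vs^(2*s)) * ∫⁻ v, ENNReal.ofReal (‖v - vs‖^(γ+2*s)) * XX s f h v)) := by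
        refine lintegral_mono_ae ?_
        filter_upwards [fin_ae hs hg hU hCg hf ff, fin_ae hs hg hU hCg hh fh] with vs a1 a2
        simp only [e2, enorm_mul]
        rw [ENNReal.tsum_mul_left]
        by_cases hgv : g vs = 0
        · simp [hgv]
        refine (mul_le_mul_right (H b hb f h M hf hh hfM hhM vs (a1 hgv) (a2 hgv)) _).trans (le_of_eq ?_)
        simp only [add_mul]
        rw [lintegral_add_left (by fun_prop), ENNReal.ofReal_mul hC.le, ← ofReal_norm (g vs), Real.norm_eq_abs]
        ring
    _ = ENNReal.ofReal C * ((∫⁻ vs, ENNReal.ofReal |g vs| * ENNReal.ofReal (jap vs^(2*s)) * ∫⁻ v, ENNReal.ofReal (‖v - vs‖^γ) * XX s f h v) +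
          (∫⁻ vs, ENNReal.ofReal |g vs| * ENNReal.ofReal (jap vs^(2*s)) * ∫⁻ v, ENNReal.ofReal (‖v - vs‖^(γ+2*s)) * XX s f h v)) := by
        rw [lintegral_const_mul' _ _ ENNReal.ofReal_ne_top, lintegral_add_left (by fun_prop)]
    _ ≤ ENNReal.ofReal C * (ENNReal.ofReal Cg * (ENNReal.ofReal (2^|(γ+2*s+1)/2|) * NN) + ENNReal.ofReal Cg * (ENNReal.ofReal (2^|(γ+2*s+1)/2|) * NN)) := by
        refine mul_le_mul_right (add_le_add (u1.trans ?_) (u2.trans ?_)) _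
        · exact mul_le_mul_right (u1'.trans xn) _
        · exact mul_le_mul_right xn _
    _ = _ := by
        rw [ENNReal.ofReal_mul (q := Cg) (by positivity), ENNReal.ofReal_mul (q := 2^|(γ+2*s+1)/2|) (by positivity), ENNReal.ofReal_mul (q := 2) (by positivity), ENNReal.ofReal_ofNat 2]
        ring

theorem N_smul {n : ℕ} (s γ t : ℝ) (f : V n → ℝ) :
    L2e (γ+2*s) (fun v => t * f v) + NdotSq s γ (fun v => t * f v) = ENNReal.ofReal (t^2) * (L2e (γ+2*s) f + NdotSq s γ f) := by
  unfold L2e NdotSq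
  rw [mul_add, ← lintegral_const_mul' _ _ ENNReal.ofReal_ne_top, ← lintegral_const_mul' _ _ ENNReal.ofReal_ne_top]
  congr 1
  · refine lintegral_congr fun v => ?_
    rw [← ENNReal.ofReal_mul (by positivity)]; congr 1; ring
  · refine lintegral_congr fun v => ?_
    rw [← lintegral_const_mul' _ _ ENNReal.ofReal_ne_top]
    refine lintegral_congr fun w => ?_
    dsimp only
    split_ifs
    · rw [← ENNReal.ofReal_mul (by positivity)]; congr 1; ring
    · simp

theorem opt {S K A B : ℝ≥0∞} (hK : K ≠ 0) (hA : A ≠ 0) (hB : B ≠ 0)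
    (H : ∀ t : ℝ, 0 < t → S ≤ K * (ENNReal.ofReal (t^2) * A + ENNReal.ofReal ((t⁻¹)^2) * B)) :
    S ≤ 2 * K * A^(2⁻¹:ℝ) * B^(2⁻¹:ℝ) := by
  have h2 : (0:ℝ) < 2⁻¹ := by norm_num
  have pA : A^(2⁻¹:ℝ) ≠ 0 := by simp [ENNReal.rpow_eq_zero_iff, hA]
  have pB : B^(2⁻¹:ℝ) ≠ 0 := by simp [ENNReal.rpow_eq_zero_iff, hB]
  by_cases hA' : A = ⊤
  · rw [hA', ENNReal.top_rpow_of_pos h2, ENNReal.mul_top (by simp [hK]), ENNReal.top_mul pB]; exact le_top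
  by_cases hB' : B = ⊤
  · rw [hB', ENNReal.top_rpow_of_pos h2, ENNReal.mul_top (mul_ne_zero (by simp [hK]) pA)]; exact le_top
  obtain ⟨a, ha, rfl⟩ : ∃ a : ℝ, 0 < a ∧ A = ENNReal.ofReal a := ⟨A.toReal, ENNReal.toReal_pos hA hA', (ENNReal.ofReal_toReal hA').symm⟩
  obtain ⟨c, hc, rfl⟩ : ∃ a : ℝ, 0 < a ∧ B = ENNReal.ofReal a := ⟨B.toReal, ENNReal.toReal_pos hB hB', (ENNReal.ofReal_toReal hB').symm⟩
  have hsa : 0 < √a := sqrt_pos.2 ha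
  have hsc : 0 < √c := sqrt_pos.2 hc
  refine (H (√(√c/√a)) (by positivity)).trans (le_of_eq ?_)
  rw [ENNReal.ofReal_rpow_of_pos ha, ENNReal.ofReal_rpow_of_pos hc, ← ENNReal.ofReal_mul (by positivity), ← ENNReal.ofReal_mul (by positivity),
    ← ENNReal.ofReal_add (by positivity) (by positivity), mul_comm 2 K, mul_assoc, mul_assoc, ← ENNReal.ofReal_ofNat 2, ← ENNReal.ofReal_mul (by positivity), ← ENNReal.ofReal_mul (by positivity)]
  congr 2
  rw [inv_pow, sq_sqrt (by positivity), show (2⁻¹:ℝ) = 1/2 by norm_num, ← sqrt_eq_rpow, ← sqrt_eq_rpow]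
  have ea : a = √a * √a := (mul_self_sqrt ha.le).symm
  have ec : c = √c * √c := (mul_self_sqrt hc.le).symm
  generalize √a = x at *
  generalize √c = y at *
  rw [ea, ec]
  field_simp
  norm_num

theorem zero_of_N {n : ℕ} {ℓ : ℝ} {f : V n → ℝ} (hf : Continuous f) (h : L2e ℓ f = 0) : f = 0 := by
  have hj := (jap_cont (n := n)).measurable
  have hfm := hf.measurable
  unfold L2e at h
  rw [lintegral_eq_zero_iff (by fun_prop)] at h
  refine (Continuous.ae_eq_iff_eq volume hf continuous_const).1 ?_
  filter_upwards [h] with v hv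
  have h1 : jap v^ℓ * f v^2 ≤ 0 := ENNReal.ofReal_eq_zero.1 hv
  have : 0 < jap v^ℓ := rpow_pos_of_pos (jap_pos v) _
  have h3 : f v^2 = 0 := le_antisymm (by nlinarith) (sq_nonneg _)
  exact pow_eq_zero_iff (two_ne_zero) |>.1 h3

theorem sch_bdd {n : ℕ} (f : SchwartzMap (V n) ℝ) : ∃ M : ℝ, ∀ v, |f v| ≤ M :=
  ⟨‖f.toBoundedContinuousFunction‖, fun v => f.toBoundedContinuousFunction.norm_coe_le_norm v⟩

/-- **Main upper bound** (Theorem 2, in dyadically decomposed form):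
each dyadic piece is absolutely integrable and
`Σ_{k∈ℤ} |T_k(f,h)| ≤ C C_g |f|_{N^{s,γ}} |h|_{N^{s,γ}}`. -/
theorem main_upper_bound
    (n : ℕ) (hn : 2 ≤ n) (s γ CΦ cb : ℝ)
    (hs : s ∈ Set.Ioo (0:ℝ) 1) (hγ : -(n:ℝ) < γ) (hCΦ : 0 < CΦ) (hcb : 0 < cb) :
    ∃ C : ℝ, 0 < C ∧
      ∀ b : ℝ → ℝ, KernelAssumptions n s cb b →
      ∀ g : V n → ℝ, Measurable g →
      ∀ Cg : ℝ, 0 < Cg → AssumptionU s γ Cg g →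
      ∀ f h : SchwartzMap (V n) ℝ,
        (∀ k : ℤ, Integrable
          (Tker CΦ γ b g (fun v => f v) (fun v => h v) k) (collMeas n)) ∧
        (∑' k : ℤ, ENNReal.ofReal
            |∫ p, Tker CΦ γ b g (fun v => f v) (fun v => h v) k p ∂(collMeas n)|) ≤
          ENNReal.ofReal (C * Cg) *
            (L2e (γ + 2 * s) (fun v => f v) + NdotSq s γ (fun v => f v)) ^ (2⁻¹ : ℝ) *
            (L2e (γ + 2 * s) (fun v => h v) + NdotSq s γ (fun v => h v)) ^ (2⁻¹ : ℝ) := by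
  obtain ⟨C, hC, H⟩ := sum_all hn hs hγ hCΦ hcb
  refine ⟨2 * C, by positivity, ?_⟩
  intro b hb g hg Cg hCg hU f h
  have cf : Continuous (fun v => f v) := f.continuous
  have ch : Continuous (fun v => h v) := h.continuous
  obtain ⟨Mf, hMf⟩ := sch_bdd f
  obtain ⟨Mh, hMh⟩ := sch_bdd h
  have H1 := H b hb g hg Cg hCg hU
  have key : ∀ t : ℝ, 0 < t → (∀ k : ℤ, Integrable
          (Tker CΦ γ b g (fun v => t * f v) (fun v => t⁻¹ * h v) k) (collMeas n)) ∧
        (∑' k : ℤ, ENNReal.ofReal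
            |∫ p, Tker CΦ γ b g (fun v => t * f v) (fun v => t⁻¹ * h v) k p ∂(collMeas n)|) ≤ 
          ENNReal.ofReal (C * Cg) * ((L2e (γ+2*s) (fun v => t * f v) + NdotSq s γ (fun v => t * f v)) + (L2e (γ+2*s) (fun v => t⁻¹ * h v) + NdotSq s γ (fun v => t⁻¹ * h v))) := by
    intro t ht
    have ht' : 0 < t⁻¹ := by positivity
    refine H1 (fun v => t * f v) (fun v => t⁻¹ * h v) (max (t * Mf) (t⁻¹ * Mh)) (by fun_prop) (by fun_prop) ?_ ?_ ?_ ?_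
    · intro v
      rw [abs_mul, abs_of_pos ht]
      exact le_trans (mul_le_mul_of_nonneg_left (hMf v) ht.le) (le_max_left _ _)
    · intro v
      rw [abs_mul, abs_of_pos ht']
      exact le_trans (mul_le_mul_of_nonneg_left (hMh v) ht'.le) (le_max_right _ _)
    · exact sch_fin (γ+2*s) (t • f)
    · exact sch_fin (γ+2*s) (t⁻¹ • h)
  have eT : ∀ t : ℝ, 0 < t → ∀ k : ℤ, Tker CΦ γ b g (fun v => t * f v) (fun v => t⁻¹ * h v) k = Tker CΦ γ b g (fun v => f v) (fun v => h v) k := by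
    intro t ht k
    funext p
    unfold Tker
    field_simp
  have key2 : ∀ t : ℝ, 0 < t → (∑' k : ℤ, ENNReal.ofReal
            |∫ p, Tker CΦ γ b g (fun v => f v) (fun v => h v) k p ∂(collMeas n)|) ≤ 
          ENNReal.ofReal (C * Cg) * (ENNReal.ofReal (t^2) * (L2e (γ+2*s) (fun v => f v) + NdotSq s γ (fun v => f v)) + ENNReal.ofReal ((t⁻¹)^2) * (L2e (γ+2*s) (fun v => h v) + NdotSq s γ (fun v => h v))) := by
    intro t ht
    have h1 := (key t ht).2
    simp only [eT t ht] at h1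
    rw [N_smul, N_smul] at h1
    exact h1
  refine ⟨fun k => ?_, ?_⟩
  · have h1 := (key 1 one_pos).1 k
    rwa [eT 1 one_pos k] at h1
  have triv : (∀ k : ℤ, ∀ p, Tker CΦ γ b g (fun v => f v) (fun v => h v) k p = 0) → (∑' k : ℤ, ENNReal.ofReal
            |∫ p, Tker CΦ γ b g (fun v => f v) (fun v => h v) k p ∂(collMeas n)|) = 0 := by
    intro h0
    simp [h0]
  by_cases hA : L2e (γ+2*s) (fun v => f v) + NdotSq s γ (fun v => f v) = 0
  · have f0 : ∀ v, f v = 0 := congrFun (zero_of_N cf (add_eq_zero.1 hA).1)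
    rw [triv (fun k p => by simp [Tker, f0])]
    exact bot_le
  by_cases hB : L2e (γ+2*s) (fun v => h v) + NdotSq s γ (fun v => h v) = 0
  · have f0 : ∀ v, h v = 0 := congrFun (zero_of_N ch (add_eq_zero.1 hB).1)
    rw [triv (fun k p => by simp [Tker, f0])]
    exact bot_le
  have hK : ENNReal.ofReal (C * Cg) ≠ 0 := by
    have : 0 < C * Cg := by positivity
    simpa using this
  have fin := opt hK hA hB key2
  rw [mul_assoc 2 C Cg, ENNReal.ofReal_mul (by norm_num), ENNReal.ofReal_ofNat 2]
  exact fin
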